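/- arXiv:2008.00519 — 6 statements merged into one kernel-verified Lean document; each statement's English description precedes it below -/
import Mathlib

section
/- Let $n_1,n_2,k\in\mathbb{N}$ and let $\Omega\subseteq\mathbb{R}^{n_1+n_2+k}$ be open. Let $f_0,f_1,\dots,f_{n_1}\in C(\Omega)$ and assume that for every $\phi\in C_c^\infty(\Omega)$ one has $\int_\Omega\big(\sum_{i=1}^{n_1} f_i(x,y,z)\,\partial_{x_i}\phi(x,y,z)+f_0(x,y,z)\phi(x,y,z)\big)\,dx\,dy\,dz=0$, where $(x,y,z)\in\mathbb{R}^{n_1}\times\mathbb{R}^{n_2}\times\mathbb{R}^k$. Then for every $z_0\in\mathbb{R}^k$ such that the slice $\Omega_0:=\{(x,y):(x,y,z_0)\in\Omega\}$ is nonempty, and for every $\phi\in C_c^\infty(\Omega_0)$, one has $\int_{\Omega_0}\big(\sum_{i=1}^{n_1} f_i(x,y,z_0)\,\partial_{x_i}\phi(x,y)+f_0(x,y,z_0)\phi(x,y)\big)\,dx\,dy=0$. -/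
open MeasureTheory

theorem stmt_0 (n₁ n₂ k : ℕ)
    (Ω : Set ((Fin n₁ → ℝ) × (Fin n₂ → ℝ) × (Fin k → ℝ))) (hΩ : IsOpen Ω)
    (f₀ : (Fin n₁ → ℝ) × (Fin n₂ → ℝ) × (Fin k → ℝ) → ℝ)
    (f : Fin n₁ → (Fin n₁ → ℝ) × (Fin n₂ → ℝ) × (Fin k → ℝ) → ℝ)
    (hf₀ : ContinuousOn f₀ Ω) (hf : ∀ i, ContinuousOn (f i) Ω)
    (H : ∀ φ : (Fin n₁ → ℝ) × (Fin n₂ → ℝ) × (Fin k → ℝ) → ℝ,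
      ContDiff ℝ (⊤ : ℕ∞) φ → HasCompactSupport φ → tsupport φ ⊆ Ω →
      ∫ p in Ω, ((∑ i, f i p * fderiv ℝ φ p (Pi.single i 1, 0, 0)) + f₀ p * φ p) = 0)
    (z₀ : Fin k → ℝ)
    (hz₀ : {p : (Fin n₁ → ℝ) × (Fin n₂ → ℝ) | (p.1, p.2, z₀) ∈ Ω}.Nonempty) :
    ∀ φ : (Fin n₁ → ℝ) × (Fin n₂ → ℝ) → ℝ,
      ContDiff ℝ (⊤ : ℕ∞) φ → HasCompactSupport φ →
      tsupport φ ⊆ {p : (Fin n₁ → ℝ) × (Fin n₂ → ℝ) | (p.1, p.2, z₀) ∈ Ω} →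
      ∫ p in {p : (Fin n₁ → ℝ) × (Fin n₂ → ℝ) | (p.1, p.2, z₀) ∈ Ω},
        ((∑ i, f i (p.1, p.2, z₀) * fderiv ℝ φ p (Pi.single i 1, 0))
          + f₀ (p.1, p.2, z₀) * φ p) = 0 := by
  intro φ hφ hφc hφs
  -- the assembling map
  let e : ((Fin n₁ → ℝ) × (Fin n₂ → ℝ)) × (Fin k → ℝ) →
      (Fin n₁ → ℝ) × (Fin n₂ → ℝ) × (Fin k → ℝ) := fun q => (q.1.1, q.1.2, q.2)
  have he : Continuous e := by fun_prop
  let G : ((Fin n₁ → ℝ) × (Fin n₂ → ℝ)) → (Fin k → ℝ) → ℝ := fun p z =>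
    (∑ i, f i (p.1, p.2, z) * fderiv ℝ φ p (Pi.single i 1, 0)) + f₀ (p.1, p.2, z) * φ p
  have hφ0 : ∀ p, p ∉ tsupport φ → φ p = 0 := fun p hp => image_eq_zero_of_notMem_tsupport hp
  have hdφ0 : ∀ p, p ∉ tsupport φ → fderiv ℝ φ p = 0 := fun p hp =>
    image_eq_zero_of_notMem_tsupport (fun h => hp (tsupport_fderiv_subset ℝ h))
  have hG0 : ∀ p z, p ∉ tsupport φ → G p z = 0 := by
    intro p z hp
    simp [G, hφ0 p hp, hdφ0 p hp]
  -- tube lemma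
  obtain ⟨V, U, hV, hU, hKV, hzU, hVU⟩ := generalized_tube_lemma (s := tsupport φ) hφc
    (t := {z₀}) isCompact_singleton (n := Set.preimage e Ω) (hΩ.preimage he) (by
      rintro ⟨p, z⟩ ⟨hp, hz⟩
      obtain rfl : z = z₀ := hz
      exact hφs hp)
  replace hzU : z₀ ∈ U := hzU rfl
  have hKU : ∀ p ∈ tsupport φ, ∀ z ∈ U, (p.1, p.2, z) ∈ Ω := fun p hp z hz =>
    hVU (Set.mk_mem_prod (hKV hp) hz)
  -- continuity of G
  have hdφ : Continuous (fderiv ℝ φ) := hφ.continuous_fderiv (by simp)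
  have hGc : ∀ p, ∀ z ∈ U, ContinuousAt (fun q : ((Fin n₁ → ℝ) × (Fin n₂ → ℝ)) × (Fin k → ℝ) =>
      G q.1 q.2) (p, z) := by
    intro p z hz
    by_cases hp : p ∈ tsupport φ
    · have hm : Ω ∈ nhds (e (p, z)) := hΩ.mem_nhds (hKU p hp z hz)
      have h0 : ContinuousAt (fun q => f₀ (e q)) (p, z) :=
        ContinuousAt.comp (hf₀.continuousAt hm) he.continuousAt
      have h1 : ∀ i, ContinuousAt (fun q => f i (e q)) (p, z) := fun i =>
        ContinuousAt.comp ((hf i).continuousAt hm) he.continuousAt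
      have h2 : ∀ i : Fin n₁, Continuous (fun q : ((Fin n₁ → ℝ) × (Fin n₂ → ℝ)) × (Fin k → ℝ) =>
          fderiv ℝ φ q.1 (Pi.single i 1, 0)) := fun i =>
        (hdφ.comp continuous_fst).clm_apply continuous_const
      have h3 : Continuous (fun q : ((Fin n₁ → ℝ) × (Fin n₂ → ℝ)) × (Fin k → ℝ) => φ q.1) :=
        hφ.continuous.comp continuous_fst
      exact (tendsto_finsetSum _ (fun i _ => (h1 i).mul (h2 i).continuousAt)).add
        (h0.mul h3.continuousAt)
    · have : (fun q : ((Fin n₁ → ℝ) × (Fin n₂ → ℝ)) × (Fin k → ℝ) => G q.1 q.2)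
          =ᶠ[nhds (p, z)] fun _ => 0 := by
        have : ∀ᶠ q : ((Fin n₁ → ℝ) × (Fin n₂ → ℝ)) × (Fin k → ℝ) in nhds (p, z),
            q.1 ∈ (tsupport φ)ᶜ :=
          continuous_fst.continuousAt.eventually
            ((isClosed_tsupport φ).isOpen_compl.mem_nhds hp)
        filter_upwards [this] with q hq using hG0 _ _ hq
      exact continuousAt_const.congr this.symm
  let g : (Fin k → ℝ) → ℝ := fun z => ∫ p, G p z
  have hg : ContinuousOn g U := by
    refine continuousOn_integral_of_compact_support (f := fun z p => G p z) hφc ?_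
      (fun z p _ hp => hG0 p z hp)
    rintro ⟨z, p⟩ ⟨hz, -⟩
    have := hGc p z hz
    exact (ContinuousAt.comp (f := Prod.swap) (x := (z, p)) this
      continuous_swap.continuousAt).continuousWithinAt
  -- the equation for g
  have hgψ : ∀ ψ : (Fin k → ℝ) → ℝ, ContDiff ℝ (⊤ : ℕ∞) ψ → HasCompactSupport ψ →
      tsupport ψ ⊆ U → ∫ z, ψ z • g z = 0 := by
    intro ψ hψ hψc hψs
    have hψ0 : ∀ z, z ∉ tsupport ψ → ψ z = 0 := fun p hp => image_eq_zero_of_notMem_tsupport hp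
    let Φ : (Fin n₁ → ℝ) × (Fin n₂ → ℝ) × (Fin k → ℝ) → ℝ := fun p => φ (p.1, p.2.1) * ψ p.2.2
    have hΦ : ContDiff ℝ (⊤ : ℕ∞) Φ := by
      refine ContDiff.mul (hφ.comp (by fun_prop)) (hψ.comp (by fun_prop))
    have hKc : IsCompact (Set.image e (tsupport φ ×ˢ tsupport ψ)) :=
      (IsCompact.prod hφc hψc).image he
    have hΦ0 : ∀ x, x ∉ Set.image e (tsupport φ ×ˢ tsupport ψ) → Φ x = 0 := by
      intro x hx
      by_contra h
      have h1 := left_ne_zero_of_mul h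
      have h2 := right_ne_zero_of_mul h
      exact hx ⟨((x.1, x.2.1), x.2.2), ⟨subset_tsupport _ h1, subset_tsupport _ h2⟩, rfl⟩
    have hΦs : tsupport Φ ⊆ Ω := by
      refine (closure_minimal (t := Set.image e (tsupport φ ×ˢ tsupport ψ)) (fun x hx => ?_)
        hKc.isClosed).trans ?_
      · by_contra h
        exact hx (hΦ0 x h)
      · rintro _ ⟨⟨p, z⟩, ⟨hp, hz⟩, rfl⟩
        exact hKU p hp z (hψs hz)
    have key := H Φ hΦ (HasCompactSupport.intro hKc hΦ0) hΦs
    rw [setIntegral_eq_integral_of_forall_compl_eq_zero (by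
      intro x hx
      have h1 : x ∉ tsupport Φ := fun h => hx (hΦs h)
      have h2 : fderiv ℝ Φ x = 0 :=
        image_eq_zero_of_notMem_tsupport (fun h => h1 (tsupport_fderiv_subset ℝ h))
      simp [h2, image_eq_zero_of_notMem_tsupport h1])] at key
    have hfd : ∀ p v, fderiv ℝ Φ p (v, 0, 0) =
        ψ p.2.2 * fderiv ℝ φ (p.1, p.2.1) (v, 0) := by
      intro p v
      have hd1 : HasFDerivAt φ (fderiv ℝ φ (p.1, p.2.1)) (p.1, p.2.1) :=
        (hφ.differentiable (by simp) _).hasFDerivAt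
      have hd2 : HasFDerivAt ψ (fderiv ℝ ψ p.2.2) p.2.2 :=
        (hψ.differentiable (by simp) _).hasFDerivAt
      let L1 : (Fin n₁ → ℝ) × (Fin n₂ → ℝ) × (Fin k → ℝ) →L[ℝ] (Fin n₁ → ℝ) × (Fin n₂ → ℝ) :=
        (ContinuousLinearMap.fst ℝ _ _).prod
          ((ContinuousLinearMap.fst ℝ _ _).comp (ContinuousLinearMap.snd ℝ _ _))
      let L2 : (Fin n₁ → ℝ) × (Fin n₂ → ℝ) × (Fin k → ℝ) →L[ℝ] (Fin k → ℝ) :=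
        (ContinuousLinearMap.snd ℝ _ _).comp (ContinuousLinearMap.snd ℝ _ _)
      have h1 : HasFDerivAt (fun p => φ (L1 p)) _ p :=
        HasFDerivAt.comp p (f := L1) (g := φ) hd1 L1.hasFDerivAt
      have h2 : HasFDerivAt (fun p => ψ (L2 p)) _ p :=
        HasFDerivAt.comp p (f := L2) (g := ψ) hd2 L2.hasFDerivAt
      have h3 : HasFDerivAt Φ _ p := h1.mul h2
      rw [h3.fderiv]
      simp [L1, L2]
    have hmp : MeasurePreserving (MeasurableEquiv.prodAssoc :
        ((Fin n₁ → ℝ) × (Fin n₂ → ℝ)) × (Fin k → ℝ) ≃ᵐ _) volume volume :=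
      volume_preserving_prodAssoc
    rw [← hmp.integral_comp'] at key
    have heq : ∀ q : ((Fin n₁ → ℝ) × (Fin n₂ → ℝ)) × (Fin k → ℝ),
        (∑ i, f i (MeasurableEquiv.prodAssoc q) *
          fderiv ℝ Φ (MeasurableEquiv.prodAssoc q) (Pi.single i 1, 0, 0)) +
          f₀ (MeasurableEquiv.prodAssoc q) * Φ (MeasurableEquiv.prodAssoc q)
        = ψ q.2 * G q.1 q.2 := by
      rintro ⟨⟨x, y⟩, z⟩
      have : (MeasurableEquiv.prodAssoc ((x, y), z) :
        (Fin n₁ → ℝ) × (Fin n₂ → ℝ) × (Fin k → ℝ)) = (x, y, z) := rfl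
      simp only [this, hfd, G, Φ, mul_add, Finset.mul_sum]
      congr 1
      · exact Finset.sum_congr rfl fun i _ => by ring
      · ring
    simp only [heq] at key
    have hint : Integrable (fun q : ((Fin n₁ → ℝ) × (Fin n₂ → ℝ)) × (Fin k → ℝ) =>
        ψ q.2 * G q.1 q.2) (volume.prod volume) := by
      apply Continuous.integrable_of_hasCompactSupport
      · rw [continuous_iff_continuousAt]
        rintro ⟨p, z⟩
        by_cases hz : z ∈ tsupport ψ
        · exact (hψ.continuous.comp continuous_snd).continuousAt.mul (hGc p z (hψs hz))
        · have : ∀ᶠ q : ((Fin n₁ → ℝ) × (Fin n₂ → ℝ)) × (Fin k → ℝ) in nhds (p, z),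
              q.2 ∈ (tsupport ψ)ᶜ :=
            continuous_snd.continuousAt.eventually
              ((isClosed_tsupport ψ).isOpen_compl.mem_nhds hz)
          refine continuousAt_const.congr (f := fun _ => (0 : ℝ)) ?_
          filter_upwards [this] with q hq
          rw [hψ0 _ hq, zero_mul]
      · refine HasCompactSupport.intro (IsCompact.prod hφc hψc) ?_
        intro q hq
        by_cases h1 : q.1 ∈ tsupport φ
        · rw [hψ0 _ (fun h2 => hq ⟨h1, h2⟩), zero_mul]
        · rw [hG0 _ _ h1, mul_zero]
    rw [Measure.volume_eq_prod, integral_prod_symm _ hint] at key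
    simpa only [integral_const_mul, smul_eq_mul, g] using key
  have hae := hU.ae_eq_zero_of_integral_contDiff_smul_eq_zero (μ := volume)
    (hg.locallyIntegrableOn hU.measurableSet) hgψ
  have hz : g z₀ = 0 := by
    have h1 : g =ᵐ[volume.restrict U] fun _ => 0 := by
      rw [Filter.EventuallyEq, ae_restrict_iff' hU.measurableSet]
      exact hae
    exact Measure.eqOn_open_of_ae_eq h1 hU hg continuousOn_const hzU
  rw [setIntegral_eq_integral_of_forall_compl_eq_zero]
  · exact hz
  · intro p hp
    exact hG0 p z₀ (fun h => hp (hφs h))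
end

section
/- Let $\Omega\subseteq\mathbb{R}^2$ be open, let $u\in C(\Omega)$ and $g\in C(\Omega)$, and suppose that $u$ is a distributional solution of the Burgers-type equation $\partial_t u - \partial_x(u^2/2) = g$ on $\Omega$, i.e. for all $\phi\in C_c^\infty(\Omega)$, $\int_\Omega\big(-u\,\partial_t\phi + \tfrac{u^2}{2}\,\partial_x\phi\big)\,dt\,dx = \int_\Omega g\,\phi\,dt\,dx$. Let $\gamma:[0,T]\to\Omega$ be a $C^1$ characteristic curve, i.e. $\gamma(t)=(t,\xi(t))$ with $\dot\xi(t)=-u(t,\xi(t))$ for all $t\in[0,T]$. Then $|u(\gamma(T))-u(\gamma(0))|\le \|g\|_{L^\infty(\Omega)}\,T$. -/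
open MeasureTheory

lemma step_exists (δ : ℝ) (hδ : 0 < δ) : ∃ s : ℝ → ℝ, ContDiff ℝ (⊤ : ℕ∞) s ∧
    (∀ t ≤ 0, s t = 0) ∧ (∀ t, δ ≤ t → s t = 1) ∧ Monotone s := by
  refine ⟨fun t => Real.smoothTransition (t / δ), ?_, ?_, ?_, ?_⟩
  · exact Real.smoothTransition.contDiff.comp (contDiff_id.div_const δ)
  · intro t ht
    exact Real.smoothTransition.zero_of_nonpos (div_nonpos_of_nonpos_of_nonneg ht hδ.le)
  · intro t ht
    exact Real.smoothTransition.one_of_one_le ((one_le_div hδ).2 ht)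
  · intro a b hab
    exact Real.smoothTransition.monotone (by gcongr)

lemma window_exists (δ L : ℝ) (hδ : 0 < δ) (hL : 0 ≤ L) : ∃ χ ρ₀ ρ₁ : ℝ → ℝ,
    ContDiff ℝ (⊤ : ℕ∞) χ ∧ (∀ t, HasDerivAt χ (ρ₀ t - ρ₁ t) t) ∧
    Continuous ρ₀ ∧ Continuous ρ₁ ∧ (∀ t, 0 ≤ ρ₀ t) ∧ (∀ t, 0 ≤ ρ₁ t) ∧
    (∀ t, t ∉ Set.Icc 0 δ → ρ₀ t = 0) ∧ (∀ t, t ∉ Set.Icc L (L + δ) → ρ₁ t = 0) ∧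
    (∫ t, ρ₀ t = 1) ∧ (∫ t, ρ₁ t = 1) ∧ (∀ t, 0 ≤ χ t) ∧
    (∀ t, t ∉ Set.Icc 0 (L + δ) → χ t = 0) ∧ (∫ t, χ t = L) := by
  obtain ⟨s, hs, hs0, hs1, hmono⟩ := step_exists δ hδ
  have hd : ∀ t, HasDerivAt s (deriv s t) t := fun t =>
    (hs.differentiable (by simp) t).hasDerivAt
  have hc : Continuous (deriv s) := hs.continuous_deriv (by simp)
  have hpos : ∀ t, 0 ≤ deriv s t := fun t => hmono.deriv_nonneg
  have hz : ∀ t, t ∉ Set.Icc 0 δ → deriv s t = 0 := by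
    intro t ht
    rw [Set.mem_Icc, not_and_or, not_le, not_le] at ht
    rcases ht with ht | ht
    · have : s =ᶠ[nhds t] fun _ => 0 := by
        filter_upwards [Iio_mem_nhds ht] with x hx using hs0 x (le_of_lt hx)
      rw [this.deriv_eq]; simp
    · have : s =ᶠ[nhds t] fun _ => 1 := by
        filter_upwards [Ioi_mem_nhds ht] with x hx using hs1 x (le_of_lt hx)
      rw [this.deriv_eq]; simp
  have hint : ∫ t, deriv s t = 1 := by
    have h1 : ∫ t in (0:ℝ)..δ, deriv s t = 1 := by
      rw [intervalIntegral.integral_eq_sub_of_hasDerivAt (fun t _ => hd t)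
        (hc.intervalIntegrable _ _), hs1 δ le_rfl, hs0 0 le_rfl]; simp
    rw [← h1, intervalIntegral.integral_of_le hδ.le, ← integral_Icc_eq_integral_Ioc]
    exact (setIntegral_eq_integral_of_forall_compl_eq_zero hz).symm
  have hchi0 : ∀ t, t ∉ Set.Icc 0 (L + δ) → s t - s (t - L) = 0 := by
    intro t ht
    rw [Set.mem_Icc, not_and_or, not_le, not_le] at ht
    rcases ht with ht | ht
    · rw [hs0 t ht.le, hs0 (t - L) (by linarith)]; simp
    · rw [hs1 t (by linarith), hs1 (t - L) (by linarith)]; simp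
  refine ⟨fun t => s t - s (t - L), deriv s, fun t => deriv s (t - L), ?_, ?_, hc, ?_, hpos,
    fun t => hpos _, hz, ?_, hint, ?_, ?_, hchi0, ?_⟩
  · exact hs.sub (hs.comp (contDiff_id.sub contDiff_const))
  · intro t
    have := (hd (t - L)).comp t ((hasDerivAt_id t).sub_const L)
    simp only [mul_one] at this
    exact (hd t).sub this
  · exact hc.comp (by fun_prop)
  · intro t ht
    apply hz
    contrapose! ht
    exact ⟨by linarith [ht.1], by linarith [ht.2]⟩
  · rw [integral_sub_right_eq_self (fun t => deriv s t) L]; exact hint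
  · intro t
    exact sub_nonneg.2 (hmono (by linarith))
  · have hii : ∀ a b, IntervalIntegrable s volume a b := fun a b =>
      hs.continuous.intervalIntegrable _ _
    have hii' : ∀ a b, IntervalIntegrable (fun t => s (t - L)) volume a b := fun a b =>
      (hs.continuous.comp (by fun_prop : Continuous fun t : ℝ => t - L)).intervalIntegrable _ _
    rw [← setIntegral_eq_integral_of_forall_compl_eq_zero hchi0, integral_Icc_eq_integral_Ioc,
      ← intervalIntegral.integral_of_le (by linarith),
      intervalIntegral.integral_sub (hii _ _) (hii' _ _),
      intervalIntegral.integral_comp_sub_right (fun t => s t) L]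
    have e1 : ∫ t in (0 - L)..(L + δ - L), s t =
        (∫ t in (0 - L)..0, s t) + ∫ t in (0:ℝ)..(L + δ - L), s t :=
      (intervalIntegral.integral_add_adjacent_intervals (hii _ _) (hii _ _)).symm
    have e2 : ∫ t in (0:ℝ)..(L + δ), s t =
        (∫ t in (0:ℝ)..(L + δ - L), s t) + ∫ t in (L + δ - L)..(L + δ), s t :=
      (intervalIntegral.integral_add_adjacent_intervals (hii _ _) (hii _ _)).symm
    have e3 : ∫ t in (0 - L)..0, s t = 0 := by
      rw [intervalIntegral.integral_congr (g := fun _ => (0:ℝ))]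
      · simp
      · intro t ht
        rw [Set.uIcc_of_le (by linarith)] at ht
        exact hs0 t ht.2
    have e4 : ∫ t in (L + δ - L)..(L + δ), s t = L := by
      rw [intervalIntegral.integral_congr (g := fun _ => (1:ℝ))]
      · simp
      · intro t ht
        rw [Set.uIcc_of_le (by linarith)] at ht
        exact hs1 t (by linarith [ht.1])
    rw [e1, e2, e3, e4]; ring

lemma shear_integral (ζ : ℝ → ℝ) (hζ : Continuous ζ) (f h : ℝ → ℝ) (hf : Continuous f)
    (hh : Continuous h) (a b c d : ℝ) (hf0 : ∀ t, t ∉ Set.Icc a b → f t = 0)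
    (hh0 : ∀ t, t ∉ Set.Icc c d → h t = 0) :
    Integrable (fun p : ℝ × ℝ => f p.1 * h (p.2 - ζ p.1)) ∧
    ∫ p : ℝ × ℝ, f p.1 * h (p.2 - ζ p.1) = (∫ t, f t) * ∫ y, h y := by
  have hi : Integrable (fun p : ℝ × ℝ => f p.1 * h (p.2 - ζ p.1)) := by
    apply Continuous.integrable_of_hasCompactSupport (by fun_prop)
    have hK : IsCompact ((fun p : ℝ × ℝ => (p.1, p.2 + ζ p.1)) '' (Set.Icc a b ×ˢ Set.Icc c d)) :=
      (isCompact_Icc.prod isCompact_Icc).image (by fun_prop)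
    apply HasCompactSupport.intro hK
    intro p hp
    by_cases h1 : p.1 ∈ Set.Icc a b
    · by_cases h2 : p.2 - ζ p.1 ∈ Set.Icc c d
      · exact absurd ⟨(p.1, p.2 - ζ p.1), ⟨h1, h2⟩, by simp⟩ hp
      · rw [hh0 _ h2, mul_zero]
    · rw [hf0 _ h1, zero_mul]
  refine ⟨hi, ?_⟩
  rw [Measure.volume_eq_prod] at hi ⊢
  rw [integral_prod _ hi]
  simp only [integral_const_mul]
  rw [← integral_mul_const]
  congr 1
  ext t
  rw [integral_sub_right_eq_self (fun y => h y) (ζ t)]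

lemma core (u g : ℝ × ℝ → ℝ) (hu : Continuous u) (hg : Continuous g) (K : Set (ℝ × ℝ))
    (hK : IsCompact K) (C : ℝ) (hC0 : 0 ≤ C) (hC : ∀ p ∈ K, |g p| ≤ C)
    (hdistr : ∀ φ : ℝ × ℝ → ℝ, ContDiff ℝ (⊤ : ℕ∞) φ → HasCompactSupport φ → tsupport φ ⊆ K →
      ∫ p, (-(u p) * fderiv ℝ φ p (1, 0) + (u p) ^ 2 / 2 * fderiv ℝ φ p (0, 1)) =
        ∫ p, g p * φ p)
    (T ε δ κ a b : ℝ) (hδ : 0 < δ) (hδT : δ ≤ T) (hε : 0 < ε)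
    (ζ ζ' : ℝ → ℝ) (hζ : ContDiff ℝ (⊤ : ℕ∞) ζ) (hζ' : ∀ t, HasDerivAt ζ (ζ' t) t)
    (hζc : Continuous ζ')
    (ha : ∀ t ∈ Set.Icc 0 δ, ∀ y ∈ Set.Icc 0 (ε + δ), a ≤ u (t, y + ζ t))
    (hb : ∀ t ∈ Set.Icc (T - δ) T, ∀ y ∈ Set.Icc 0 (ε + δ), u (t, y + ζ t) ≤ b)
    (hκ : ∀ t ∈ Set.Icc 0 T, ∀ y ∈ Set.Icc 0 δ, (u (t, y + ζ t) + ζ' t) ^ 2 ≤ κ)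
    (hmem : ∀ t ∈ Set.Icc 0 T, ∀ y ∈ Set.Icc 0 (ε + δ), (t, y + ζ t) ∈ K) :
    0 ≤ ε * (b - a) + T * κ / 2 + C * ε * T := by
  obtain ⟨χ, ρ₀, ρ₁, hχ, hχd, hρ₀c, hρ₁c, hρ₀, hρ₁, hρ₀z, hρ₁z, hρ₀i, hρ₁i, hχp, hχz, hχi⟩ :=
    window_exists δ (T - δ) hδ (by linarith)
  obtain ⟨η, σ₀, σ₁, hη, hηd, hσ₀c, hσ₁c, hσ₀, hσ₁, hσ₀z, hσ₁z, hσ₀i, hσ₁i, hηp, hηz, hηi⟩ :=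
    window_exists δ ε hδ hε.le
  rw [sub_add_cancel] at hρ₁z hχz
  have hχc := hχ.continuous
  have hηc := hη.continuous
  have hζcc := hζ.continuous
  set φ : ℝ × ℝ → ℝ := fun p => χ p.1 * η (p.2 - ζ p.1) with hφ
  have hφs : ContDiff ℝ (⊤ : ℕ∞) φ := by
    apply ContDiff.mul (hχ.comp contDiff_fst)
    exact hη.comp (contDiff_snd.sub (hζ.comp contDiff_fst))
  have hmemK : ∀ p : ℝ × ℝ, p.1 ∈ Set.Icc 0 T → p.2 - ζ p.1 ∈ Set.Icc 0 (ε + δ) → p ∈ K := by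
    intro p h1 h2
    have := hmem p.1 h1 _ h2
    simpa using this
  set K' : Set (ℝ × ℝ) := {p | p.1 ∈ Set.Icc 0 T ∧ p.2 - ζ p.1 ∈ Set.Icc 0 (ε + δ)} with hK'
  have hK'c : IsClosed K' := by
    apply IsClosed.inter
    · exact isClosed_Icc.preimage continuous_fst
    · exact isClosed_Icc.preimage (by fun_prop : Continuous fun p : ℝ × ℝ => p.2 - ζ p.1)
  have hK'K : K' ⊆ K := fun p hp => hmemK p hp.1 hp.2
  have hφts : tsupport φ ⊆ K' := by
    apply closure_minimal _ hK'c
    intro p hp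
    rw [Function.mem_support] at hp
    constructor
    · by_contra h
      exact hp (by simp [hφ, hχz _ h])
    · by_contra h
      exact hp (by simp [hφ, hηz _ h])
  have hφcs : HasCompactSupport φ := hK.of_isClosed_subset (isClosed_tsupport _)
    (hφts.trans hK'K)
  have hD := hdistr φ hφs hφcs (hφts.trans hK'K)
  have hfd : ∀ p : ℝ × ℝ, ∀ v : ℝ × ℝ, fderiv ℝ φ p v =
      χ p.1 * ((σ₀ (p.2 - ζ p.1) - σ₁ (p.2 - ζ p.1)) * (v.2 - ζ' p.1 * v.1)) +
      η (p.2 - ζ p.1) * ((ρ₀ p.1 - ρ₁ p.1) * v.1) := by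
    intro p v
    have h1 : HasFDerivAt (fun p : ℝ × ℝ => χ p.1) _ p :=
      (hχd p.1).comp_hasFDerivAt p (hasFDerivAt_fst (𝕜 := ℝ))
    have h2 : HasFDerivAt (fun p : ℝ × ℝ => ζ p.1) _ p :=
      (hζ' p.1).comp_hasFDerivAt p (hasFDerivAt_fst (𝕜 := ℝ))
    have h3 : HasFDerivAt (fun p : ℝ × ℝ => p.2 - ζ p.1) _ p :=
      (hasFDerivAt_snd (𝕜 := ℝ)).sub h2
    have h4 : HasFDerivAt (fun p : ℝ × ℝ => η (p.2 - ζ p.1)) _ p :=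
      (hηd (p.2 - ζ p.1)).comp_hasFDerivAt p h3
    have h5 := (h1.mul h4).fderiv
    rw [show φ = (fun p : ℝ × ℝ => χ p.1) * (fun p : ℝ × ℝ => η (p.2 - ζ p.1)) from rfl] 
    rw [h5]
    simp
  simp only [hfd] at hD
  -- integrand
  set I : ℝ × ℝ → ℝ := fun p => -(u p) * (χ p.1 * ((σ₀ (p.2 - ζ p.1) - σ₁ (p.2 - ζ p.1)) *
        (0 - ζ' p.1 * 1)) + η (p.2 - ζ p.1) * ((ρ₀ p.1 - ρ₁ p.1) * 1)) +
      (u p) ^ 2 / 2 * (χ p.1 * ((σ₀ (p.2 - ζ p.1) - σ₁ (p.2 - ζ p.1)) * (1 - ζ' p.1 * 0)) +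
      η (p.2 - ζ p.1) * ((ρ₀ p.1 - ρ₁ p.1) * 0)) with hI
  have hσ₀z' : ∀ y, y ∉ Set.Icc 0 (ε + δ) → σ₀ y = 0 := fun y hy => hσ₀z y fun h =>
    hy ⟨h.1, by linarith [h.2]⟩
  have hσ₁z' : ∀ y, y ∉ Set.Icc 0 (ε + δ) → σ₁ y = 0 := fun y hy => hσ₁z y fun h =>
    hy ⟨by linarith [h.1], h.2⟩
  have hρ₀z' : ∀ y, y ∉ Set.Icc 0 T → ρ₀ y = 0 := fun y hy => hρ₀z y fun h =>
    hy ⟨h.1, by linarith [h.2]⟩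
  have hρ₁z' : ∀ y, y ∉ Set.Icc 0 T → ρ₁ y = 0 := fun y hy => hρ₁z y fun h =>
    hy ⟨by linarith [h.1], h.2⟩
  have hIz : ∀ p, p ∉ K' → I p = 0 := by
    intro p hp
    by_cases h1 : p.1 ∈ Set.Icc 0 T
    · have h2 : p.2 - ζ p.1 ∉ Set.Icc 0 (ε + δ) := fun h => hp ⟨h1, h⟩
      simp [hI, hσ₀z' _ h2, hσ₁z' _ h2, hηz _ h2]
    · simp [hI, hρ₀z' _ h1, hρ₁z' _ h1, hχz _ h1]
  have hK'cpt : IsCompact K' := hK.of_isClosed_subset hK'c hK'K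
  have hIi : Integrable I := by
    apply Continuous.integrable_of_hasCompactSupport (by simp only [hI]; fun_prop)
    exact HasCompactSupport.intro hK'cpt hIz
  have hGi : Integrable (fun p => g p * φ p) := by
    apply Continuous.integrable_of_hasCompactSupport (by simp only [hφ]; fun_prop)
    exact hφcs.mul_left
  have hI0 : ∫ p, (I p - g p * φ p) = 0 := by
    rw [integral_sub hIi hGi]
    linarith
  obtain ⟨i1, e1⟩ := shear_integral ζ hζcc ρ₀ η hρ₀c hηc _ _ _ _ hρ₀z hηz
  obtain ⟨i2, e2⟩ := shear_integral ζ hζcc ρ₁ η hρ₁c hηc _ _ _ _ hρ₁z hηz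
  obtain ⟨i3, e3⟩ := shear_integral ζ hζcc χ σ₀ hχc hσ₀c _ _ _ _ hχz hσ₀z
  obtain ⟨i4, e4⟩ := shear_integral ζ hζcc (fun t => χ t * ζ' t ^ 2) σ₀ (by fun_prop) hσ₀c
    0 T _ _ (fun t ht => by simp [hχz _ ht]) hσ₀z
  obtain ⟨i5, e5⟩ := shear_integral ζ hζcc (fun t => χ t * ζ' t ^ 2) σ₁ (by fun_prop) hσ₁c
    0 T _ _ (fun t ht => by simp [hχz _ ht]) hσ₁z
  obtain ⟨i6, e6⟩ := shear_integral ζ hζcc χ η hχc hηc _ _ _ _ hχz hηz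
  have hle := integral_mono (hIi.sub hGi)
    ((((((i1.const_mul (-a)).add (i2.const_mul b)).add (i3.const_mul (κ / 2))).add
      (i4.const_mul (-1/2))).add (i5.const_mul (1/2))).add (i6.const_mul C)) (by
    intro p
    simp only [Pi.add_apply, Pi.sub_apply]
    by_cases hp : p ∈ K'
    · obtain ⟨hp1, hp2⟩ := hp
      have hpe : (p.1, (p.2 - ζ p.1) + ζ p.1) = p := by simp
      have A1 : a * ρ₀ p.1 * η (p.2 - ζ p.1) ≤ u p * ρ₀ p.1 * η (p.2 - ζ p.1) := by
        by_cases h : p.1 ∈ Set.Icc 0 δ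
        · have := ha _ h _ hp2
          rw [hpe] at this
          exact mul_le_mul_of_nonneg_right (mul_le_mul_of_nonneg_right this (hρ₀ _)) (hηp _)
        · simp [hρ₀z _ h]
      have A2 : u p * ρ₁ p.1 * η (p.2 - ζ p.1) ≤ b * ρ₁ p.1 * η (p.2 - ζ p.1) := by
        by_cases h : p.1 ∈ Set.Icc (T - δ) T
        · have := hb _ h _ hp2
          rw [hpe] at this
          exact mul_le_mul_of_nonneg_right (mul_le_mul_of_nonneg_right this (hρ₁ _)) (hηp _)
        · simp [hρ₁z _ h]
      have A3 : (u p + ζ' p.1) ^ 2 * χ p.1 * σ₀ (p.2 - ζ p.1) ≤ κ * χ p.1 * σ₀ (p.2 - ζ p.1) := by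
        by_cases h : p.2 - ζ p.1 ∈ Set.Icc 0 δ
        · have := hκ _ hp1 _ h
          rw [hpe] at this
          exact mul_le_mul_of_nonneg_right (mul_le_mul_of_nonneg_right this (hχp _)) (hσ₀ _)
        · simp [hσ₀z _ h]
      have A4 : 0 ≤ (u p + ζ' p.1) ^ 2 * χ p.1 * σ₁ (p.2 - ζ p.1) :=
        mul_nonneg (mul_nonneg (sq_nonneg _) (hχp _)) (hσ₁ _)
      have A5 : -(g p) * (χ p.1 * η (p.2 - ζ p.1)) ≤ C * (χ p.1 * η (p.2 - ζ p.1)) := by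
        apply mul_le_mul_of_nonneg_right _ (mul_nonneg (hχp _) (hηp _))
        exact (neg_le_abs _).trans (hC p (hmemK p hp1 hp2))
      simp only [hI, hφ]
      nlinarith [A1, A2, A3, A4, A5]
    · have hφ0 : φ p = 0 := image_eq_zero_of_notMem_tsupport fun h => hp (hφts h)
      rw [hIz p hp, hφ0]
      by_cases h1 : p.1 ∈ Set.Icc 0 T
      · have h2 : p.2 - ζ p.1 ∉ Set.Icc 0 (ε + δ) := fun h => hp ⟨h1, h⟩
        simp [hσ₀z' _ h2, hσ₁z' _ h2, hηz _ h2]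
      · simp [hρ₀z' _ h1, hρ₁z' _ h1, hχz _ h1])
  have hL : ∫ p, (I - fun p => g p * φ p) p = 0 := hI0
  rw [hL] at hle
  rw [integral_add' (by fun_prop) (by fun_prop), integral_add' (by fun_prop) (by fun_prop),
    integral_add' (by fun_prop) (by fun_prop), integral_add' (by fun_prop) (by fun_prop),
    integral_add' (by fun_prop) (by fun_prop)] at hle
  simp only [integral_const_mul] at hle
  rw [e1, e2, e3, e4, e5, e6, hρ₀i, hρ₁i, hηi, hσ₀i, hσ₁i, hχi] at hle
  have hκ0 : 0 ≤ κ := (sq_nonneg _).trans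
    (hκ 0 ⟨le_rfl, by linarith⟩ 0 ⟨le_rfl, hδ.le⟩)
  nlinarith [mul_nonneg hκ0 hδ.le, mul_nonneg (mul_nonneg hC0 hε.le) hδ.le]

lemma approx_curve (T θ : ℝ) (hT : 0 < T) (hθ : 0 < θ) (ξ v : ℝ → ℝ)
    (hv : ContinuousOn v (Set.Icc 0 T)) (hξ : ∀ t ∈ Set.Icc 0 T, HasDerivAt ξ (v t) t) :
    ∃ ζ ζ' : ℝ → ℝ, ContDiff ℝ (⊤ : ℕ∞) ζ ∧ (∀ t, HasDerivAt ζ (ζ' t) t) ∧ Continuous ζ' ∧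
      (∀ t ∈ Set.Icc 0 T, |ζ' t - v t| ≤ θ) ∧ (∀ t ∈ Set.Icc 0 T, |ζ t - ξ t| ≤ θ * T) := by
  obtain ⟨p, hp⟩ := exists_polynomial_near_of_continuousOn 0 T v hv θ hθ
  have hpc : Continuous fun t => p.eval t := p.continuous
  have hd : ∀ t, HasDerivAt (fun t => ξ 0 + ∫ s in (0:ℝ)..t, p.eval s) (p.eval t) t := fun t =>
    (intervalIntegral.integral_hasDerivAt_right (hpc.intervalIntegrable _ _)
      (hpc.stronglyMeasurableAtFilter _ _) hpc.continuousAt).const_add _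
  refine ⟨fun t => ξ 0 + ∫ s in (0:ℝ)..t, p.eval s, fun t => p.eval t, ?_, hd, hpc,
    fun t ht => (hp t ht).le, ?_⟩
  · rw [contDiff_infty_iff_deriv]
    refine ⟨fun t => (hd t).differentiableAt, ?_⟩
    rw [funext fun t => (hd t).deriv]
    simpa using p.contDiff_aeval (𝕜 := ℝ) (⊤ : ℕ∞)
  · intro t ht
    have := Convex.norm_image_sub_le_of_norm_hasDerivWithin_le (s := Set.Icc 0 T) (C := θ)
      (f := fun t => (ξ 0 + ∫ s in (0:ℝ)..t, p.eval s) - ξ t) (f' := fun t => p.eval t - v t)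
      (x := 0) (y := t) (fun x hx => ((hd x).sub (hξ x hx)).hasDerivWithinAt)
      (fun x hx => (hp x hx).le) (convex_Icc _ _) ⟨le_rfl, hT.le⟩ ht
    simp only [intervalIntegral.integral_same, add_zero, sub_self, sub_zero,
      Real.norm_eq_abs] at this
    refine this.trans ?_
    rw [abs_of_nonneg ht.1]
    exact mul_le_mul_of_nonneg_left ht.2 hθ.le

lemma extend_cont (K : Set (ℝ × ℝ)) (hK : IsClosed K) (u : ℝ × ℝ → ℝ) (hu : ContinuousOn u K) :
    ∃ w : ℝ × ℝ → ℝ, Continuous w ∧ ∀ p ∈ K, w p = u p := by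
  obtain ⟨w, hw⟩ := ContinuousMap.exists_restrict_eq hK ⟨fun p : K => u p, continuousOn_iff_continuous_domRestrict.1 hu⟩
  refine ⟨w, w.continuous, fun p hp => ?_⟩
  exact DFunLike.congr_fun hw ⟨p, hp⟩

lemma lower (Ω : Set (ℝ × ℝ)) (hΩ : IsOpen Ω)
    (u g : ℝ × ℝ → ℝ) (hu : ContinuousOn u Ω) (hg : ContinuousOn g Ω)
    (C : ℝ) (hC : ∀ p ∈ Ω, |g p| ≤ C)
    (hdistr : ∀ φ : ℝ × ℝ → ℝ, ContDiff ℝ (⊤ : ℕ∞) φ → HasCompactSupport φ → tsupport φ ⊆ Ω →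
      ∫ p in Ω, (-(u p) * fderiv ℝ φ p (1, 0) + (u p) ^ 2 / 2 * fderiv ℝ φ p (0, 1)) =
        ∫ p in Ω, g p * φ p)
    (T : ℝ) (hT : 0 < T) (ξ : ℝ → ℝ)
    (hmem : ∀ t ∈ Set.Icc 0 T, (t, ξ t) ∈ Ω)
    (hchar : ∀ t ∈ Set.Icc 0 T, HasDerivAt ξ (-(u (t, ξ t))) t) :
    -(C * T) ≤ u (T, ξ T) - u (0, ξ 0) := by
  have h0 : (0:ℝ) ∈ Set.Icc 0 T := ⟨le_rfl, hT.le⟩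
  have h1 : T ∈ Set.Icc 0 T := ⟨hT.le, le_rfl⟩
  have hC0 : 0 ≤ C := (abs_nonneg _).trans (hC _ (hmem 0 h0))
  have hγ : ContinuousOn (fun t => (t, ξ t)) (Set.Icc 0 T) :=
    continuousOn_id.prodMk fun t ht => (hchar t ht).continuousAt.continuousWithinAt
  set Γ := (fun t => (t, ξ t)) '' Set.Icc 0 T with hΓ
  have hΓc : IsCompact Γ := isCompact_Icc.image_of_continuousOn hγ
  have hΓΩ : Γ ⊆ Ω := by rintro _ ⟨t, ht, rfl⟩; exact hmem t ht
  obtain ⟨r, hr, hrΩ⟩ := hΓc.exists_cthickening_subset_open hΩ hΓΩ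
  set K := Metric.cthickening r Γ with hKdef
  have hK : IsCompact K := hΓc.cthickening
  obtain ⟨w, hw, hwu⟩ := extend_cont K hK.isClosed u (hu.mono hrΩ)
  obtain ⟨k, hk, hkg⟩ := extend_cont K hK.isClosed g (hg.mono hrΩ)
  have hΓK : ∀ t ∈ Set.Icc 0 T, (t, ξ t) ∈ K := fun t ht =>
    Metric.self_subset_cthickening _ ⟨t, ht, rfl⟩
  have hD : ∀ φ : ℝ × ℝ → ℝ, ContDiff ℝ (⊤ : ℕ∞) φ → HasCompactSupport φ → tsupport φ ⊆ K →
      ∫ p, (-(w p) * fderiv ℝ φ p (1, 0) + (w p) ^ 2 / 2 * fderiv ℝ φ p (0, 1)) =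
        ∫ p, k p * φ p := by
    intro φ hφ hφc hφK
    have hz : ∀ p, p ∉ K → φ p = 0 := fun p hp =>
      image_eq_zero_of_notMem_tsupport fun h => hp (hφK h)
    have hz' : ∀ p, p ∉ K → fderiv ℝ φ p = 0 := fun p hp =>
      image_eq_zero_of_notMem_tsupport fun h => hp (hφK (tsupport_fderiv_subset ℝ h))
    have := hdistr φ hφ hφc (hφK.trans hrΩ)
    rw [setIntegral_eq_integral_of_forall_compl_eq_zero,
      setIntegral_eq_integral_of_forall_compl_eq_zero] at this
    · convert this using 3 with p p
      · by_cases hp : p ∈ K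
        · rw [hwu p hp]
        · simp [hz' p hp]
      · by_cases hp : p ∈ K
        · rw [hkg p hp]
        · simp [hz p hp]
    · intro p hp
      simp [hz p fun h => hp (hrΩ h)]
    · intro p hp
      simp [hz' p fun h => hp (hrΩ h)]
  have hCk : ∀ p ∈ K, |k p| ≤ C := fun p hp => by rw [hkg p hp]; exact hC p (hrΩ hp)
  have huc := hK.uniformContinuousOn_of_continuous hw.continuousOn
  rw [Metric.uniformContinuousOn_iff] at huc
  rw [← hwu _ (hΓK 0 h0), ← hwu _ (hΓK T h1)]
  have key : ∀ κ > 0, -(C * T) ≤ w (T, ξ T) - w (0, ξ 0) + κ * (2 + T) := by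
    intro κ hκ
    obtain ⟨r₁, hr₁, hu₁⟩ := huc κ hκ
    obtain ⟨ε, hε, hεr, hεr₁⟩ : ∃ ε : ℝ, 0 < ε ∧ 8 * ε ≤ r ∧ 8 * ε ≤ r₁ :=
      ⟨min r r₁ / 8, by positivity, by linarith [min_le_left r r₁],
        by linarith [min_le_right r r₁]⟩
    set κ₁ := √(2 * ε * κ) with hκ₁
    have hκ₁p : 0 < κ₁ := Real.sqrt_pos.2 (by positivity)
    have hκ₁s : κ₁ ^ 2 = 2 * ε * κ := Real.sq_sqrt (by positivity)
    obtain ⟨r₂, hr₂, hu₂⟩ := huc (κ₁ / 2) (by positivity)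
    obtain ⟨d₀, hd₀, hc₀⟩ := Metric.continuousAt_iff.1 (hchar 0 h0).continuousAt ε hε
    obtain ⟨d₁, hd₁, hc₁⟩ := Metric.continuousAt_iff.1 (hchar T h1).continuousAt ε hε
    simp only [Real.dist_eq] at hc₀ hc₁
    obtain ⟨δ, hδ, hδ1, hδ2, hδ3, hδ4, hδ5⟩ : ∃ δ : ℝ, 0 < δ ∧ δ ≤ T ∧ δ ≤ ε ∧ 4 * δ ≤ r₂ ∧
        2 * δ ≤ d₀ ∧ 2 * δ ≤ d₁ := by
      have : ∀ᶠ δ : ℝ in nhdsWithin 0 (Set.Ioi 0), 0 < δ ∧ δ < T ∧ δ < ε ∧ δ < r₂ / 4 ∧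
          δ < d₀ / 2 ∧ δ < d₁ / 2 := by
        filter_upwards [Ioo_mem_nhdsGT hT, Ioo_mem_nhdsGT hε,
          Ioo_mem_nhdsGT (show 0 < r₂ / 4 by positivity),
          Ioo_mem_nhdsGT (show 0 < d₀ / 2 by positivity),
          Ioo_mem_nhdsGT (show 0 < d₁ / 2 by positivity)] with x a b c d e
        exact ⟨a.1, a.2, b.2, c.2, d.2, e.2⟩
      obtain ⟨δ, a, b, c, d, e, f⟩ := this.exists
      exact ⟨δ, a, b.le, c.le, by linarith, by linarith, by linarith⟩
    obtain ⟨θ, hθ, hθ1, hθ2⟩ : ∃ θ : ℝ, 0 < θ ∧ θ ≤ κ₁ / 2 ∧ θ * T ≤ δ := by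
      refine ⟨min (κ₁ / 2) (δ / T), by positivity, min_le_left _ _, ?_⟩
      rw [← le_div_iff₀ hT]
      exact min_le_right _ _
    obtain ⟨ζ, ζ', hζ, hζd, hζc, hζ1, hζ2⟩ := approx_curve T θ hT hθ ξ (fun t => -u (t, ξ t))
      (hu.comp hγ (fun t ht => hmem t ht)).neg hchar
    have hmK : ∀ t ∈ Set.Icc 0 T, ∀ y ∈ Set.Icc 0 (ε + δ), (t, y + ζ t) ∈ K := by
      intro t ht y hy
      have hΓt : (t, ξ t) ∈ Γ := ⟨t, ht, rfl⟩
      refine Metric.mem_cthickening_of_dist_le (t, y + ζ t) (t, ξ t) r Γ hΓt ?_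
      have := abs_le.1 (hζ2 t ht)
      rw [Prod.dist_eq, dist_self, Real.dist_eq]
      apply max_le hr.le
      rw [abs_le]
      constructor <;> linarith [hy.1, hy.2, this.1, this.2]
    have hc := core w k hw hk K hK C hC0 hCk hD T ε δ (κ₁ ^ 2) (w (0, ξ 0) - κ) (w (T, ξ T) + κ)
      hδ hδ1 hε ζ ζ' hζ hζd hζc ?_ ?_ ?_ hmK
    · rw [hκ₁s] at hc
      have : 0 ≤ ε * ((w (T, ξ T) + κ - (w (0, ξ 0) - κ)) + T * κ + C * T) := by
        nlinarith [hc]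
      have := nonneg_of_mul_nonneg_right this hε
      linarith
    · intro t ht y hy
      have ht' : t ∈ Set.Icc 0 T := ⟨ht.1, ht.2.trans hδ1⟩
      have e1 := abs_le.1 (hζ2 t ht')
      have e2 := abs_lt.1 (@hc₀ t (by rw [sub_zero, abs_of_nonneg ht.1]; linarith [ht.2]))
      have := hu₁ _ (hmK t ht' y hy) _ (hΓK 0 h0) (by
        rw [Prod.dist_eq, Real.dist_eq, Real.dist_eq]
        apply max_lt
        · rw [sub_zero, abs_of_nonneg ht.1]; linarith [ht.2]
        · rw [abs_lt]
          constructor <;> linarith [hy.1, hy.2, e1.1, e1.2, e2.1, e2.2])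
      rw [Real.dist_eq] at this
      linarith [(abs_lt.1 this).1]
    · intro t ht y hy
      have ht' : t ∈ Set.Icc 0 T := ⟨by linarith [ht.1], ht.2⟩
      have hat : |t - T| ≤ δ := by rw [abs_le]; constructor <;> linarith [ht.1, ht.2]
      have e1 := abs_le.1 (hζ2 t ht')
      have e2 := abs_lt.1 (@hc₁ t (by linarith))
      have := hu₁ _ (hmK t ht' y hy) _ (hΓK T h1) (by
        rw [Prod.dist_eq, Real.dist_eq, Real.dist_eq]
        apply max_lt
        · simp only; linarith
        · rw [abs_lt]
          constructor <;> linarith [hy.1, hy.2, e1.1, e1.2, e2.1, e2.2])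
      rw [Real.dist_eq] at this
      linarith [(abs_lt.1 this).2]
    · intro t ht y hy
      have e1 := abs_le.1 (hζ2 t ht)
      have e3 := abs_le.1 (hζ1 t ht)
      have := hu₂ _ (hmK t ht y ⟨hy.1, by linarith [hy.2]⟩) _ (hΓK t ht) (by
        rw [Prod.dist_eq, Real.dist_eq, Real.dist_eq]
        apply max_lt
        · simpa using hr₂
        · rw [abs_lt]
          constructor <;> linarith [hy.1, hy.2, e1.1, e1.2])
      rw [Real.dist_eq, hwu _ (hΓK t ht)] at this
      have e4 := abs_lt.1 this
      apply sq_le_sq'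
      · linarith [e3.1, e4.1]
      · linarith [e3.2, e4.2]
  apply le_of_forall_pos_le_add
  intro e he
  have := key (e / (2 + T)) (by positivity)
  rwa [div_mul_cancel₀ _ (by positivity)] at this

/-- The reflection `(t,x) ↦ (t,-x)`. -/
lemma reflect_mp : MeasurePreserving (fun p : ℝ × ℝ => (p.1, -p.2)) volume volume := by
  rw [Measure.volume_eq_prod]
  exact (MeasurePreserving.id volume).prod (Measure.measurePreserving_neg volume)

theorem stmt_1 (Ω : Set (ℝ × ℝ)) (hΩ : IsOpen Ω)
    (u g : ℝ × ℝ → ℝ) (hu : ContinuousOn u Ω) (hg : ContinuousOn g Ω)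
    (C : ℝ) (hC : ∀ p ∈ Ω, |g p| ≤ C)
    (hdistr : ∀ φ : ℝ × ℝ → ℝ, ContDiff ℝ (⊤ : ℕ∞) φ → HasCompactSupport φ → tsupport φ ⊆ Ω →
      ∫ p in Ω, (-(u p) * fderiv ℝ φ p (1, 0) + (u p) ^ 2 / 2 * fderiv ℝ φ p (0, 1)) =
        ∫ p in Ω, g p * φ p)
    (T : ℝ) (hT : 0 ≤ T) (ξ : ℝ → ℝ)
    (hmem : ∀ t ∈ Set.Icc 0 T, (t, ξ t) ∈ Ω)
    (hchar : ∀ t ∈ Set.Icc 0 T, HasDerivAt ξ (-(u (t, ξ t))) t) :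
    |u (T, ξ T) - u (0, ξ 0)| ≤ C * T := by
  rcases hT.eq_or_lt with rfl | hT
  · simp
  have hlow := lower Ω hΩ u g hu hg C hC hdistr T hT ξ hmem hchar
  let Re : (ℝ × ℝ) ≃L[ℝ] (ℝ × ℝ) :=
    (ContinuousLinearEquiv.refl ℝ ℝ).prodCongr (ContinuousLinearEquiv.neg ℝ)
  have hRe : ∀ p, Re p = (p.1, -p.2) := fun p => rfl
  have hRR : ∀ p, Re (Re p) = p := fun p => by simp [hRe]
  have hmp : MeasurePreserving Re volume volume := reflect_mp
  have hemb : MeasurableEmbedding Re := Re.toHomeomorph.measurableEmbedding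
  have hup := lower (Re ⁻¹' Ω) (hΩ.preimage Re.continuous) (fun p => -u (Re p))
    (fun p => -g (Re p)) (hu.comp Re.continuous.continuousOn fun p hp => hp).neg
    (hg.comp Re.continuous.continuousOn fun p hp => hp).neg C
    (fun p hp => by rw [abs_neg]; exact hC _ hp) ?_ T hT (fun t => -ξ t) ?_ ?_
  · simp only [hRe, neg_neg] at hup
    rw [abs_le]
    constructor <;> linarith
  · intro φ hφ hφc hφs
    have hd := hdistr (φ ∘ Re) (hφ.comp Re.contDiff) (hφc.comp_homeomorph Re.toHomeomorph) (by
      have : tsupport (φ ∘ Re) = Re ⁻¹' tsupport φ :=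
        tsupport_comp_eq_preimage φ Re.toHomeomorph
      rw [this]
      intro p hp
      have := hφs hp
      rwa [Set.mem_preimage, hRR] at this)
    have hfd : ∀ p v, fderiv ℝ (φ ∘ Re) p v = fderiv ℝ φ (Re p) (Re v) := by
      intro p v
      rw [Re.comp_right_fderiv]
      rfl
    simp only [hfd, Function.comp, hRR] at hd
    have e1 : Re (1, 0) = (1, 0) := by simp [hRe]
    have e2 : Re (0, 1) = -(0, 1) := by simp [hRe]
    rw [e1, e2] at hd
    simp only [map_neg] at hd
    have hs := fun f : ℝ × ℝ → ℝ => hmp.setIntegral_preimage_emb hemb f Ω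
    rw [← hs, ← hs] at hd
    simp only [hRR] at hd
    simp only [neg_mul, integral_neg]
    rw [← hd, ← integral_neg]
    congr 1
    ext p
    ring
  · intro t ht
    simpa [hRe] using hmem t ht
  · intro t ht
    have := (hchar t ht).neg
    simp only [hRe, neg_neg] at this ⊢
    exact this
end

section
/- Let $\Omega\subseteq\mathbb{R}^2$ be open, $u\in C(\Omega)$, $g\in C(\Omega)$, and suppose $u$ is a distributional solution of $\partial_t u - \partial_x(u^2/2)=g$ on $\Omega$. Let $\gamma(t)=(t,\xi(t))$, $t\in[0,T]$, be a $C^1$ characteristic with $\dot\xi(t)=-u(t,\xi(t))$, and assume a tubular neighborhood $\{(t,x): t\in[0,T],\ \xi(t)-\epsilon_0\le x\le \xi(t)\}\subseteq\Omega$ for some $\epsilon_0>0$. Then for every $0<\epsilon\le\epsilon_0$, $\int_{\xi(T)-\epsilon}^{\xi(T)} u(T,x)\,dx - \int_{\xi(0)-\epsilon}^{\xi(0)} u(0,x)\,dx - \int_0^T\!\!\int_{\xi(t)-\epsilon}^{\xi(t)} g(t,x)\,dx\,dt = -\tfrac12\int_0^T\big(u(t,\xi(t)-\epsilon)-u(t,\xi(t))\big)^2\,dt$.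 -/
open MeasureTheory

lemma aux_conv_deriv (ρ v : ℝ × ℝ → ℝ) (hρ : ContDiff ℝ 1 ρ) (hc : HasCompactSupport ρ)
    (hv : LocallyIntegrable v volume) (p e : ℝ × ℝ) :
    Integrable (fun q => fderiv ℝ ρ (p - q) e * v q) ∧
    fderiv ℝ (convolution ρ v (ContinuousLinearMap.lsmul ℝ ℝ) volume) p e
      = ∫ q, fderiv ℝ ρ (p - q) e * v q := by
  have h := hc.hasFDerivAt_convolution_left (ContinuousLinearMap.lsmul ℝ ℝ) hρ hv p
  have hi := ((hc.fderiv (𝕜 := ℝ)).convolutionExists_left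
    ((ContinuousLinearMap.lsmul ℝ ℝ).precompL (ℝ × ℝ)) (hρ.continuous_fderiv one_ne_zero) hv p).integrable_swap
  constructor
  · have := hi.apply_continuousLinearMap e
    refine this.congr (Filter.Eventually.of_forall fun q => ?_)
    simp [ContinuousLinearMap.precompL_apply]
  · rw [h.fderiv, convolution_eq_swap, ContinuousLinearMap.integral_apply hi]
    refine integral_congr_ae (Filter.Eventually.of_forall fun q => ?_)
    simp [ContinuousLinearMap.precompL_apply]

lemma aux_unif (K : Set (ℝ × ℝ)) (hK : IsCompact K) (Ω : Set (ℝ × ℝ)) (hΩ : IsOpen Ω)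
    (hKΩ : K ⊆ Ω) (h : ℝ × ℝ → ℝ) (hh : ContinuousOn h Ω) (η : ℝ) (hη : 0 < η) :
    ∃ δ > 0, ∀ p ∈ K, ∀ q, dist q p < δ → dist (h q) (h p) ≤ η := by
  obtain ⟨r, hr, hrΩ⟩ := hK.exists_cthickening_subset_open hΩ hKΩ
  have hK' : IsCompact (Metric.cthickening r K) := hK.cthickening
  have hu := hK'.uniformContinuousOn_of_continuous (hh.mono hrΩ)
  rw [Metric.uniformContinuousOn_iff] at hu
  obtain ⟨δ, hδ, H⟩ := hu η hη
  refine ⟨min δ r, lt_min hδ hr, fun p hp q hq => ?_⟩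
  refine (H q ?_ p (Metric.self_subset_cthickening _ hp) (hq.trans_le (min_le_left _ _))).le
  exact Metric.mem_cthickening_of_dist_le q p r K hp (hq.le.trans (min_le_right _ _))

lemma aux_mollify (Ω : Set (ℝ × ℝ)) (hΩ : IsOpen Ω)
    (u g : ℝ × ℝ → ℝ) (hu : ContinuousOn u Ω) (hg : ContinuousOn g Ω)
    (hdistr : ∀ φ : ℝ × ℝ → ℝ, ContDiff ℝ (⊤ : ℕ∞) φ → HasCompactSupport φ → tsupport φ ⊆ Ω →
      ∫ p in Ω, (-(u p) * fderiv ℝ φ p (1, 0) + (u p) ^ 2 / 2 * fderiv ℝ φ p (0, 1)) =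
        ∫ p in Ω, g p * φ p)
    (K : Set (ℝ × ℝ)) (hK : IsCompact K) (hKΩ : K ⊆ Ω) (η : ℝ) (hη : 0 < η) :
    ∃ U F G : ℝ × ℝ → ℝ, ContDiff ℝ 1 U ∧ ContDiff ℝ 1 F ∧ Continuous G ∧
      (∀ p ∈ K, |U p - u p| ≤ η ∧ |F p - u p ^ 2 / 2| ≤ η ∧ |G p - g p| ≤ η ∧
        fderiv ℝ U p (1, 0) - fderiv ℝ F p (0, 1) = G p) := by
  have hf : ContinuousOn (fun p => u p ^ 2 / 2) Ω := (hu.pow 2).div_const 2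
  obtain ⟨r, hr, hrΩ⟩ := hK.exists_cthickening_subset_open hΩ hKΩ
  obtain ⟨δ1, hδ1, H1⟩ := aux_unif K hK Ω hΩ hKΩ u hu η hη
  obtain ⟨δ2, hδ2, H2⟩ := aux_unif K hK Ω hΩ hKΩ _ hf η hη
  obtain ⟨δ3, hδ3, H3⟩ := aux_unif K hK Ω hΩ hKΩ g hg η hη
  set K' := Metric.cthickening r K with hK'def
  have hK' : IsCompact K' := hK.cthickening
  have hmK : MeasurableSet K' := hK'.measurableSet
  obtain ⟨R, hR, hRr, hR1, hR2, hR3⟩ : ∃ R > 0, R ≤ r ∧ R ≤ δ1 ∧ R ≤ δ2 ∧ R ≤ δ3 :=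
    ⟨min (min r δ1) (min δ2 δ3), by positivity, by simp, by simp, by simp, by simp⟩
  let b : ContDiffBump (0 : ℝ × ℝ) := ⟨R / 2, R, by positivity, by linarith⟩
  set ρ := b.normed volume with hρdef
  have hρ : ContDiff ℝ (⊤ : ℕ∞) ρ := b.contDiff_normed
  have hρ1 : ContDiff ℝ 1 ρ := b.contDiff_normed
  have hρc : HasCompactSupport ρ := b.hasCompactSupport_normed
  have hts : tsupport ρ = Metric.closedBall 0 R := b.tsupport_normed_eq
  have hint : ∀ h : ℝ × ℝ → ℝ, ContinuousOn h Ω → Integrable (K'.indicator h) volume := by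
    intro h hh
    exact ((hh.mono hrΩ).integrableOn_compact hK').integrable_indicator hmK
  have hpK : ∀ p ∈ K, ∀ q, dist q p ≤ R → q ∈ K' := fun p hp q hq =>
    Metric.mem_cthickening_of_dist_le q p r K hp (hq.trans hRr)
  have hclose : ∀ h : ℝ × ℝ → ℝ, ContinuousOn h Ω → ∀ δ, R ≤ δ →
      (∀ p ∈ K, ∀ q, dist q p < δ → dist (h q) (h p) ≤ η) → ∀ p ∈ K,
      |convolution ρ (K'.indicator h) (ContinuousLinearMap.lsmul ℝ ℝ) volume p - h p| ≤ η := by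
    intro h hh δ hδ H p hp
    have hpp : K'.indicator h p = h p :=
      Set.indicator_of_mem (hpK p hp p (by simpa using hR.le)) _
    have := b.dist_normed_convolution_le (μ := volume) (g := K'.indicator h) (x₀ := p) (ε := η)
      (hint h hh).aestronglyMeasurable (by
        intro q hq
        have hq : dist q p < R := hq
        rw [hpp, Set.indicator_of_mem (hpK p hp q hq.le)]
        exact H p hp q (hq.trans_le hδ))
    rw [hpp, Real.dist_eq] at this
    exact this
  refine ⟨convolution ρ (K'.indicator u) (ContinuousLinearMap.lsmul ℝ ℝ) volume,
    convolution ρ (K'.indicator fun p => u p ^ 2 / 2) (ContinuousLinearMap.lsmul ℝ ℝ) volume,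
    convolution ρ (K'.indicator g) (ContinuousLinearMap.lsmul ℝ ℝ) volume,
    hρc.contDiff_convolution_left _ hρ1 (hint u hu).locallyIntegrable,
    hρc.contDiff_convolution_left _ hρ1 (hint _ hf).locallyIntegrable,
    hρc.continuous_convolution_left _ hρ1.continuous (hint g hg).locallyIntegrable,
    fun p hp => ⟨hclose u hu δ1 hR1 H1 p hp, hclose _ hf δ2 hR2 H2 p hp,
      hclose g hg δ3 hR3 H3 p hp, ?_⟩⟩
  obtain ⟨i1, e1⟩ := aux_conv_deriv ρ _ hρ1 hρc (hint u hu).locallyIntegrable p (1, 0)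
  obtain ⟨i2, e2⟩ := aux_conv_deriv ρ _ hρ1 hρc (hint _ hf).locallyIntegrable p (0, 1)
  rw [e1, e2, convolution_lsmul_swap, ← integral_sub i1 i2]
  have hz : ∀ q, q ∉ K' → p - q ∉ tsupport ρ := by
    intro q hq hq'
    apply hq
    rw [hts, mem_closedBall_zero_iff, ← dist_eq_norm, dist_comm] at hq'
    exact hpK p hp q hq'
  have hφts : tsupport (fun q => ρ (p - q)) ⊆ K' := by
    refine closure_minimal ?_ hK'.isClosed
    intro q hq
    by_contra hq'
    exact hq (image_eq_zero_of_notMem_tsupport (hz q hq'))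
  have hφd : ∀ q e, fderiv ℝ (fun q => ρ (p - q)) q e = - fderiv ℝ ρ (p - q) e := by
    intro q e
    have h := ((hρ1.differentiable one_ne_zero (p - q)).hasFDerivAt).comp q
      ((hasFDerivAt_id q).const_sub p)
    have h2 : HasFDerivAt (fun q => ρ (p - q)) _ q := h
    rw [h2.fderiv]; simp
  have key := hdistr (fun q => ρ (p - q)) (hρ.comp (contDiff_const.sub contDiff_id))
    (HasCompactSupport.intro hK' fun q hq => image_eq_zero_of_notMem_tsupport (hz q hq))
    (hφts.trans hrΩ)
  simp only [hφd] at key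
  have L1 : ∀ q, -u q * -(fderiv ℝ ρ (p - q)) (1, 0) + u q ^ 2 / 2 * -(fderiv ℝ ρ (p - q)) (0, 1)
     = (fderiv ℝ ρ (p - q)) (1, 0) * K'.indicator u q
      - (fderiv ℝ ρ (p - q)) (0, 1) * K'.indicator (fun p => u p ^ 2 / 2) q := by
    intro q
    by_cases hq : q ∈ K'
    · rw [Set.indicator_of_mem hq, Set.indicator_of_mem hq]; ring
    · rw [fderiv_of_notMem_tsupport ℝ (hz q hq)]; simp
  have L2 : ∀ q, g q * ρ (p - q) = ρ (p - q) • K'.indicator g q := by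
    intro q
    by_cases hq : q ∈ K'
    · rw [Set.indicator_of_mem hq, smul_eq_mul]; ring
    · rw [image_eq_zero_of_notMem_tsupport (hz q hq)]; simp
  simp only [L1, L2] at key
  rw [setIntegral_eq_integral_of_forall_compl_eq_zero, 
    setIntegral_eq_integral_of_forall_compl_eq_zero] at key
  · exact key
  · intro q hq
    rw [Set.indicator_of_notMem (fun h => hq (hrΩ h))]; simp
  · intro q hq
    rw [Set.indicator_of_notMem (fun h => hq (hrΩ h)), Set.indicator_of_notMem (fun h => hq (hrΩ h))]; simp

lemma aux_smooth (U F G : ℝ × ℝ → ℝ) (hU : ContDiff ℝ 1 U) (hF : ContDiff ℝ 1 F)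
    (hG : Continuous G) (ξ d : ℝ → ℝ) (hξ : Continuous ξ) (hd : Continuous d) (T ε : ℝ)
    (hT : 0 ≤ T) (hε : 0 ≤ ε) (hder : ∀ t ∈ Set.Ioo 0 T, HasDerivAt ξ (d t) t)
    (hpde : ∀ t ∈ Set.Icc 0 T, ∀ s ∈ Set.Icc 0 ε,
      fderiv ℝ U (t, ξ t - s) (1, 0) - fderiv ℝ F (t, ξ t - s) (0, 1) = G (t, ξ t - s)) :
    (∫ s in (0:ℝ)..ε, U (T, ξ T - s)) - (∫ s in (0:ℝ)..ε, U (0, ξ 0 - s))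
      - (∫ t in (0:ℝ)..T, ∫ s in (0:ℝ)..ε, G (t, ξ t - s))
      = ∫ t in (0:ℝ)..T, (F (t, ξ t - 0) - F (t, ξ t - ε)
          + d t * (U (t, ξ t - 0) - U (t, ξ t - ε))) := by
  have hUc := hU.continuous
  have hFc := hF.continuous
  have hU' := hU.continuous_fderiv one_ne_zero
  have hF' := hF.continuous_fderiv one_ne_zero
  have hUd : ∀ p, HasFDerivAt U (fderiv ℝ U p) p := fun p =>
    (hU.differentiable one_ne_zero p).hasFDerivAt
  have hFd : ∀ p, HasFDerivAt F (fderiv ℝ F p) p := fun p =>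
    (hF.differentiable one_ne_zero p).hasFDerivAt
  have S1 : ∀ s, ∫ t in (0:ℝ)..T, fderiv ℝ U (t, ξ t - s) (1, d t) = U (T, ξ T - s) - U (0, ξ 0 - s) := by
    intro s
    refine intervalIntegral.integral_eq_sub_of_hasDerivAt_of_le (f := fun t => U (t, ξ t - s)) hT
      (by fun_prop) ?_ (Continuous.intervalIntegrable (by fun_prop) _ _)
    intro t ht
    exact (hUd (t, ξ t - s)).comp_hasDerivAt t
      ((hasDerivAt_id t).prodMk ((hder t ht).sub_const s))
  have S2 : ∀ t, ∫ s in (0:ℝ)..ε, (fderiv ℝ F (t, ξ t - s) (0, 1) + d t * fderiv ℝ U (t, ξ t - s) (0, 1))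
      = F (t, ξ t - 0) - F (t, ξ t - ε) + d t * (U (t, ξ t - 0) - U (t, ξ t - ε)) := by
    intro t
    have hx : ∀ s, HasDerivAt (fun s => ((t, ξ t - s) : ℝ × ℝ)) (0, -1) s := fun s =>
      (hasDerivAt_const s t).prodMk ((hasDerivAt_id s).const_sub (ξ t))
    have := intervalIntegral.integral_eq_sub_of_hasDerivAt (a := 0) (b := ε)
      (f := fun s => -(F (t, ξ t - s) + d t * U (t, ξ t - s)))
      (f' := fun s => fderiv ℝ F (t, ξ t - s) (0, 1) + d t * fderiv ℝ U (t, ξ t - s) (0, 1)) ?_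
      (Continuous.intervalIntegrable (by fun_prop) _ _)
    · rw [this]; ring
    · intro s _
      have h := (((hFd (t, ξ t - s)).comp_hasDerivAt s (hx s)).add
        (((hUd (t, ξ t - s)).comp_hasDerivAt s (hx s)).const_mul (d t))).neg
      refine HasDerivAt.congr_deriv h ?_
      have e : ((0, -1) : ℝ × ℝ) = -(0, 1) := by simp
      rw [e, map_neg, map_neg]; ring
  have hcont : Continuous (Function.uncurry fun t s : ℝ => fderiv ℝ U (t, ξ t - s) (1, d t)) := by
    unfold Function.uncurry; fun_prop
  rw [← intervalIntegral.integral_sub (Continuous.intervalIntegrable (by fun_prop) _ _)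
    (Continuous.intervalIntegrable (by fun_prop) _ _)]
  simp_rw [← S1, ← S2]
  rw [← intervalIntegral_intervalIntegral_swap (F := fun t s : ℝ => fderiv ℝ U (t, ξ t - s) (1, d t))]
  · rw [← intervalIntegral.integral_sub]
    · refine intervalIntegral.integral_congr fun t ht => ?_
      rw [Set.uIcc_of_le hT] at ht
      rw [← intervalIntegral.integral_sub (Continuous.intervalIntegrable (by fun_prop) _ _)
        (Continuous.intervalIntegrable (by fun_prop) _ _)]
      refine intervalIntegral.integral_congr fun s hs => ?_
      rw [Set.uIcc_of_le hε] at hs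
      have e : ((1, d t) : ℝ × ℝ) = (1, 0) + d t • (0, 1) := by simp
      rw [e, map_add, map_smul, ← hpde t ht s hs, smul_eq_mul]; ring
    · exact Continuous.intervalIntegrable (intervalIntegral.continuous_parametric_intervalIntegral_of_continuous' hcont _ _) _ _
    · refine Continuous.intervalIntegrable (intervalIntegral.continuous_parametric_intervalIntegral_of_continuous' (f := fun t s : ℝ => G (t, ξ t - s)) ?_ _ _) _ _
      unfold Function.uncurry; fun_prop
  · exact (hcont.continuousOn.integrableOn_compact (isCompact_uIcc.prod isCompact_uIcc)).mono_set
      (Set.prod_mono Set.uIoc_subset_uIcc Set.uIoc_subset_uIcc)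

lemma aux_close1 (f h : ℝ → ℝ) (hf : Continuous f) (hh : Continuous h) (a η : ℝ) (ha : 0 ≤ a)
    (H : ∀ t ∈ Set.Icc 0 a, |f t - h t| ≤ η) :
    |(∫ t in (0:ℝ)..a, f t) - ∫ t in (0:ℝ)..a, h t| ≤ η * a := by
  rw [← intervalIntegral.integral_sub (hf.intervalIntegrable _ _) (hh.intervalIntegrable _ _)]
  have := intervalIntegral.norm_integral_le_of_norm_le_const (a := 0) (b := a)
    (f := fun t => f t - h t) (C := η) (by
      intro t ht
      rw [Set.uIoc_of_le ha] at ht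
      exact H t ⟨ht.1.le, ht.2⟩)
  rwa [sub_zero, abs_of_nonneg ha] at this

lemma aux_limit (u f g : ℝ → ℝ → ℝ) (hu : Continuous (Function.uncurry u))
    (hf : Continuous (Function.uncurry f)) (hg : Continuous (Function.uncurry g))
    (d : ℝ → ℝ) (hd : Continuous d) (T ε : ℝ) (hT : 0 ≤ T) (hε : 0 ≤ ε)
    (H : ∀ η > 0, ∃ U F G : ℝ → ℝ → ℝ, Continuous (Function.uncurry U) ∧
      Continuous (Function.uncurry F) ∧ Continuous (Function.uncurry G) ∧
      (∀ t ∈ Set.Icc 0 T, ∀ s ∈ Set.Icc 0 ε, |U t s - u t s| ≤ η ∧ |F t s - f t s| ≤ η ∧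
        |G t s - g t s| ≤ η) ∧
      (∫ s in (0:ℝ)..ε, U T s) - (∫ s in (0:ℝ)..ε, U 0 s)
      - (∫ t in (0:ℝ)..T, ∫ s in (0:ℝ)..ε, G t s)
      = ∫ t in (0:ℝ)..T, (F t 0 - F t ε + d t * (U t 0 - U t ε))) :
    (∫ s in (0:ℝ)..ε, u T s) - (∫ s in (0:ℝ)..ε, u 0 s)
      - (∫ t in (0:ℝ)..T, ∫ s in (0:ℝ)..ε, g t s)
      = ∫ t in (0:ℝ)..T, (f t 0 - f t ε + d t * (u t 0 - u t ε)) := by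
  obtain ⟨D, hD⟩ := (isCompact_Icc (a := (0:ℝ)) (b := T)).exists_bound_of_continuousOn hd.continuousOn
  have hD0 : 0 ≤ D := (norm_nonneg _).trans (hD 0 ⟨le_rfl, hT⟩)
  have sl : ∀ {h : ℝ → ℝ → ℝ}, Continuous (Function.uncurry h) → ∀ t, Continuous (h t) :=
    fun hh t => hh.comp (Continuous.prodMk_right t)
  have sr : ∀ {h : ℝ → ℝ → ℝ}, Continuous (Function.uncurry h) → ∀ s, Continuous (fun t => h t s) :=
    fun hh s => hh.comp (Continuous.prodMk_left s)
  set C := 2 * ε + ε * T + (2 + 2 * D) * T with hC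
  have hC0 : 0 ≤ C := by positivity
  rw [← sub_eq_zero, ← abs_nonpos_iff]
  refine le_of_forall_pos_le_add fun κ hκ => ?_
  obtain ⟨U, F, G, cU, cF, cG, hcl, heq⟩ := H (κ / (C + 1)) (by positivity)
  set η := κ / (C + 1) with hη
  have hη0 : 0 < η := by positivity
  have hTT : T ∈ Set.Icc 0 T := ⟨hT, le_rfl⟩
  have h0T : (0:ℝ) ∈ Set.Icc 0 T := ⟨le_rfl, hT⟩
  have h0ε : (0:ℝ) ∈ Set.Icc 0 ε := ⟨le_rfl, hε⟩
  have hεε : ε ∈ Set.Icc 0 ε := ⟨hε, le_rfl⟩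
  have a1 := aux_close1 (U T) (u T) (sl cU T) (sl hu T) ε η hε fun s hs => (hcl T hTT s hs).1
  have a2 := aux_close1 (U 0) (u 0) (sl cU 0) (sl hu 0) ε η hε fun s hs => (hcl 0 h0T s hs).1
  have a3 := aux_close1 (fun t => ∫ s in (0:ℝ)..ε, G t s) (fun t => ∫ s in (0:ℝ)..ε, g t s)
    (intervalIntegral.continuous_parametric_intervalIntegral_of_continuous' cG _ _)
    (intervalIntegral.continuous_parametric_intervalIntegral_of_continuous' hg _ _) T (η * ε) hT
    fun t ht => aux_close1 (G t) (g t) (sl cG t) (sl hg t) ε η hε fun s hs => (hcl t ht s hs).2.2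
  have a4 := aux_close1 (fun t => F t 0 - F t ε + d t * (U t 0 - U t ε))
    (fun t => f t 0 - f t ε + d t * (u t 0 - u t ε))
    (((sr cF 0).sub (sr cF ε)).add (hd.mul ((sr cU 0).sub (sr cU ε))))
    (((sr hf 0).sub (sr hf ε)).add (hd.mul ((sr hu 0).sub (sr hu ε)))) T (η * (2 + 2 * D)) hT (by
      intro t ht
      obtain ⟨p1, p2, -⟩ := hcl t ht 0 h0ε
      obtain ⟨q1, q2, -⟩ := hcl t ht ε hεε
      have hx : |d t * ((U t 0 - u t 0) - (U t ε - u t ε))| ≤ D * (2 * η) := by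
        rw [abs_mul]
        refine mul_le_mul (hD t ht) ?_ (abs_nonneg _) hD0
        rw [abs_le] at *
        constructor <;> linarith
      rw [abs_le] at *
      constructor <;> linarith)
  have hfin : η * C ≤ κ := by
    rw [hη, div_mul_eq_mul_div, div_le_iff₀ (by positivity)]
    nlinarith
  have hexp : η * C = η * ε + η * ε + η * ε * T + η * (2 + 2 * D) * T := by rw [hC]; ring
  rw [abs_le] at *
  constructor <;> linarith

theorem stmt_2 (Ω : Set (ℝ × ℝ)) (hΩ : IsOpen Ω)
    (u g : ℝ × ℝ → ℝ) (hu : ContinuousOn u Ω) (hg : ContinuousOn g Ω)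
    (hdistr : ∀ φ : ℝ × ℝ → ℝ, ContDiff ℝ (⊤ : ℕ∞) φ → HasCompactSupport φ → tsupport φ ⊆ Ω →
      ∫ p in Ω, (-(u p) * fderiv ℝ φ p (1, 0) + (u p) ^ 2 / 2 * fderiv ℝ φ p (0, 1)) =
        ∫ p in Ω, g p * φ p)
    (T : ℝ) (hT : 0 ≤ T) (ξ : ℝ → ℝ)
    (hchar : ∀ t ∈ Set.Icc 0 T, HasDerivAt ξ (-(u (t, ξ t))) t)
    (ε₀ : ℝ) (hε₀ : 0 < ε₀)
    (htube : ∀ t ∈ Set.Icc 0 T, ∀ x ∈ Set.Icc (ξ t - ε₀) (ξ t), (t, x) ∈ Ω) :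
    ∀ ε : ℝ, 0 < ε → ε ≤ ε₀ →
      (∫ x in (ξ T - ε)..(ξ T), u (T, x)) - (∫ x in (ξ 0 - ε)..(ξ 0), u (0, x))
        - ∫ t in (0:ℝ)..T, ∫ x in (ξ t - ε)..(ξ t), g (t, x)
      = -(1 / 2) * ∫ t in (0:ℝ)..T, (u (t, ξ t - ε) - u (t, ξ t)) ^ 2 := by
  intro ε hε hεε₀
  have hξc : ContinuousOn ξ (Set.Icc 0 T) := fun t ht => (hchar t ht).continuousAt.continuousWithinAt
  obtain ⟨τ, hτc, hτm, hτ⟩ : ∃ τ : ℝ → ℝ, Continuous τ ∧ (∀ t, τ t ∈ Set.Icc 0 T) ∧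
      ∀ t ∈ Set.Icc 0 T, τ t = t :=
    ⟨fun t => Set.projIcc 0 T hT t, by fun_prop, fun t => (Set.projIcc 0 T hT t).2,
      fun t ht => by simp only [Set.projIcc_of_mem hT ht]⟩
  obtain ⟨σ, hσc, hσm, hσ⟩ : ∃ σ : ℝ → ℝ, Continuous σ ∧ (∀ t, σ t ∈ Set.Icc 0 ε) ∧
      ∀ t ∈ Set.Icc 0 ε, σ t = t :=
    ⟨fun t => Set.projIcc 0 ε hε.le t, by fun_prop, fun t => (Set.projIcc 0 ε hε.le t).2,
      fun t ht => by simp only [Set.projIcc_of_mem hε.le ht]⟩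
  have hξτ : Continuous fun t => ξ (τ t) := hξc.comp_continuous hτc hτm
  have hin : ∀ t ∈ Set.Icc 0 T, ∀ s ∈ Set.Icc 0 ε, (t, ξ t - s) ∈ Ω := fun t ht s hs =>
    htube t ht _ ⟨by linarith [hs.2], by linarith [hs.1]⟩
  have hdc : Continuous fun t => -u (τ t, ξ (τ t)) := by
    refine (hu.comp_continuous (hτc.prodMk hξτ) fun t => ?_).neg
    simpa using hin _ (hτm t) 0 ⟨le_rfl, hε.le⟩
  have hcomp : ∀ h : ℝ × ℝ → ℝ, ContinuousOn h Ω →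
      Continuous (Function.uncurry fun t s => h (τ t, ξ (τ t) - σ s)) := by
    intro h hh
    refine hh.comp_continuous (f := fun p : ℝ × ℝ => (τ p.1, ξ (τ p.1) - σ p.2)) ?_
      fun p => hin _ (hτm _) _ (hσm _)
    exact (hτc.comp continuous_fst).prodMk ((hξτ.comp continuous_fst).sub (hσc.comp continuous_snd))
  have hf : ContinuousOn (fun p => u p ^ 2 / 2) Ω := (hu.pow 2).div_const 2
  have hTT : T ∈ Set.Icc 0 T := ⟨hT, le_rfl⟩
  have h0T : (0:ℝ) ∈ Set.Icc 0 T := ⟨le_rfl, hT⟩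
  have h0ε : (0:ℝ) ∈ Set.Icc 0 ε := ⟨le_rfl, hε.le⟩
  have hεε : ε ∈ Set.Icc 0 ε := ⟨hε.le, le_rfl⟩
  have main := aux_limit _ _ _ (hcomp u hu) (hcomp _ hf) (hcomp g hg) _ hdc T ε hT hε.le (by
    intro η hη
    let K : Set (ℝ × ℝ) := (fun p : ℝ × ℝ => (p.1, ξ (τ p.1) - p.2)) '' (Set.Icc 0 T ×ˢ Set.Icc 0 ε)
    have hKc : IsCompact K := (isCompact_Icc.prod isCompact_Icc).image
      (continuous_fst.prodMk ((hξτ.comp continuous_fst).sub continuous_snd))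
    have hKΩ : K ⊆ Ω := by
      rintro _ ⟨⟨t, s⟩, ⟨ht, hs⟩, rfl⟩
      simp only [hτ t ht]
      exact hin t ht s hs
    have hmem : ∀ t ∈ Set.Icc 0 T, ∀ s ∈ Set.Icc 0 ε, (t, ξ (τ t) - s) ∈ K := fun t ht s hs =>
      ⟨(t, s), ⟨ht, hs⟩, rfl⟩
    obtain ⟨U, F, G, cU, cF, cG, H⟩ := aux_mollify Ω hΩ u g hu hg hdistr K hKc hKΩ η hη
    have hmap : Continuous fun p : ℝ × ℝ => (p.1, ξ (τ p.1) - p.2) :=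
      continuous_fst.prodMk ((hξτ.comp continuous_fst).sub continuous_snd)
    refine ⟨fun t s => U (t, ξ (τ t) - s), fun t s => F (t, ξ (τ t) - s),
      fun t s => G (t, ξ (τ t) - s), cU.continuous.comp hmap, cF.continuous.comp hmap,
      cG.comp hmap, ?_, ?_⟩
    · intro t ht s hs
      have := H _ (hmem t ht s hs)
      rw [hσ s hs]
      simp only [hτ t ht] at this ⊢
      exact ⟨this.1, this.2.1, this.2.2.1⟩
    · refine aux_smooth U F G cU cF cG (fun t => ξ (τ t)) (fun t => -u (τ t, ξ (τ t))) hξτ hdc T ε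
        hT hε.le ?_ fun t ht s hs => (H _ (hmem t ht s hs)).2.2.2
      intro t ht
      have ht' : t ∈ Set.Icc 0 T := ⟨ht.1.le, ht.2.le⟩
      rw [hτ t ht']
      refine (hchar t ht').congr_of_eventuallyEq ?_
      filter_upwards [Ioo_mem_nhds ht.1 ht.2] with y hy
      rw [hτ y ⟨hy.1.le, hy.2.le⟩])
  have cv : ∀ h : ℝ × ℝ → ℝ, ∀ t ∈ Set.Icc 0 T,
      ∫ s in (0:ℝ)..ε, h (τ t, ξ (τ t) - σ s) = ∫ x in (ξ t - ε)..(ξ t), h (t, x) := by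
    intro h t ht
    have := intervalIntegral.integral_comp_sub_left (a := 0) (b := ε) (fun x => h (t, x)) (ξ t)
    rw [sub_zero] at this
    rw [← this]
    refine intervalIntegral.integral_congr fun s hs => ?_
    rw [Set.uIcc_of_le hε.le] at hs
    simp only [hτ t ht, hσ s hs]
  rw [cv u T hTT, cv u 0 h0T] at main
  rw [intervalIntegral.integral_congr (g := fun t => ∫ x in (ξ t - ε)..(ξ t), g (t, x))
    (fun t ht => cv g t (by rwa [Set.uIcc_of_le hT] at ht))] at main
  rw [main, ← intervalIntegral.integral_const_mul]
  refine intervalIntegral.integral_congr fun t ht => ?_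
  rw [Set.uIcc_of_le hT] at ht
  simp only [hτ t ht, hσ 0 h0ε, hσ ε hεε, sub_zero]
  ring
end

section
/- Let $\Omega\subseteq\mathbb{R}^2$ be open, $u\in C(\Omega)$, $g\in C(\Omega)$ with $g$ bounded, and suppose $u$ is a distributional solution of $\partial_t u - \partial_x(u^2/2)=g$ on $\Omega$. Then for every characteristic $\gamma(t)=(t,\xi(t))$ with $\dot\xi=-u\circ\gamma$ on $[0,T]$ and $\gamma([0,T])\subseteq\Omega$, the map $t\mapsto u(\gamma(t))$ is Lipschitz on $[0,T]$ with Lipschitz constant at most $\|g\|_{L^\infty(\Omega)}$. -/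
open MeasureTheory

open scoped Convolution in
lemma moll_one (ρ : ContDiffBump (0 : ℝ × ℝ)) (f : ℝ × ℝ → ℝ) (hf : Integrable f) :
    ∃ v : ℝ × ℝ → ℝ, ContDiff ℝ 1 v ∧
      (∀ p e, fderiv ℝ v p e = ∫ q, f q * fderiv ℝ (ρ.normed volume) (p - q) e) ∧
      (∀ p η, (∀ q ∈ Metric.ball p ρ.rOut, dist (f q) (f p) ≤ η) → |v p - f p| ≤ η) := by
  have hcs : HasCompactSupport (ρ.normed (volume : Measure (ℝ × ℝ))) := ρ.hasCompactSupport_normed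
  have hcd : ContDiff ℝ 1 (ρ.normed (volume : Measure (ℝ × ℝ))) := ρ.contDiff_normed
  have hli : LocallyIntegrable f volume := hf.locallyIntegrable
  refine ⟨f ⋆[ContinuousLinearMap.mul ℝ ℝ, volume] (ρ.normed volume), ?_, ?_, ?_⟩
  · exact hcs.contDiff_convolution_right (n := 1) _ hli hcd
  · intro p e
    rw [(hcs.hasFDerivAt_convolution_right _ hli hcd p).fderiv,
      convolution_precompR_apply _ hli (hcs.fderiv ℝ) (hcd.continuous_fderiv (by norm_num))]
    rfl
  · intro p η h
    have h1 := ρ.dist_normed_convolution_le (μ := volume) hf.aestronglyMeasurable h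
    rw [convolution_lsmul_swap, Real.dist_eq] at h1
    convert h1 using 3
    rw [convolution_def]
    congr 1; ext t; simp [mul_comm]

lemma moll (Ω : Set (ℝ × ℝ)) (hΩ : IsOpen Ω)
    (u g : ℝ × ℝ → ℝ) (hu : ContinuousOn u Ω) 
    (C : ℝ) (hC0 : 0 ≤ C) (hC : ∀ p ∈ Ω, |g p| ≤ C)
    (hdistr : ∀ φ : ℝ × ℝ → ℝ, ContDiff ℝ (⊤ : ℕ∞) φ → HasCompactSupport φ → tsupport φ ⊆ Ω →
      ∫ p in Ω, (-(u p) * fderiv ℝ φ p (1, 0) + (u p) ^ 2 / 2 * fderiv ℝ φ p (0, 1)) =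
        ∫ p in Ω, g p * φ p)
    (K : Set (ℝ × ℝ)) (hK : IsCompact K) (hKΩ : K ⊆ Ω) (η : ℝ) (hη : 0 < η) :
    ∃ v w : ℝ × ℝ → ℝ, ContDiff ℝ 1 v ∧ ContDiff ℝ 1 w ∧
      ∀ p ∈ K, |v p - u p| ≤ η ∧ |w p - u p ^ 2 / 2| ≤ η ∧
        |fderiv ℝ v p (1, 0) - fderiv ℝ w p (0, 1)| ≤ C := by
  obtain ⟨r, hr, hrΩ⟩ := hK.exists_cthickening_subset_open hΩ hKΩ
  set K' := Metric.cthickening r K with hK'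
  have hK'c : IsCompact K' := hK.cthickening
  have huc := hu.mono hrΩ
  have huc2 : ContinuousOn (fun p => u p ^ 2 / 2) K' := (huc.pow 2).div_const 2
  obtain ⟨r1, hr1, h1⟩ := Metric.uniformContinuousOn_iff_le.1
    (hK'c.uniformContinuousOn_of_continuous huc) η hη
  obtain ⟨r2, hr2, h2⟩ := Metric.uniformContinuousOn_iff_le.1
    (hK'c.uniformContinuousOn_of_continuous huc2) η hη
  obtain ⟨ε, hε, hεm⟩ : ∃ ε : ℝ, 0 < ε ∧ ε ≤ min r (min r1 r2) :=
    ⟨min r (min r1 r2), by positivity, le_rfl⟩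
  have hεr : ε ≤ r := hεm.trans (min_le_left _ _)
  have hεr1 : ε ≤ r1 := hεm.trans ((min_le_right _ _).trans (min_le_left _ _))
  have hεr2 : ε ≤ r2 := hεm.trans ((min_le_right _ _).trans (min_le_right _ _))
  let ρ : ContDiffBump (0 : ℝ × ℝ) := ⟨ε / 2, ε, by positivity, by linarith⟩
  have hρo : ρ.rOut = ε := rfl
  have hKK' : K ⊆ K' := Metric.self_subset_cthickening K
  have hb : ∀ p ∈ K, Metric.closedBall p ε ⊆ K' := fun p hp =>
    (Metric.closedBall_subset_closedBall hεr).trans (Metric.closedBall_subset_cthickening hp r)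
  have hm : MeasurableSet K' := hK'c.measurableSet
  obtain ⟨v, hv, hv1, hv2⟩ := moll_one ρ (K'.indicator u)
    ((integrable_indicator_iff hm).2 (huc.integrableOn_compact hK'c))
  obtain ⟨w, hw, hw1, hw2⟩ := moll_one ρ (K'.indicator (fun p => u p ^ 2 / 2))
    ((integrable_indicator_iff hm).2 (huc2.integrableOn_compact hK'c))
  refine ⟨v, w, hv, hw, fun p hp => ⟨?_, ?_, ?_⟩⟩
  · have := hv2 p η
    rw [Set.indicator_of_mem (hKK' hp)] at this
    apply this
    intro q hq
    have hq' : q ∈ K' := hb p hp (Metric.ball_subset_closedBall hq)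
    rw [Set.indicator_of_mem hq']
    exact h1 q hq' p (hKK' hp) ((Metric.mem_ball.1 hq).le.trans hεr1)
  · have := hw2 p η
    rw [Set.indicator_of_mem (hKK' hp)] at this
    apply this
    intro q hq
    have hq' : q ∈ K' := hb p hp (Metric.ball_subset_closedBall hq)
    rw [Set.indicator_of_mem hq']
    exact h2 q hq' p (hKK' hp) ((Metric.mem_ball.1 hq).le.trans hεr2)
  · set R : ℝ × ℝ → ℝ := ρ.normed volume with hR
    have hRcd : ContDiff ℝ (⊤ : ℕ∞) R := ρ.contDiff_normed
    have hRd : Differentiable ℝ R := hRcd.differentiable (by simp)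
    have hRcs : HasCompactSupport R := ρ.hasCompactSupport_normed
    have hRts : tsupport R = Metric.closedBall 0 ε := ρ.tsupport_normed_eq
    let φ : ℝ × ℝ → ℝ := fun q => R (p - q)
    have hφ : ContDiff ℝ (⊤ : ℕ∞) φ := hRcd.comp (contDiff_const.sub contDiff_id)
    have hsupp : Function.support φ ⊆ Metric.closedBall p ε := by
      intro q hq
      have : p - q ∈ tsupport R := subset_tsupport _ hq
      rw [hRts, mem_closedBall_zero_iff] at this
      rw [Metric.mem_closedBall, dist_comm, dist_eq_norm]; exact this
    have htsupp : tsupport φ ⊆ Metric.closedBall p ε :=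
      closure_minimal hsupp Metric.isClosed_closedBall
    have hφcs : HasCompactSupport φ :=
      HasCompactSupport.of_support_subset_isCompact (isCompact_closedBall p ε) hsupp
    have hφΩ : tsupport φ ⊆ Ω := htsupp.trans ((hb p hp).trans hrΩ)
    have key := hdistr φ hφ hφcs hφΩ
    have hfd : ∀ q e, fderiv ℝ φ q e = - fderiv ℝ R (p - q) e := by
      intro q e
      have : HasFDerivAt φ ((fderiv ℝ R (p - q)).comp (-(ContinuousLinearMap.id ℝ (ℝ × ℝ)))) q :=
        (hRd (p - q)).hasFDerivAt.comp q ((hasFDerivAt_id q).const_sub p)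
      rw [this.fderiv]; simp
    have hz : ∀ q, q ∉ K' → ∀ e, fderiv ℝ R (p - q) e = 0 := by
      intro q hq e
      have : p - q ∉ tsupport R := by
        rw [hRts, mem_closedBall_zero_iff, ← dist_eq_norm, dist_comm]
        exact fun h => hq (hb p hp h)
      rw [fderiv_of_notMem_tsupport ℝ this]; rfl
    have hint : ∀ f : ℝ × ℝ → ℝ, ContinuousOn f K' → ∀ e,
        Integrable (fun q => K'.indicator f q * fderiv ℝ R (p - q) e) := by
      intro f hf e
      have hi : Integrable (K'.indicator f) :=
        (integrable_indicator_iff hm).2 (hf.integrableOn_compact hK'c)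
      have hc : Continuous fun q => fderiv ℝ R (p - q) e :=
        ((hRcd.continuous_fderiv (by simp)).comp (continuous_const.sub continuous_id)).clm_apply
          continuous_const
      have : (fun q => K'.indicator f q * fderiv ℝ R (p - q) e)
          = K'.indicator (fun q => f q * fderiv ℝ R (p - q) e) := by
        ext q; by_cases h : q ∈ K' <;> simp [h]
      rw [this]
      exact (integrable_indicator_iff hm).2 ((hf.mul hc.continuousOn).integrableOn_compact hK'c)
    have e1 : fderiv ℝ v p (1, 0) - fderiv ℝ w p (0, 1) = ∫ q in Ω, g q * φ q := by
      rw [hv1, hw1, ← integral_sub (hint _ huc _) (hint _ huc2 _), ← key,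
        ← integral_indicator hΩ.measurableSet]
      congr 1; ext q
      by_cases h : q ∈ K'
      · simp only [Set.indicator_of_mem h, Set.indicator_of_mem (hrΩ h), hfd]; ring
      · by_cases h' : q ∈ Ω
        · simp only [Set.indicator_of_mem h', hfd, hz q h]; simp
        · simp [h, h']
    have hφi : Integrable φ := hφ.continuous.integrable_of_hasCompactSupport hφcs
    have hφ0 : ∀ q, 0 ≤ φ q := fun q => ρ.nonneg_normed _
    have hφ1 : ∫ q, φ q = 1 := by
      have := integral_sub_left_eq_self R volume p
      rw [show (∫ q, φ q) = ∫ q, R (p - q) from rfl, this]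
      exact ρ.integral_normed
    rw [e1, ← Real.norm_eq_abs]
    calc ‖∫ q in Ω, g q * φ q‖ ≤ ∫ q in Ω, C * φ q := by
          apply norm_integral_le_of_norm_le (hφi.const_mul C).integrableOn
          refine (ae_restrict_iff' hΩ.measurableSet).2 (Filter.Eventually.of_forall fun q hq => ?_)
          rw [norm_mul, Real.norm_eq_abs, Real.norm_eq_abs, abs_of_nonneg (hφ0 q)]
          exact mul_le_mul_of_nonneg_right (hC q hq) (hφ0 q)
      _ ≤ ∫ q, C * φ q := setIntegral_le_integral (hφi.const_mul C)
          (Filter.Eventually.of_forall fun q => mul_nonneg hC0 (hφ0 q))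
      _ = C := by rw [integral_const_mul, hφ1, mul_one]


lemma strip_deriv (v w : ℝ × ℝ → ℝ) (hv : ContDiff ℝ 1 v) (hw : ContDiff ℝ 1 w)
    (a X : ℝ → ℝ) (ha : Continuous a) (hX : ∀ t, HasDerivAt X (-a t) t) (δ t : ℝ) :
    HasDerivAt (fun t => ∫ y in (0:ℝ)..δ, v (t, X t + y))
      ((∫ y in (0:ℝ)..δ, (fderiv ℝ v (t, X t + y) (1, 0) - fderiv ℝ w (t, X t + y) (0, 1)))
        + ((w (t, X t + δ) - a t * v (t, X t + δ)) - (w (t, X t) - a t * v (t, X t)))) t := by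
  have hXc : Continuous X := continuous_iff_continuousAt.2 fun t => (hX t).continuousAt
  have hvc := hv.continuous_fderiv (by norm_num)
  have hwc := hw.continuous_fderiv (by norm_num)
  have hvd := hv.differentiable (by norm_num)
  have hwd := hw.differentiable (by norm_num)
  have hv0 := hv.continuous
  have hF'c : Continuous (fun q : ℝ × ℝ => fderiv ℝ v (q.1, X q.1 + q.2) (1, -a q.1)) :=
    (hvc.comp (by fun_prop)).clm_apply (by fun_prop)
  obtain ⟨B, hB⟩ := ((isCompact_Icc (a := t - 1) (b := t + 1)).prod
    (isCompact_uIcc (a := (0:ℝ)) (b := δ))).exists_bound_of_continuousOn hF'c.continuousOn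
  have hd : ∀ y x, HasDerivAt (fun x => v (x, X x + y)) (fderiv ℝ v (x, X x + y) (1, -a x)) x := by
    intro y x
    exact (hvd (x, X x + y)).hasFDerivAt.comp_hasDerivAt x
      ((hasDerivAt_id x).prodMk ((hX x).add_const y))
  have main := (intervalIntegral.hasDerivAt_integral_of_dominated_loc_of_deriv_le (μ := volume)
    (F := fun t y => v (t, X t + y)) (F' := fun t y => fderiv ℝ v (t, X t + y) (1, -a t))
    (x₀ := t) (s := Set.Icc (t - 1) (t + 1)) (a := 0) (b := δ) (bound := fun _ => B)
    (Icc_mem_nhds (by linarith) (by linarith))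
    (Filter.Eventually.of_forall fun x => Continuous.aestronglyMeasurable (by fun_prop))
    (Continuous.intervalIntegrable (by fun_prop) _ _)
    ((hF'c.comp (Continuous.prodMk_right t)).aestronglyMeasurable)
    (Filter.Eventually.of_forall fun y hy x hx => hB (x, y) ⟨hx, Set.uIoc_subset_uIcc hy⟩)
    (by simp)
    (Filter.Eventually.of_forall fun y hy x hx => hd y x)).2
  refine HasDerivAt.congr_deriv main (Eq.symm ?_)
  have hwy : ∀ y, HasDerivAt (fun y => w (t, X t + y) - a t * v (t, X t + y))
      (fderiv ℝ w (t, X t + y) (0, 1) - a t * fderiv ℝ v (t, X t + y) (0, 1)) y := by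
    intro y
    have h0 : HasDerivAt (fun y : ℝ => (t, X t + y)) ((0:ℝ), (1:ℝ)) y :=
      (hasDerivAt_const y t).prodMk ((hasDerivAt_id y).const_add (X t))
    exact ((hwd (t, X t + y)).hasFDerivAt.comp_hasDerivAt y h0).sub
      (((hvd (t, X t + y)).hasFDerivAt.comp_hasDerivAt y h0).const_mul (a t))
  have cw : ∀ e, Continuous fun y => fderiv ℝ w (t, X t + y) e := fun e =>
    (hwc.comp (by fun_prop)).clm_apply continuous_const
  have cv : ∀ e, Continuous fun y => fderiv ℝ v (t, X t + y) e := fun e =>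
    (hvc.comp (by fun_prop)).clm_apply continuous_const
  have c1 : Continuous fun y => 
      fderiv ℝ w (t, X t + y) (0, 1) - a t * fderiv ℝ v (t, X t + y) (0, 1) :=
    (cw _).sub (continuous_const.mul (cv _))
  have ftc := intervalIntegral.integral_eq_sub_of_hasDerivAt (a := 0) (b := δ)
    (fun y _ => hwy y) (c1.intervalIntegrable _ _)
  rw [add_zero] at ftc
  have c2 : Continuous fun y => 
      fderiv ℝ v (t, X t + y) (1, 0) - fderiv ℝ w (t, X t + y) (0, 1) := (cv _).sub (cw _)
  rw [← ftc, ← intervalIntegral.integral_add (c2.intervalIntegrable _ _)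
    (c1.intervalIntegrable _ _)]
  congr 1; ext y
  have : ((1:ℝ), -a t) = (1, 0) + (-a t) • ((0:ℝ), (1:ℝ)) := by simp
  rw [this, map_add, map_smul, smul_eq_mul]; ring

lemma strip_ineq (u v w : ℝ × ℝ → ℝ) (hv : ContDiff ℝ 1 v) (hw : ContDiff ℝ 1 w)
    (a X : ℝ → ℝ) (ha : Continuous a) (hX : ∀ t, HasDerivAt X (-a t) t) (δ s τ C η A : ℝ)
    (hsτ : s ≤ τ)
    (h : ∀ t ∈ Set.Icc s τ, ∀ y ∈ Set.uIcc 0 δ,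
      |v (t, X t + y) - u (t, X t + y)| ≤ η ∧ |w (t, X t + y) - u (t, X t + y) ^ 2 / 2| ≤ η ∧
      |fderiv ℝ v (t, X t + y) (1, 0) - fderiv ℝ w (t, X t + y) (0, 1)| ≤ C)
    (hau : ∀ t ∈ Set.Icc s τ, a t = u (t, X t)) (hA : ∀ t ∈ Set.Icc s τ, |a t| ≤ A) :
    -(C * |δ| + 2 * η * (1 + A)) * (τ - s) ≤
      (∫ y in (0:ℝ)..δ, v (τ, X τ + y)) - ∫ y in (0:ℝ)..δ, v (s, X s + y) := by
  have hd := strip_deriv v w hv hw a X ha hX δ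
  refine Convex.mul_sub_le_image_sub_of_le_deriv (convex_Icc s τ)
    (f := fun t => ∫ y in (0:ℝ)..δ, v (t, X t + y))
    (fun t _ => (hd t).continuousAt.continuousWithinAt)
    (fun t _ => (hd t).differentiableAt.differentiableWithinAt) ?_
    s (Set.left_mem_Icc.2 hsτ) τ (Set.right_mem_Icc.2 hsτ) hsτ
  intro t ht
  rw [interior_Icc] at ht
  have ht := Set.Ioo_subset_Icc_self ht
  rw [(hd t).deriv]
  have hI : ‖∫ y in (0:ℝ)..δ, (fderiv ℝ v (t, X t + y) (1, 0) - fderiv ℝ w (t, X t + y) (0, 1))‖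
      ≤ C * |δ - 0| := intervalIntegral.norm_integral_le_of_norm_le_const fun y hy =>
        (h t ht y (Set.uIoc_subset_uIcc hy)).2.2
  rw [sub_zero, Real.norm_eq_abs] at hI
  obtain ⟨p1, p2, -⟩ := h t ht δ Set.right_mem_uIcc
  obtain ⟨q1, q2, -⟩ := h t ht 0 Set.left_mem_uIcc
  rw [add_zero] at q1 q2
  have hat := hau t ht
  have hAt := hA t ht
  rw [← hat] at q1 q2
  have m1 : |a t * (v (t, X t + δ) - u (t, X t + δ))| ≤ A * η := by
    rw [abs_mul]; exact mul_le_mul hAt p1 (abs_nonneg _) ((abs_nonneg _).trans hAt)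
  have m2 : |a t * (v (t, X t) - a t)| ≤ A * η := by
    rw [abs_mul]; exact mul_le_mul hAt q1 (abs_nonneg _) ((abs_nonneg _).trans hAt)
  have := abs_le.1 hI
  have := abs_le.1 m1
  have := abs_le.1 m2
  have := abs_le.1 p2
  have := abs_le.1 q2
  nlinarith [sq_nonneg (u (t, X t + δ) - a t)]

lemma strip_avg (u v : ℝ × ℝ → ℝ) (hv : Continuous v) (τ x δ η ε : ℝ)
    (h : ∀ y ∈ Set.uIcc 0 δ, |v (τ, x + y) - u (τ, x + y)| ≤ η)
    (h' : ∀ y ∈ Set.uIcc 0 δ, |u (τ, x + y) - u (τ, x)| ≤ ε) :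
    |(∫ y in (0:ℝ)..δ, v (τ, x + y)) - δ * u (τ, x)| ≤ (η + ε) * |δ| := by
  have h1 : ‖∫ y in (0:ℝ)..δ, (v (τ, x + y) - u (τ, x))‖ ≤ (η + ε) * |δ - 0| := by
    refine intervalIntegral.norm_integral_le_of_norm_le_const fun y hy => ?_
    have hy := Set.uIoc_subset_uIcc hy
    have := abs_add_le (v (τ, x + y) - u (τ, x + y)) (u (τ, x + y) - u (τ, x))
    rw [sub_add_sub_cancel] at this
    exact this.trans (add_le_add (h y hy) (h' y hy))
  rw [intervalIntegral.integral_sub (Continuous.intervalIntegrable (by fun_prop) _ _) (by simp)] at h1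
  simpa using h1

theorem stmt_three_aux (Ω : Set (ℝ × ℝ)) (hΩ : IsOpen Ω)
    (u : ℝ × ℝ → ℝ) (hu : ContinuousOn u Ω)
    (C : ℝ) 
    (hmoll : ∀ (K : Set (ℝ × ℝ)) (hK : IsCompact K) (hKΩ : K ⊆ Ω) (η : ℝ) (hη : 0 < η),
      ∃ v w : ℝ × ℝ → ℝ, ContDiff ℝ 1 v ∧ ContDiff ℝ 1 w ∧
      ∀ p ∈ K, |v p - u p| ≤ η ∧ |w p - u p ^ 2 / 2| ≤ η ∧
        |fderiv ℝ v p (1, 0) - fderiv ℝ w p (0, 1)| ≤ C)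
    (T : ℝ) (hT : 0 ≤ T) (ξ : ℝ → ℝ)
    (hmem : ∀ t ∈ Set.Icc 0 T, (t, ξ t) ∈ Ω)
    (hchar : ∀ t ∈ Set.Icc 0 T, HasDerivAt ξ (-(u (t, ξ t))) t) :
    ∀ s ∈ Set.Icc (0:ℝ) T, ∀ t ∈ Set.Icc (0:ℝ) T, s ≤ t →
      |u (t, ξ t) - u (s, ξ s)| ≤ C * (t - s) := by
  have hξc : ContinuousOn ξ (Set.Icc 0 T) := fun t ht => (hchar t ht).continuousAt.continuousWithinAt
  have hcurve : ContinuousOn (fun t => (t, ξ t)) (Set.Icc 0 T) := continuousOn_id.prodMk hξc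
  have ha0 : ContinuousOn (fun t => u (t, ξ t)) (Set.Icc 0 T) := hu.comp hcurve hmem
  obtain ⟨A, hA⟩ := isCompact_Icc.exists_bound_of_continuousOn ha0
  have hA0 : 0 ≤ A := (norm_nonneg _).trans (hA 0 ⟨le_rfl, hT⟩)
  let a : ℝ → ℝ := Set.IccExtend hT ((Set.Icc 0 T).domRestrict fun t => u (t, ξ t))
  have hac : Continuous a := (continuousOn_iff_continuous_domRestrict.1 ha0).Icc_extend'
  have haξ : ∀ t ∈ Set.Icc 0 T, a t = u (t, ξ t) := fun t ht => by
    simp only [a, Set.IccExtend_of_mem hT _ ht]; rfl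
  let X : ℝ → ℝ := fun t => ξ 0 + ∫ r in (0:ℝ)..t, -a r
  have hX : ∀ t, HasDerivAt X (-a t) t := fun t =>
    ((hac.neg.integral_hasStrictDerivAt 0 t).hasDerivAt).const_add _
  have hXξ : ∀ t ∈ Set.Icc 0 T, X t = ξ t := by
    intro t ht
    have hsub : Set.uIcc 0 t ⊆ Set.Icc 0 T := by
      rw [Set.uIcc_of_le ht.1]; exact Set.Icc_subset_Icc_right ht.2
    have := intervalIntegral.integral_eq_sub_of_hasDerivAt (a := 0) (b := t) (f := ξ)
      (f' := fun r => -a r) (fun r hr => by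
        have := hchar r (hsub hr); rwa [← haξ r (hsub hr)] at this)
      (hac.neg.intervalIntegrable _ _)
    simp only [X]; rw [this]; ring
  set Γ := (fun t => (t, ξ t)) '' Set.Icc 0 T with hΓ
  have hΓc : IsCompact Γ := isCompact_Icc.image_of_continuousOn hcurve
  obtain ⟨d, hd, hdΩ⟩ := hΓc.exists_cthickening_subset_open hΩ (by
    rintro _ ⟨t, ht, rfl⟩; exact hmem t ht)
  set K := Metric.cthickening d Γ
  have hKc : IsCompact K := hΓc.cthickening
  have hdist : ∀ t y : ℝ, dist (t, ξ t + y) (t, ξ t) = |y| := by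
    intro t y; simp [Prod.dist_eq, Real.dist_eq]
  have hK : ∀ t ∈ Set.Icc 0 T, ∀ y, |y| ≤ d → (t, ξ t + y) ∈ K := by
    intro t ht y hy
    refine Metric.mem_cthickening_of_dist_le _ (t, ξ t) _ _ (Set.mem_image_of_mem (fun t => (t, ξ t)) ht) ?_
    rwa [hdist]
  have huK := hKc.uniformContinuousOn_of_continuous (hu.mono hdΩ)
  intro s hs τ hτ hsτ
  have hst : Set.Icc s τ ⊆ Set.Icc 0 T := Set.Icc_subset_Icc hs.1 hτ.2
  have claim : ∀ ε > 0, |u (τ, ξ τ) - u (s, ξ s)| ≤ C * (τ - s) + ε * (4 + 2 * (τ - s)) := by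
    intro ε hε
    obtain ⟨d1, hd1, h1⟩ := Metric.uniformContinuousOn_iff_le.1 huK ε hε
    obtain ⟨δ0, hδ0, hδm⟩ : ∃ δ0 : ℝ, 0 < δ0 ∧ δ0 ≤ min d d1 :=
      ⟨min d d1, by positivity, le_rfl⟩
    have hδd : δ0 ≤ d := hδm.trans (min_le_left _ _)
    have hδd1 : δ0 ≤ d1 := hδm.trans (min_le_right _ _)
    obtain ⟨η, hη, hη1, hη2⟩ : ∃ η : ℝ, 0 < η ∧ η ≤ ε ∧ η * (1 + A) ≤ ε * δ0 := by
      refine ⟨ε * δ0 / (1 + A + δ0), by positivity, ?_, ?_⟩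
      · rw [div_le_iff₀ (by positivity)]; nlinarith
      · rw [div_mul_eq_mul_div, div_le_iff₀ (by positivity)]
        have : 0 < ε * δ0 := by positivity
        nlinarith
    obtain ⟨v, w, hv, hw, hvw⟩ := hmoll K hKc hdΩ η hη
    have side : ∀ δ : ℝ, |δ| = δ0 →
        -(δ * (u (τ, ξ τ) - u (s, ξ s))) ≤ δ0 * (C * (τ - s) + ε * (4 + 2 * (τ - s))) := by
      intro δ hδ
      have hy : ∀ y ∈ Set.uIcc 0 δ, |y| ≤ δ0 := by
        intro y hy
        have := Set.abs_sub_left_of_mem_uIcc hy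
        simpa [hδ] using this
      have i1 := strip_ineq u v w hv hw a X hac hX δ s τ C η A hsτ
        (fun t ht y hyy => by
          rw [hXξ t (hst ht)]
          exact hvw _ (hK t (hst ht) y ((hy y hyy).trans hδd)))
        (fun t ht => by rw [hXξ t (hst ht)]; exact haξ t (hst ht))
        (fun t ht => by rw [haξ t (hst ht)]; exact hA t (hst ht))
      have av : ∀ t ∈ Set.Icc 0 T, 
          |(∫ y in (0:ℝ)..δ, v (t, ξ t + y)) - δ * u (t, ξ t)| ≤ (η + ε) * |δ| := by
        intro t ht
        refine strip_avg u v hv.continuous t (ξ t) δ η ε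
          (fun y hyy => (hvw _ (hK t ht y ((hy y hyy).trans hδd))).1) (fun y hyy => ?_)
        refine h1 _ (hK t ht y ((hy y hyy).trans hδd)) _
          (Metric.self_subset_cthickening _ ⟨t, ht, rfl⟩) ?_
        rw [hdist]; exact (hy y hyy).trans hδd1
      rw [hXξ τ hτ, hXξ s hs, hδ] at i1
      have b1 := abs_le.1 (av τ hτ)
      have b2 := abs_le.1 (av s hs)
      rw [hδ] at b1 b2
      have k1 : η * δ0 ≤ ε * δ0 := mul_le_mul_of_nonneg_right hη1 hδ0.le
      have k2 : η * (1 + A) * (τ - s) ≤ ε * δ0 * (τ - s) :=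
        mul_le_mul_of_nonneg_right hη2 (sub_nonneg.2 hsτ)
      nlinarith
    have s1 := side δ0 (abs_of_pos hδ0)
    have s2 := side (-δ0) (by rw [abs_neg, abs_of_pos hδ0])
    rw [abs_le]
    constructor
    · refine le_of_mul_le_mul_left ?_ hδ0
      linarith
    · refine le_of_mul_le_mul_left ?_ hδ0
      linarith
  have hc : 0 < 4 + 2 * (τ - s) := by linarith
  refine le_of_forall_pos_le_add fun ε hε => ?_
  have := claim (ε / (4 + 2 * (τ - s))) (by positivity)
  rwa [div_mul_cancel₀ _ hc.ne'] at this

theorem stmt_3 (Ω : Set (ℝ × ℝ)) (hΩ : IsOpen Ω)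
    (u g : ℝ × ℝ → ℝ) (hu : ContinuousOn u Ω) (hg : ContinuousOn g Ω)
    (C : ℝ) (hC : ∀ p ∈ Ω, |g p| ≤ C)
    (hdistr : ∀ φ : ℝ × ℝ → ℝ, ContDiff ℝ (⊤ : ℕ∞) φ → HasCompactSupport φ → tsupport φ ⊆ Ω →
      ∫ p in Ω, (-(u p) * fderiv ℝ φ p (1, 0) + (u p) ^ 2 / 2 * fderiv ℝ φ p (0, 1)) =
        ∫ p in Ω, g p * φ p)
    (T : ℝ) (hT : 0 ≤ T) (ξ : ℝ → ℝ)
    (hmem : ∀ t ∈ Set.Icc 0 T, (t, ξ t) ∈ Ω)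
    (hchar : ∀ t ∈ Set.Icc 0 T, HasDerivAt ξ (-(u (t, ξ t))) t) :
    ∀ s ∈ Set.Icc (0:ℝ) T, ∀ t ∈ Set.Icc (0:ℝ) T,
      |u (t, ξ t) - u (s, ξ s)| ≤ C * |t - s| := by
  have hC0 : 0 ≤ C := (abs_nonneg _).trans (hC _ (hmem 0 ⟨le_rfl, hT⟩))
  have key := stmt_three_aux Ω hΩ u hu C
    (fun K hK hKΩ η hη => moll Ω hΩ u g hu C hC0 hC hdistr K hK hKΩ η hη) T hT ξ hmem hchar
  intro s hs t ht
  rcases le_total s t with h | h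
  · rw [abs_of_nonneg (sub_nonneg.2 h)]
    exact key s hs t ht h
  · rw [abs_sub_comm, abs_sub_comm t s, abs_of_nonneg (sub_nonneg.2 h)]
    exact key t ht s hs h
end

section
/- Let $\Omega\subseteq\mathbb{R}^2$ be open with $(0,0)\in\Omega$, let $u\in C(\Omega)$ with $u(0,0)=0$ and $g\in C(\Omega)$ bounded, and suppose $u$ is a distributional solution of $\partial_t u-\partial_x(u^2/2)=g$ on $\Omega$. Then there exists $\delta>0$ and a $C^1$ curve $\xi:[-\delta,\delta]\to\mathbb{R}$ with $\xi(0)=0$, $(t,\xi(t))\in\Omega$ and $\dot\xi(t)=-u(t,\xi(t))$ for all $t\in[-\delta,\delta]$, such that $u(t,\xi(t))-u(0,0)=\int_0^t g(s,\xi(s))\,ds$ for every $t\in[-\delta,\delta]$. -/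
open MeasureTheory

open Set Filter Topology Metric ContinuousLinearMap in
/-- Mollification. -/
noncomputable def molB (ρ : ContDiffBump (0 : ℝ × ℝ)) (f : ℝ × ℝ → ℝ) : ℝ × ℝ → ℝ :=
  MeasureTheory.convolution f (ρ.normed volume) (lsmul ℝ ℝ) volume

lemma molB_eq (ρ : ContDiffBump (0 : ℝ × ℝ)) (f : ℝ × ℝ → ℝ) (p : ℝ × ℝ) :
    molB ρ f p = ∫ z, f z * ρ.normed volume (p - z) := rfl

lemma molB_close (f : ℝ × ℝ → ℝ) (hf : Continuous f) (hc : HasCompactSupport f)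
    (e : ℝ) (he : 0 < e) :
    ∃ d > 0, ∀ ρ : ContDiffBump (0 : ℝ × ℝ), ρ.rOut < d → ∀ p, |molB ρ f p - f p| ≤ e := by
  have hu := hc.uniformContinuous_of_continuous hf
  obtain ⟨d, hd, h⟩ := Metric.uniformContinuous_iff.1 hu e he
  refine ⟨d, hd, fun ρ hρ p => ?_⟩
  have := ρ.dist_normed_convolution_le (μ := volume) (g := f) (x₀ := p) (ε := e)
    hf.aestronglyMeasurable (fun x hx => (h (lt_trans (Metric.mem_ball.1 hx) hρ)).le)
  rw [convolution_lsmul_swap, Real.dist_eq] at this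
  rw [molB_eq]
  simpa [mul_comm] using this

lemma molB_contDiff (ρ : ContDiffBump (0 : ℝ × ℝ)) (f : ℝ × ℝ → ℝ) (hf : Continuous f) :
    ContDiff ℝ 1 (molB ρ f) := by
  have := ρ.hasCompactSupport_normed (μ := volume) |>.contDiff_convolution_right (n := 1)
    (ContinuousLinearMap.lsmul ℝ ℝ) (hf.locallyIntegrable (μ := volume)) ρ.contDiff_normed
  exact this

lemma molB_hasCompactSupport (ρ : ContDiffBump (0 : ℝ × ℝ)) (f : ℝ × ℝ → ℝ)
    (hc : HasCompactSupport f) : HasCompactSupport (molB ρ f) :=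
  hc.convolution _ ρ.hasCompactSupport_normed

lemma molB_fderiv (ρ : ContDiffBump (0 : ℝ × ℝ)) (f : ℝ × ℝ → ℝ) (hf : Continuous f)
    (p v : ℝ × ℝ) :
    fderiv ℝ (molB ρ f) p v = ∫ z, f z * fderiv ℝ (ρ.normed volume) (p - z) v := by
  have h1 := (ρ.hasCompactSupport_normed (μ := volume)).hasFDerivAt_convolution_right
    (ContinuousLinearMap.lsmul ℝ ℝ) (hf.locallyIntegrable (μ := volume)) ρ.contDiff_normed p
  have h2 := convolution_precompR_apply (ContinuousLinearMap.lsmul ℝ ℝ)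
    (hf.locallyIntegrable (μ := volume)) (ρ.hasCompactSupport_normed.fderiv ℝ)
    ((ρ.contDiff_normed (μ := volume) (n := 1)).continuous_fderiv (by simp)) p v
  rw [molB, h1.fderiv, h2]
  rfl

lemma exists_bumpB (d : ℝ) (hd : 0 < d) : ∃ ρ : ContDiffBump (0 : ℝ × ℝ), ρ.rOut < d :=
  ⟨⟨d / 4, d / 2, by positivity, by linarith⟩, by simp; linarith⟩

lemma approxB (f : ℝ × ℝ → ℝ) (hf : Continuous f) (hc : HasCompactSupport f)
    (M : ℝ) (hM : ∀ p, |f p| ≤ M) (n : ℕ) :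
    ∃ α d : ℝ → ℝ, α 0 = 0 ∧ ∀ t ∈ Set.Icc (-(n:ℝ)) n,
      HasDerivWithinAt α (d t) (Set.Icc (-(n:ℝ)) n) t ∧ |d t - f (t, α t)| ≤ 1 / ((n:ℝ) + 1) := by
  obtain ⟨d, hd, h⟩ := molB_close f hf hc (1 / ((n:ℝ) + 1)) (by positivity)
  obtain ⟨ρ, hρ⟩ := exists_bumpB d hd
  have hcl := h ρ hρ
  obtain ⟨K, hK⟩ := ContDiff.lipschitzWith_of_hasCompactSupport (𝕂 := ℝ)
    (molB_hasCompactSupport ρ f hc) (molB_contDiff ρ f hf) (by simp)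
  have hM0 : 0 ≤ M := (abs_nonneg _).trans (hM 0)
  have h1 : (1 / ((n:ℝ) + 1)) ≤ 1 := by
    rw [div_le_one (by positivity)]; linarith [(Nat.cast_nonneg n : (0:ℝ) ≤ n)]
  have hPL : IsPicardLindelof (fun t x => molB ρ f (t, x)) (tmin := -(n:ℝ)) (tmax := n)
      ⟨0, by simp⟩ (0:ℝ) (⟨(M+1) * n, by positivity⟩) 0 ⟨M + 1, by positivity⟩ K := by
    refine ⟨fun t _ => ?_, fun x _ => ?_, fun t _ x _ => ?_, ?_⟩
    · refine LipschitzWith.lipschitzOnWith ?_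
      have := hK.comp (LipschitzWith.prodMk_left (α := ℝ) (β := ℝ) t)
      rw [mul_one] at this
      exact this
    · exact ((molB_contDiff ρ f hf).continuous.comp (by fun_prop : Continuous fun t : ℝ => (t, x))).continuousOn
    · have a1 := hcl (t, x)
      have a2 := hM (t, x)
      show |molB ρ f (t, x)| ≤ M + 1
      rw [abs_le] at *
      constructor <;> linarith [a1.1, a1.2, a2.1, a2.2]
    · simp
      exact le_rfl
  obtain ⟨α, h0, hα⟩ := hPL.exists_eq_forall_mem_Icc_hasDerivWithinAt₀
  exact ⟨α, fun t => molB ρ f (t, α t), h0, fun t ht => ⟨hα t ht, hcl _⟩⟩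

lemma peanoB (f : ℝ × ℝ → ℝ) (hf : Continuous f) (hc : HasCompactSupport f)
    (M : ℝ) (hM : ∀ p, |f p| ≤ M) :
    ∃ ξ : ℝ → ℝ, ξ 0 = 0 ∧ ∀ t, HasDerivAt ξ (f (t, ξ t)) t := by
  choose α d h0 h using approxB f hf hc M hM
  have hM0 : 0 ≤ M := (abs_nonneg _).trans (hM 0)
  have hd : ∀ n : ℕ, ∀ t ∈ Set.Icc (-(n:ℝ)) n, ‖d n t‖ ≤ M + 1 := by
    intro n t ht
    have a1 := (h n t ht).2
    have a2 := hM (t, α n t)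
    have h1 : (1 / ((n:ℝ) + 1)) ≤ 1 := by
      rw [div_le_one (by positivity)]; linarith [(Nat.cast_nonneg n : (0:ℝ) ≤ n)]
    rw [Real.norm_eq_abs]
    rw [abs_le] at *
    constructor <;> linarith [a1.1, a1.2, a2.1, a2.2]
  have hL : ∀ n : ℕ, ∀ s ∈ Set.Icc (-(n:ℝ)) n, ∀ t ∈ Set.Icc (-(n:ℝ)) n,
      |α n t - α n s| ≤ (M + 1) * |t - s| := fun n s hs t ht =>
    (convex_Icc _ _).norm_image_sub_le_of_norm_hasDerivWithin_le
      (fun x hx => (h n x hx).1) (hd n) hs ht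
  have hU : ((Filter.hyperfilter ℕ : Ultrafilter ℕ) : Filter ℕ) ≤ Filter.atTop := by
    rw [← Nat.cofinite_eq_atTop]; exact Filter.hyperfilter_le_cofinite
  set U : Ultrafilter ℕ := Filter.hyperfilter ℕ
  have hbig : ∀ c : ℝ, ∀ᶠ n : ℕ in U, c ≤ n := fun c =>
    (tendsto_natCast_atTop_atTop.eventually_ge_atTop c).filter_mono hU
  have hlim : ∀ t, ∃ x, Filter.Tendsto (fun n => α n t) U (nhds x) := by
    intro t
    have hK : IsCompact (Set.Icc (-((M+1) * |t|)) ((M+1)*|t|)) := isCompact_Icc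
    obtain ⟨x, -, hx⟩ := hK.ultrafilter_le_nhds (U.map (fun n => α n t)) (by
      rw [Filter.le_principal_iff, Ultrafilter.coe_map, Filter.mem_map]
      filter_upwards [hbig |t|] with n hn
      have := hL n 0 (by simp) t (abs_le.1 hn)
      rw [h0, sub_zero, sub_zero] at this
      exact abs_le.1 this)
    exact ⟨x, hx⟩
  choose ξ hξ using hlim
  refine ⟨ξ, ?_, fun t0 => ?_⟩
  · have := hξ 0
    simp only [h0] at this
    exact (tendsto_nhds_unique this tendsto_const_nhds)
  rw [hasDerivAt_iff_isLittleO, Asymptotics.isLittleO_iff]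
  intro ε hε
  obtain ⟨δ, hδ, hfδ⟩ := Metric.continuousAt_iff.1 (hf.continuousAt (x := (t0, ξ t0))) (ε/2) (by positivity)
  have hr : 0 < min 1 (min δ (δ / (2 * (M + 1)))) := by positivity
  filter_upwards [Metric.ball_mem_nhds t0 hr] with t ht
  rw [Metric.mem_ball, Real.dist_eq, lt_min_iff, lt_min_iff, lt_div_iff₀ (by positivity)] at ht
  obtain ⟨ht1, ht2, ht3⟩ := ht
  have hT : Filter.Tendsto (fun n => ‖α n t - α n t0 - (t - t0) * f (t0, ξ t0)‖) U
      (nhds ‖ξ t - ξ t0 - (t - t0) * f (t0, ξ t0)‖) :=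
    (((hξ t).sub (hξ t0)).sub_const _).norm
  refine le_of_tendsto hT ?_
  filter_upwards [hbig (|t0| + 1), hbig (2 / ε), (Metric.tendsto_nhds.1 (hξ t0)) (δ/2) (by positivity)]
    with n hn1 hn2 hn3
  have hsub : ∀ s ∈ Set.uIcc t0 t, |s - t0| ≤ |t - t0| ∧ s ∈ Set.Icc (-(n:ℝ)) n := by
    intro s hs
    have : |s - t0| ≤ |t - t0| := Set.abs_sub_left_of_mem_uIcc hs
    refine ⟨this, abs_le.1 ?_⟩
    have := abs_add_le (s - t0) t0
    rw [sub_add_cancel] at this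
    linarith
  have key := (convex_uIcc t0 t).norm_image_sub_le_of_norm_hasDerivWithin_le
    (f := fun s => α n s - s * f (t0, ξ t0)) (f' := fun s => d n s - 1 * f (t0, ξ t0)) (C := ε)
    (fun s hs => (((h n s (hsub s hs).2).1).mono (fun x hx => (hsub x hx).2)).sub
      ((hasDerivWithinAt_id s _).mul_const _)) (by
      intro s hs
      have b1 := (h n s (hsub s hs).2).2
      have b2 : 1 / ((n:ℝ) + 1) ≤ ε / 2 := by
        rw [div_le_div_iff₀ (by positivity) (by positivity)]
        rw [div_le_iff₀ hε] at hn2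
        nlinarith
      have b3 := hL n t0 (hsub t0 Set.left_mem_uIcc).2 s (hsub s hs).2
      have b4 := (hsub s hs).1
      rw [Real.dist_eq] at hn3
      have b5 : dist (s, α n s) (t0, ξ t0) < δ := by
        rw [Prod.dist_eq, max_lt_iff, Real.dist_eq, Real.dist_eq]
        refine ⟨by linarith, ?_⟩
        have : |α n s - ξ t0| ≤ |α n s - α n t0| + |α n t0 - ξ t0| := abs_sub_le _ _ _
        have : (M + 1) * |s - t0| ≤ (M + 1) * |t - t0| := by gcongr
        nlinarith
      have b6 := hfδ b5
      rw [Real.dist_eq] at b6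
      rw [one_mul, Real.norm_eq_abs]
      have := abs_sub_le (d n s) (f (s, α n s)) (f (t0, ξ t0))
      linarith) Set.left_mem_uIcc Set.right_mem_uIcc
  refine le_trans (le_of_eq ?_) key
  congr 1
  ring

lemma weakB (Ω : Set (ℝ × ℝ)) (hΩ : IsOpen Ω) (u g : ℝ × ℝ → ℝ)
    (hdistr : ∀ φ : ℝ × ℝ → ℝ, ContDiff ℝ (⊤ : ℕ∞) φ → HasCompactSupport φ → tsupport φ ⊆ Ω →
      ∫ p in Ω, (-(u p) * fderiv ℝ φ p (1, 0) + (u p) ^ 2 / 2 * fderiv ℝ φ p (0, 1)) =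
        ∫ p in Ω, g p * φ p)
    (U Q G : ℝ × ℝ → ℝ) (hU : Continuous U) (hQ : Continuous Q) (B : Set (ℝ × ℝ)) (hB : B ⊆ Ω)
    (hUe : ∀ p ∈ B, U p = u p) (hQe : ∀ p ∈ B, Q p = u p ^ 2 / 2) (hGe : ∀ p ∈ B, G p = g p)
    (ρ : ContDiffBump (0 : ℝ × ℝ)) (p : ℝ × ℝ) (hp : Metric.closedBall p ρ.rOut ⊆ B) :
    fderiv ℝ (molB ρ U) p (1, 0) - fderiv ℝ (molB ρ Q) p (0, 1) = molB ρ G p := by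
  set R := ρ.normed (volume : Measure (ℝ × ℝ)) with hR
  have hRc : ContDiff ℝ (⊤ : ℕ∞) R := ρ.contDiff_normed
  have hRs : HasCompactSupport R := ρ.hasCompactSupport_normed
  have hDc : Continuous (fderiv ℝ R) := hRc.continuous_fderiv (by simp)
  set φ : ℝ × ℝ → ℝ := fun z => R (p - z) with hφ
  have hφc : ContDiff ℝ (⊤ : ℕ∞) φ := hRc.comp (contDiff_const.sub contDiff_id)
  have hts : tsupport φ ⊆ Metric.closedBall p ρ.rOut := by
    refine closure_minimal (fun z hz => ?_) Metric.isClosed_closedBall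
    have : p - z ∈ Function.support R := hz
    rw [hR, ρ.support_normed_eq, mem_ball_zero_iff] at this
    rw [Metric.mem_closedBall, dist_comm, dist_eq_norm]
    exact this.le
  have hφs : HasCompactSupport φ :=
    (isCompact_closedBall p ρ.rOut).of_isClosed_subset (isClosed_tsupport φ) hts
  have hfd : ∀ z v, fderiv ℝ φ z v = - fderiv ℝ R (p - z) v := by
    intro z v
    have h1 : HasFDerivAt R (fderiv ℝ R (p - z)) (p - z) :=
      (hRc.differentiable (by simp) (p - z)).hasFDerivAt
    have h2 : HasFDerivAt (fun z : ℝ × ℝ => p - z) (-ContinuousLinearMap.id ℝ (ℝ × ℝ)) z :=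
      (hasFDerivAt_id z).const_sub p
    have h3 : HasFDerivAt φ ((fderiv ℝ R (p - z)).comp (-ContinuousLinearMap.id ℝ (ℝ × ℝ))) z :=
      h1.comp z h2
    rw [h3.fderiv]
    simp
  have hz0 : ∀ z ∉ B, φ z = 0 ∧ fderiv ℝ φ z = 0 := by
    intro z hz
    have : z ∉ tsupport φ := fun h => hz (hp (hts h))
    exact ⟨image_eq_zero_of_notMem_tsupport this, fderiv_of_notMem_tsupport ℝ this⟩
  have hw := hdistr φ hφc hφs (hts.trans (hp.trans hB))
  rw [← integral_indicator hΩ.measurableSet, ← integral_indicator hΩ.measurableSet] at hw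
  have hcs : ∀ v : ℝ × ℝ, HasCompactSupport (fun z => fderiv ℝ R (p - z) v) := by
    intro v
    have : (fun z => fderiv ℝ R (p - z) v) = fun z => - (fderiv ℝ φ z v) := by
      funext z; rw [hfd]; ring
    rw [this]
    exact (hφs.fderiv_apply ℝ v).comp_left (g := fun x : ℝ => -x) (by simp)
  have hint : ∀ f : ℝ × ℝ → ℝ, Continuous f → ∀ v, Integrable (fun z => f z * fderiv ℝ R (p - z) v) := by
    intro f hf v
    refine Continuous.integrable_of_hasCompactSupport ?_ (hcs v).mul_left
    fun_prop
  rw [molB_fderiv ρ U hU, molB_fderiv ρ Q hQ, molB_eq, ← integral_sub (hint U hU _) (hint Q hQ _)]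
  refine Eq.trans (integral_congr_ae (Filter.Eventually.of_forall fun z => ?_))
    (hw.trans (integral_congr_ae (Filter.Eventually.of_forall fun z => ?_)))
  · by_cases hz : z ∈ B
    · simp only [Set.indicator_of_mem (hB hz), hfd, hUe z hz, hQe z hz]
      ring
    · have h1 := hfd z (1, 0)
      have h2 := hfd z (0, 1)
      rw [(hz0 z hz).2] at h1 h2
      simp only [zero_apply, zero_eq_neg] at h1 h2
      by_cases hzΩ : z ∈ Ω
      · simp [Set.indicator_of_mem hzΩ, (hz0 z hz).2, h1, h2]
      · simp [Set.indicator_of_notMem hzΩ, h1, h2]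
  · by_cases hz : z ∈ B
    · simp only [Set.indicator_of_mem (hB hz), hGe z hz]
      rfl
    · have h1 : ρ.normed volume (p - z) = 0 := (hz0 z hz).1
      by_cases hzΩ : z ∈ Ω
      · simp [Set.indicator_of_mem hzΩ, (hz0 z hz).1, h1]
      · simp [Set.indicator_of_notMem hzΩ, h1]

lemma identB (V W H : ℝ × ℝ → ℝ) (hV : ContDiff ℝ 1 V) (hW : ContDiff ℝ 1 W) (hH : Continuous H)
    (ξ v : ℝ → ℝ) (hξ : ∀ t, HasDerivAt ξ (v t) t) (hv : Continuous v) (a b ε : ℝ)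
    (hpde : ∀ t ∈ Set.uIcc a b, ∀ y ∈ Set.uIcc 0 ε,
      fderiv ℝ V (t, ξ t + y) (1, 0) - fderiv ℝ W (t, ξ t + y) (0, 1) = H (t, ξ t + y)) :
    ∫ y in (0:ℝ)..ε, (V (b, ξ b + y) - V (a, ξ a + y) - ∫ t in a..b, H (t, ξ t + y)) =
      ∫ t in a..b, (W (t, ξ t + ε) - W (t, ξ t + 0)
        + v t * (V (t, ξ t + ε) - V (t, ξ t + 0))) := by
  have hξc : Continuous ξ := continuous_iff_continuousAt.2 fun t => (hξ t).continuousAt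
  have hDV : Continuous (fderiv ℝ V) := hV.continuous_fderiv (by simp)
  have hDW : Continuous (fderiv ℝ W) := hW.continuous_fderiv (by simp)
  set K : ℝ → ℝ → ℝ := fun t y =>
    fderiv ℝ W (t, ξ t + y) (0, 1) + v t * fderiv ℝ V (t, ξ t + y) (0, 1) with hK
  have hKc : Continuous (fun q : ℝ × ℝ => K q.1 q.2) := by
    simp only [hK]
    fun_prop
  have h1 : ∀ y ∈ Set.uIcc 0 ε,
      V (b, ξ b + y) - V (a, ξ a + y) - (∫ t in a..b, H (t, ξ t + y)) = ∫ t in a..b, K t y := by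
    intro y hy
    have hi1 : IntervalIntegrable (fun t => K t y) volume a b :=
      (hKc.comp (by fun_prop : Continuous fun t : ℝ => (t, y))).intervalIntegrable _ _
    have hi2 : IntervalIntegrable (fun t => H (t, ξ t + y)) volume a b :=
      Continuous.intervalIntegrable (by fun_prop) _ _
    have := intervalIntegral.integral_eq_sub_of_hasDerivAt (a := a) (b := b)
      (f := fun t => V (t, ξ t + y)) (f' := fun t => K t y + H (t, ξ t + y)) (by
        intro t ht
        have hd : HasDerivAt (fun t => (t, ξ t + y)) ((1:ℝ), v t) t :=
          (hasDerivAt_id t).prodMk ((hξ t).add_const y)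
        have hc := (hV.differentiable (by simp) (t, ξ t + y)).hasFDerivAt.comp_hasDerivAt t hd
        refine HasDerivAt.congr_deriv (f := fun t => V (t, ξ t + y)) hc ?_
        have e : ((1:ℝ), v t) = (1, 0) + v t • ((0:ℝ), (1:ℝ)) := by simp
        rw [e, map_add, map_smul, ← hpde t ht y hy, hK]
        simp only [smul_eq_mul]
        ring) (hi1.add hi2)
    rw [intervalIntegral.integral_add hi1 hi2] at this
    linarith
  have h2 : ∀ t, ∫ y in (0:ℝ)..ε, K t y = W (t, ξ t + ε) - W (t, ξ t + 0)
        + v t * (V (t, ξ t + ε) - V (t, ξ t + 0)) := by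
    intro t
    rw [intervalIntegral.integral_eq_sub_of_hasDerivAt
      (f := fun y => W (t, ξ t + y) + v t * V (t, ξ t + y)) (f' := fun y => K t y)]
    · ring
    · intro y _
      have hd : HasDerivAt (fun y => (t, ξ t + y)) ((0:ℝ), (1:ℝ)) y :=
        (hasDerivAt_const y t).prodMk ((hasDerivAt_id y).const_add (ξ t))
      exact ((hW.differentiable (by simp) (t, ξ t + y)).hasFDerivAt.comp_hasDerivAt y hd).add
        (((hV.differentiable (by simp) (t, ξ t + y)).hasFDerivAt.comp_hasDerivAt y hd).const_mul (v t))
    · exact (hKc.comp (by fun_prop : Continuous fun y : ℝ => (t, y))).intervalIntegrable _ _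
  rw [intervalIntegral.integral_congr (fun y hy => h1 y hy),
    ← intervalIntegral.integral_congr (fun t _ => h2 t),
    intervalIntegral_intervalIntegral_swap]
  have : IntegrableOn (fun q : ℝ × ℝ => K q.2 q.1) (Set.uIcc 0 ε ×ˢ Set.uIcc a b) :=
    (hKc.comp continuous_swap).continuousOn.integrableOn_compact
      (isCompact_uIcc.prod isCompact_uIcc)
  exact this.mono_set (Set.prod_mono Set.uIoc_subset_uIcc Set.uIoc_subset_uIcc)

lemma nonnegB (U Q G : ℝ × ℝ → ℝ) (hU : Continuous U) (hQ : Continuous Q) (hG : Continuous G)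
    (hUs : HasCompactSupport U) (hQs : HasCompactSupport Q) (hGs : HasCompactSupport G)
    (M : ℝ) (hM : ∀ p, |U p| ≤ M) (r : ℝ) (hr : 0 < r)
    (hQU : ∀ p ∈ Metric.ball (0 : ℝ × ℝ) r, Q p = U p ^ 2 / 2)
    (hP : ∀ (ρ : ContDiffBump (0 : ℝ × ℝ)) (p : ℝ × ℝ),
      Metric.closedBall p ρ.rOut ⊆ Metric.ball 0 r →
      fderiv ℝ (molB ρ U) p (1, 0) - fderiv ℝ (molB ρ Q) p (0, 1) = molB ρ G p)
    (ξ : ℝ → ℝ) (hξ : ∀ t, HasDerivAt ξ (-U (t, ξ t)) t) (a b ε : ℝ) (hab : a ≤ b)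
    (hin : ∀ t ∈ Set.uIcc a b, ∀ y ∈ Set.uIcc 0 ε, ‖(t, ξ t + y)‖ ≤ r / 2) :
    0 ≤ ∫ y in (0:ℝ)..ε, (U (b, ξ b + y) - U (a, ξ a + y) - ∫ t in a..b, G (t, ξ t + y)) := by
  have hξc : Continuous ξ := continuous_iff_continuousAt.2 fun t => (hξ t).continuousAt
  have hM0 : 0 ≤ M := (abs_nonneg _).trans (hM 0)
  have hFc : ∀ V H : ℝ × ℝ → ℝ, Continuous V → Continuous H → Continuous (fun y =>
      V (b, ξ b + y) - V (a, ξ a + y) - ∫ t in a..b, H (t, ξ t + y)) := by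
    intro V H hV hH
    refine Continuous.sub (by fun_prop) ?_
    exact intervalIntegral.continuous_parametric_intervalIntegral_of_continuous'
      (f := fun y t => H (t, ξ t + y)) (by simp only [Function.uncurry_def]; fun_prop) a b
  set X := ∫ y in (0:ℝ)..ε, (U (b, ξ b + y) - U (a, ξ a + y) - ∫ t in a..b, G (t, ξ t + y)) with hX
  set C : ℝ := (2 + (b - a)) * |ε| + (2 + 2 * M) * (b - a) with hC
  have hba : 0 ≤ b - a := by linarith
  have hC0 : 0 ≤ C := by positivity
  have main : ∀ e > 0, -(C * e) ≤ X := by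
    intro e he
    obtain ⟨d1, hd1, h1⟩ := molB_close U hU hUs e he
    obtain ⟨d2, hd2, h2⟩ := molB_close Q hQ hQs e he
    obtain ⟨d3, hd3, h3⟩ := molB_close G hG hGs e he
    obtain ⟨ρ, hρ⟩ := exists_bumpB (min (min d1 d2) (min d3 (r / 2))) (by positivity)
    simp only [lt_min_iff] at hρ
    replace h1 := h1 ρ hρ.1.1
    replace h2 := h2 ρ hρ.1.2
    replace h3 := h3 ρ hρ.2.1
    have hV := molB_contDiff ρ U hU
    have hW := molB_contDiff ρ Q hQ
    have hH := (molB_contDiff ρ G hG).continuous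
    have hVc := hV.continuous
    have hWc := hW.continuous
    have hP' := hP ρ
    set V := molB ρ U
    set W := molB ρ Q
    set H := molB ρ G
    have id := identB V W H hV hW hH ξ (fun t => -U (t, ξ t)) hξ (by fun_prop) a b ε (by
      intro t ht y hy
      refine hP' _ fun z hz => ?_
      have := hin t ht y hy
      rw [mem_closedBall_iff_norm] at hz
      rw [mem_ball_zero_iff]
      have h4 := norm_add_le (z - (t, ξ t + y)) (t, ξ t + y)
      rw [sub_add_cancel] at h4
      linarith [hρ.2.2])
    have lo : -((2 + 2 * M) * e) * (b - a) ≤ ∫ t in a..b, (W (t, ξ t + ε) - W (t, ξ t + 0)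
        + -U (t, ξ t) * (V (t, ξ t + ε) - V (t, ξ t + 0))) := by
      have hmono := intervalIntegral.integral_mono_on (μ := volume) hab
        (f := fun _ => -((2 + 2 * M) * e))
        (g := fun t => (W (t, ξ t + ε) - W (t, ξ t + 0)
          + -U (t, ξ t) * (V (t, ξ t + ε) - V (t, ξ t + 0)))) (by simp)
        (Continuous.intervalIntegrable (by fun_prop) _ _) (by
          intro t ht
          rw [← Set.uIcc_of_le hab] at ht
          have q1 := hQU (t, ξ t + ε) (mem_ball_zero_iff.2 (by
            linarith [hin t ht ε Set.right_mem_uIcc]))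
          have q2 := hQU (t, ξ t + 0) (mem_ball_zero_iff.2 (by
            linarith [hin t ht 0 Set.left_mem_uIcc]))
          have a1 := abs_le.1 (h2 (t, ξ t + ε))
          have a2 := abs_le.1 (h2 (t, ξ t + 0))
          have a3 : |U (t, ξ t) * ((V (t, ξ t + ε) - U (t, ξ t + ε)) - (V (t, ξ t + 0) - U (t, ξ t + 0)))|
              ≤ M * (e + e) := by
            rw [abs_mul]
            refine mul_le_mul (hM _) ?_ (abs_nonneg _) hM0
            exact (abs_sub _ _).trans (add_le_add (h1 _) (h1 _))
          have a4 := abs_le.1 a3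
          simp only [add_zero] at *
          nlinarith [sq_nonneg (U (t, ξ t + ε) - U (t, ξ t)), a1.1, a2.2, a4.2])
      rw [intervalIntegral.integral_const, smul_eq_mul] at hmono
      linarith
    have cl : |(∫ y in (0:ℝ)..ε, (V (b, ξ b + y) - V (a, ξ a + y) - ∫ t in a..b, H (t, ξ t + y)))
        - X| ≤ ((2 + (b - a)) * e) * |ε - 0| := by
      rw [hX, ← intervalIntegral.integral_sub ((hFc V H hVc hH).intervalIntegrable _ _)
        ((hFc U G hU hG).intervalIntegrable _ _), ← Real.norm_eq_abs]
      refine intervalIntegral.norm_integral_le_of_norm_le_const fun y _ => ?_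
      have a1 := abs_le.1 (h1 (b, ξ b + y))
      have a2 := abs_le.1 (h1 (a, ξ a + y))
      have a3 : |(∫ t in a..b, H (t, ξ t + y)) - ∫ t in a..b, G (t, ξ t + y)| ≤ e * |b - a| := by
        rw [← intervalIntegral.integral_sub (Continuous.intervalIntegrable (by fun_prop) _ _)
          (Continuous.intervalIntegrable (by fun_prop) _ _), ← Real.norm_eq_abs]
        exact intervalIntegral.norm_integral_le_of_norm_le_const fun t _ => h3 _
      rw [abs_of_nonneg hba] at a3
      replace a3 := abs_le.1 a3
      rw [Real.norm_eq_abs, abs_le]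
      constructor <;> nlinarith [a1.1, a1.2, a2.1, a2.2, a3.1, a3.2]
    rw [id, sub_zero] at cl
    have := (abs_le.1 cl).2
    rw [hC]
    nlinarith
  by_contra hneg
  push Not at hneg
  have hpos : 0 < -X / (2 * (C + 1)) := by
    apply div_pos <;> linarith
  have h5 := main _ hpos
  have h6 : 2 * (C + 1) * (-X / (2 * (C + 1))) = -X := by field_simp
  nlinarith

lemma eqB (U Q G : ℝ × ℝ → ℝ) (hU : Continuous U) (hQ : Continuous Q) (hG : Continuous G)
    (hUs : HasCompactSupport U) (hQs : HasCompactSupport Q) (hGs : HasCompactSupport G)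
    (M : ℝ) (hM : ∀ p, |U p| ≤ M) (r : ℝ) (hr : 0 < r)
    (hQU : ∀ p ∈ Metric.ball (0 : ℝ × ℝ) r, Q p = U p ^ 2 / 2)
    (hP : ∀ (ρ : ContDiffBump (0 : ℝ × ℝ)) (p : ℝ × ℝ),
      Metric.closedBall p ρ.rOut ⊆ Metric.ball 0 r →
      fderiv ℝ (molB ρ U) p (1, 0) - fderiv ℝ (molB ρ Q) p (0, 1) = molB ρ G p)
    (ξ : ℝ → ℝ) (hξ : ∀ t, HasDerivAt ξ (-U (t, ξ t)) t) (a b : ℝ) (hab : a ≤ b)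
    (hin : ∀ t ∈ Set.uIcc a b, |t| ≤ r / 4 ∧ |ξ t| ≤ r / 4) :
    U (b, ξ b) - U (a, ξ a) = ∫ t in a..b, G (t, ξ t) := by
  have hξc : Continuous ξ := continuous_iff_continuousAt.2 fun t => (hξ t).continuousAt
  set F : ℝ → ℝ := fun y => U (b, ξ b + y) - U (a, ξ a + y) - ∫ t in a..b, G (t, ξ t + y) with hF
  have hFc : Continuous F := by
    refine Continuous.sub (by fun_prop) ?_
    exact intervalIntegral.continuous_parametric_intervalIntegral_of_continuous'
      (f := fun y t => G (t, ξ t + y)) (by simp only [Function.uncurry_def]; fun_prop) a b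
  have hd : HasDerivAt (fun ε => ∫ y in (0:ℝ)..ε, F y) (F 0) 0 :=
    (hFc.integral_hasStrictDerivAt 0 0).hasDerivAt
  have hmin : IsLocalMin (fun ε => ∫ y in (0:ℝ)..ε, F y) 0 := by
    filter_upwards [Metric.ball_mem_nhds (0:ℝ) (by positivity : 0 < r / 4)] with ε hε
    rw [intervalIntegral.integral_same]
    refine nonnegB U Q G hU hQ hG hUs hQs hGs M hM r hr hQU hP ξ hξ a b ε hab fun t ht y hy => ?_
    rw [Metric.mem_ball, Real.dist_eq, sub_zero] at hε
    have h1 := Set.abs_sub_left_of_mem_uIcc hy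
    rw [sub_zero, sub_zero] at h1
    have h2 := hin t ht
    have h3 := abs_add_le (ξ t) y
    rw [Prod.norm_def, max_le_iff, Real.norm_eq_abs, Real.norm_eq_abs]
    constructor <;> linarith [h2.1, h2.2]
  have h0 := hmin.hasDerivAt_eq_zero hd
  simp only [hF, add_zero] at h0
  linarith

lemma cutB (Ω : Set (ℝ × ℝ)) (hΩ : IsOpen Ω) (χ : ContDiffBump (0 : ℝ × ℝ))
    (hχ : Metric.closedBall 0 χ.rOut ⊆ Ω) (f : ℝ × ℝ → ℝ) (hf : ContinuousOn f Ω) :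
    Continuous (fun p => χ p * f p) ∧ HasCompactSupport (fun p => χ p * f p) := by
  refine ⟨?_, χ.hasCompactSupport.mul_right⟩
  refine continuous_of_tsupport fun p hp => ?_
  have hp' : p ∈ Ω := by
    apply hχ
    rw [← χ.tsupport_eq]
    exact tsupport_mul_subset_left hp
  exact χ.continuous.continuousAt.mul (hf.continuousAt (hΩ.mem_nhds hp'))

theorem stmt_10 (Ω : Set (ℝ × ℝ)) (hΩ : IsOpen Ω) (h0 : ((0 : ℝ), (0 : ℝ)) ∈ Ω)
    (u g : ℝ × ℝ → ℝ) (hu : ContinuousOn u Ω) (hu0 : u (0, 0) = 0)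
    (hg : ContinuousOn g Ω) (C : ℝ) (hC : ∀ p ∈ Ω, |g p| ≤ C)
    (hdistr : ∀ φ : ℝ × ℝ → ℝ, ContDiff ℝ (⊤ : ℕ∞) φ → HasCompactSupport φ → tsupport φ ⊆ Ω →
      ∫ p in Ω, (-(u p) * fderiv ℝ φ p (1, 0) + (u p) ^ 2 / 2 * fderiv ℝ φ p (0, 1)) =
        ∫ p in Ω, g p * φ p) :
    ∃ δ : ℝ, 0 < δ ∧ ∃ ξ : ℝ → ℝ, ξ 0 = 0 ∧
      (∀ t ∈ Set.Icc (-δ) δ, (t, ξ t) ∈ Ω) ∧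
      (∀ t ∈ Set.Icc (-δ) δ, HasDerivAt ξ (-(u (t, ξ t))) t) ∧
      (∀ t ∈ Set.Icc (-δ) δ,
        u (t, ξ t) - u (0, 0) = ∫ s in (0:ℝ)..t, g (s, ξ s)) := by
  obtain ⟨R, hR, hRΩ⟩ := Metric.nhds_basis_closedBall.mem_iff.1 (hΩ.mem_nhds h0)
  let χ : ContDiffBump (0 : ℝ × ℝ) := ⟨R / 2, R, by positivity, by linarith⟩
  have hχ : Metric.closedBall 0 χ.rOut ⊆ Ω := hRΩ
  obtain ⟨hU, hUs⟩ := cutB Ω hΩ χ hχ u hu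
  obtain ⟨hQ, hQs⟩ := cutB Ω hΩ χ hχ (fun p => u p ^ 2 / 2) ((hu.pow 2).div_const 2)
  obtain ⟨hG, hGs⟩ := cutB Ω hΩ χ hχ g hg
  have hr : 0 < R / 2 := by positivity
  have hχ1 : ∀ p ∈ Metric.ball (0 : ℝ × ℝ) (R / 2), χ p = 1 := fun p hp =>
    χ.one_of_mem_closedBall (Metric.ball_subset_closedBall hp)
  have hBΩ : Metric.ball (0 : ℝ × ℝ) (R / 2) ⊆ Ω :=
    (Metric.ball_subset_closedBall.trans (Metric.closedBall_subset_closedBall (by linarith))).trans hRΩ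
  have hUe : ∀ p ∈ Metric.ball (0 : ℝ × ℝ) (R / 2), (fun p => χ p * u p) p = u p := by
    intro p hp; simp [hχ1 p hp]
  have hQe : ∀ p ∈ Metric.ball (0 : ℝ × ℝ) (R / 2),
      (fun p => χ p * (u p ^ 2 / 2)) p = u p ^ 2 / 2 := by
    intro p hp; simp [hχ1 p hp]
  have hGe : ∀ p ∈ Metric.ball (0 : ℝ × ℝ) (R / 2), (fun p => χ p * g p) p = g p := by
    intro p hp; simp [hχ1 p hp]
  have hP := fun ρ p => weakB Ω hΩ u g hdistr _ _ _ hU hQ _ hBΩ hUe hQe hGe ρ p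
  set U : ℝ × ℝ → ℝ := fun p => χ p * u p
  set Q : ℝ × ℝ → ℝ := fun p => χ p * (u p ^ 2 / 2)
  set G : ℝ × ℝ → ℝ := fun p => χ p * g p
  obtain ⟨M, hM⟩ := hUs.exists_bound_of_continuous hU
  simp only [Real.norm_eq_abs] at hM
  obtain ⟨ξ, hξ0, hξ⟩ := peanoB (fun p => - U p) hU.neg hUs.neg M (by simpa using hM)
  have hξc : Continuous ξ := continuous_iff_continuousAt.2 fun t => (hξ t).continuousAt
  have hev : ∀ᶠ t in nhds (0:ℝ), |ξ t| < R / 2 / 4 :=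
    (continuous_abs.comp hξc).continuousAt.eventually_lt_const (by simp [hξ0]; exact hR)
  obtain ⟨d, hd, hdξ⟩ := Metric.eventually_nhds_iff.1 hev
  set δ := min (d / 2) (R / 2 / 4) with hδ
  have hδ0 : 0 < δ := by positivity
  have hsm : ∀ t ∈ Set.Icc (-δ) δ, |t| ≤ R / 2 / 4 ∧ |ξ t| ≤ R / 2 / 4 := by
    intro t ht
    have h1 : |t| ≤ δ := abs_le.2 ht
    refine ⟨h1.trans (min_le_right _ _), (hdξ ?_).le⟩
    rw [Real.dist_eq, sub_zero]
    linarith [h1.trans (min_le_left _ _)]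
  have hb : ∀ t ∈ Set.Icc (-δ) δ, (t, ξ t) ∈ Metric.ball (0 : ℝ × ℝ) (R / 2) := by
    intro t ht
    rw [mem_ball_zero_iff, Prod.norm_def, max_lt_iff, Real.norm_eq_abs, Real.norm_eq_abs]
    constructor <;> linarith [(hsm t ht).1, (hsm t ht).2]
  have hz : (0:ℝ) ∈ Set.Icc (-δ) δ := ⟨by linarith, hδ0.le⟩
  have heq : ∀ a ∈ Set.Icc (-δ) δ, ∀ b ∈ Set.Icc (-δ) δ, a ≤ b →
      u (b, ξ b) - u (a, ξ a) = ∫ t in a..b, g (t, ξ t) := by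
    intro a ha b hb' hab
    have hsub : Set.uIcc a b ⊆ Set.Icc (-δ) δ := Set.uIcc_subset_Icc ha hb'
    have := eqB U Q G hU hQ hG hUs hQs hGs M hM (R / 2) hr
      (fun p hp => by rw [hUe p hp, hQe p hp]) hP ξ hξ a b hab (fun t ht => hsm t (hsub ht))
    rw [hUe _ (hb a ha), hUe _ (hb b hb')] at this
    rw [this]
    exact intervalIntegral.integral_congr fun t ht => hGe _ (hb t (hsub ht))
  refine ⟨δ, hδ0, ξ, hξ0, fun t ht => hBΩ (hb t ht), fun t ht => ?_, fun t ht => ?_⟩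
  · rw [← hUe _ (hb t ht)]
    exact hξ t
  · rcases le_total 0 t with h | h
    · have := heq 0 hz t ht h
      rwa [hξ0] at this
    · have := heq t ht 0 hz h
      rw [hξ0] at this
      rw [intervalIntegral.integral_symm, ← this]
      ring
end

section
/- In the first Heisenberg group $\mathbb H^1$ identified with $\mathbb{R}^3$ (coordinates $(x_1,x_2,y)$, with $[X_1,X_2]=Y$), let $\mathbb W=\{x_1=0\}\cong\mathbb{R}^2$ and $\mathbb L=\{(x_1,0,0)\}$. Let $U\subseteq\mathbb W$ be open and $\phi:U\to\mathbb{R}$ continuous, and suppose there is a continuous bounded $\omega:U\to\mathbb{R}$ with $\partial_{x_2}\phi-\partial_y(\phi^2/2)=\omega$ in the distributional sense on $U$. Then $\phi$ is $1/2$-little Hölder continuous in the vertical variable: $\lim_{r\to0}\sup\{|\phi(x_2,y')-\phi(x_2,y)|/|y'-y|^{1/2} : (x_2,y),(x_2,y')\in K,\ 0<|y'-y|<r\}=0$ for every compact $K\subseteq U$. -/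
open MeasureTheory Set Filter Topology

lemma curve_deriv (u : ℝ × ℝ → ℝ) (hu : ContDiff ℝ 1 u) {γ : ℝ → ℝ} {s c z : ℝ}
    (hγ : HasDerivAt γ c s) :
    HasDerivAt (fun s => u (s, γ s + z)) (fderiv ℝ u (s, γ s + z) (1, c)) s := by
  have h1 : HasDerivAt (fun s => (s, γ s + z)) ((1 : ℝ), c) s :=
    (hasDerivAt_id s).prodMk (hγ.add_const z)
  have h2 := (hu.differentiable (by norm_num) (s, γ s + z)).hasFDerivAt
  exact h2.comp_hasDerivAt s h1

lemma vert_deriv (u : ℝ × ℝ → ℝ) (hu : ContDiff ℝ 1 u) (s y z : ℝ) :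
    HasDerivAt (fun z => u (s, y + z)) (fderiv ℝ u (s, y + z) (0, 1)) z := by
  have h1 : HasDerivAt (fun z : ℝ => (s, y + z)) ((0 : ℝ), (1:ℝ)) z :=
    (hasDerivAt_const z s).prodMk ((hasDerivAt_id z).const_add y)
  have h2 := (hu.differentiable (by norm_num) (s, y + z)).hasFDerivAt
  exact h2.comp_hasDerivAt z h1

lemma int_deriv (u g w : ℝ × ℝ → ℝ) (hu : ContDiff ℝ 1 u) (hcu : HasCompactSupport u)
    (hg : ContDiff ℝ 1 g) (hw : Continuous w) (γ : ℝ → ℝ) (s a b : ℝ) (hab : a ≤ b)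
    (hγ : ∀ᶠ s' in 𝓝 s, HasDerivAt γ (-u (s', γ s')) s')
    (heq : ∀ z ∈ Icc a b, fderiv ℝ u (s, γ s + z) (1, 0) - fderiv ℝ g (s, γ s + z) (0, 1)
      = w (s, γ s + z)) :
    HasDerivAt (fun s => ∫ z in a..b, u (s, γ s + z))
      (g (s, γ s + b) - g (s, γ s + a) - u (s, γ s) * (u (s, γ s + b) - u (s, γ s + a))
        + ∫ z in a..b, w (s, γ s + z)) s := by
  have hfc : Continuous (fderiv ℝ u) := hu.continuous_fderiv (by norm_num)
  have hgc : Continuous (fderiv ℝ g) := hg.continuous_fderiv (by norm_num)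
  obtain ⟨B, hB⟩ := (hcu.fderiv (𝕜 := ℝ)).exists_bound_of_continuous hfc
  obtain ⟨B', hB'⟩ := hcu.exists_bound_of_continuous hu.continuous
  have hB0 : 0 ≤ B := (norm_nonneg _).trans (hB 0)
  have hB0' : 0 ≤ B' := (norm_nonneg _).trans (hB' 0)
  have hcl : ∀ s' : ℝ, Continuous fun z : ℝ => (s', γ s' + z) := fun s' => by fun_prop
  have key := intervalIntegral.hasDerivAt_integral_of_dominated_loc_of_deriv_le
    (μ := volume) (a := a) (b := b) (F := fun s z => u (s, γ s + z))
    (F' := fun s z => fderiv ℝ u (s, γ s + z) (1, -u (s, γ s))) (x₀ := s)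
    (bound := fun _ => B * (1 + B')) hγ
    (Eventually.of_forall fun s' => (hu.continuous.comp (hcl s')).aestronglyMeasurable)
    ((hu.continuous.comp (hcl s)).intervalIntegrable _ _)
    (((hfc.comp (hcl s)).clm_apply continuous_const).aestronglyMeasurable)
    (ae_of_all _ fun t _ x _ => by
      refine ((fderiv ℝ u (x, γ x + t)).le_opNorm _).trans ?_
      refine mul_le_mul (hB _) ?_ (norm_nonneg _) hB0
      rw [Prod.norm_def]
      have := hB' (x, γ x)
      simp only [norm_one, norm_neg]
      exact max_le (by linarith) (by linarith))
    (_root_.intervalIntegrable_const)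
    (ae_of_all _ fun t _ x hx => curve_deriv u hu hx)
  have h2 := key.2
  refine h2.congr_deriv (Eq.symm ?_)
  have e1 : ∫ z in a..b, fderiv ℝ u (s, γ s + z) (0, 1) = u (s, γ s + b) - u (s, γ s + a) :=
    intervalIntegral.integral_eq_sub_of_hasDerivAt (fun z _ => vert_deriv u hu s (γ s) z)
      (((hfc.comp (hcl s)).clm_apply continuous_const).intervalIntegrable _ _)
  have e2 : ∫ z in a..b, fderiv ℝ g (s, γ s + z) (0, 1) = g (s, γ s + b) - g (s, γ s + a) :=
    intervalIntegral.integral_eq_sub_of_hasDerivAt (fun z _ => vert_deriv g hg s (γ s) z)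
      (((hgc.comp (hcl s)).clm_apply continuous_const).intervalIntegrable _ _)
  rw [← e1, ← e2, ← intervalIntegral.integral_const_mul, ← intervalIntegral.integral_sub,
    ← intervalIntegral.integral_add]
  · refine intervalIntegral.integral_congr fun z hz => ?_
    rw [uIcc_of_le hab] at hz
    have h := heq z hz
    have : ((1 : ℝ), -u (s, γ s)) = (1, 0) + (-u (s, γ s)) • ((0 : ℝ), (1 : ℝ)) := by simp
    simp only [this, map_add, map_smul, smul_eq_mul]
    rw [← h]; ring
  · exact Continuous.intervalIntegrable (((hgc.comp (hcl s)).clm_apply continuous_const).sub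
      (continuous_const.mul ((hfc.comp (hcl s)).clm_apply continuous_const))) _ _
  · exact (hw.comp (hcl s)).intervalIntegrable _ _
  · exact ((hgc.comp (hcl s)).clm_apply continuous_const).intervalIntegrable _ _
  · exact (continuous_const.mul ((hfc.comp (hcl s)).clm_apply continuous_const)).intervalIntegrable _ _

/-- global characteristics -/
lemma exists_char (u : ℝ × ℝ → ℝ) (hu : ContDiff ℝ 1 u) (hcu : HasCompactSupport u)
    (M : ℝ) (hM : ∀ p, |u p| ≤ M) (x y T : ℝ) (hT : 0 ≤ T) :
    ∃ γ : ℝ → ℝ, γ x = y ∧ ∀ s ∈ Icc x (x + T), ∀ᶠ s' in 𝓝 s, HasDerivAt γ (-u (s', γ s')) s' := by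
  obtain ⟨K, hK⟩ := hu.lipschitzWith_of_hasCompactSupport hcu (by norm_num)
  have hM0 : 0 ≤ M := (abs_nonneg _).trans (hM 0)
  have hx : x ∈ Icc (x - (T + 1)) (x + (T + 1)) := ⟨by linarith, by linarith⟩
  have hPL : IsPicardLindelof (fun s y => - u (s, y)) (tmin := x - (T+1)) (tmax := x + (T+1))
      ⟨x, hx⟩ y ⟨M * (T + 1), by positivity⟩ 0 ⟨M, hM0⟩ K := by
    refine ⟨fun t _ => ?_, fun y' _ => ?_, fun t _ y' _ => ?_, ?_⟩
    · apply LipschitzWith.lipschitzOnWith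
      refine LipschitzWith.of_dist_le_mul fun a b => ?_
      rw [dist_neg_neg]
      refine (hK.dist_le_mul _ _).trans ?_
      rw [Prod.dist_eq]; simp
    · exact (hu.continuous.comp (by fun_prop : Continuous fun s : ℝ => (s, y'))).neg.continuousOn
    · rw [norm_neg]; exact hM (t, y')
    · have : max (x + (T + 1) - x) (x - (x - (T + 1))) = T + 1 := by simp
      show M * max (x + (T + 1) - x) (x - (x - (T + 1))) ≤ M * (T + 1) - 0
      rw [this]; simp
  obtain ⟨γ, h0, h1⟩ := hPL.exists_eq_forall_mem_Icc_hasDerivWithinAt₀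
  refine ⟨γ, h0, fun s hs => ?_⟩
  have : Ioo (x - (T+1)) (x + (T+1)) ∈ 𝓝 s := Ioo_mem_nhds (by linarith [hs.1]) (by linarith [hs.2])
  filter_upwards [this] with s' hs'
  exact (h1 s' (Ioo_subset_Icc_self hs')).hasDerivAt (Icc_mem_nhds hs'.1 hs'.2)

lemma mono_bound {f f' : ℝ → ℝ} {x T c : ℝ}
    (hd : ∀ s ∈ Icc x (x + T), HasDerivAt f (f' s) s) (hc : ∀ s ∈ Icc x (x + T), c ≤ f' s) :
    ∀ s ∈ Icc x (x + T), c * (s - x) ≤ f s - f x := by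
  intro s hs
  refine (convex_Icc x (x + T)).mul_sub_le_image_sub_of_le_deriv
    (fun t ht => (hd t ht).continuousAt.continuousWithinAt)
    (fun t ht => (hd t (interior_subset ht)).differentiableAt.differentiableWithinAt)
    (fun t ht => ?_) x ⟨le_rfl, hs.1.trans hs.2⟩ s hs hs.1
  rw [(hd t (interior_subset ht)).deriv]
  exact hc t (interior_subset ht)

lemma lower_growth (u g w : ℝ × ℝ → ℝ) (hu : ContDiff ℝ 1 u) (hcu : HasCompactSupport u)
    (hg : ContDiff ℝ 1 g) (hw : Continuous w) (γ : ℝ → ℝ) (x T h κ σ m : ℝ) (hh : 0 < h)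
    (hγ : ∀ s ∈ Icc x (x + T), ∀ᶠ s' in 𝓝 s, HasDerivAt γ (-u (s', γ s')) s')
    (hgu : ∀ p, |g p - u p ^ 2 / 2| ≤ κ)
    (hσ : ∀ s y z, |z| ≤ h → |u (s, y + z) - u (s, y)| ≤ σ)
    (heq : ∀ s ∈ Icc x (x + T), ∀ z, |z| ≤ h →
      fderiv ℝ u (s, γ s + z) (1, 0) - fderiv ℝ g (s, γ s + z) (0, 1) = w (s, γ s + z))
    (hm : ∀ s ∈ Icc x (x + T), ∀ z, |z| ≤ h → m ≤ w (s, γ s + z)) :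
    ∀ s ∈ Icc x (x + T), (m - 2 * κ / h) * (s - x) - 2 * σ ≤ u (s, γ s) - u (x, γ x) := by
  have hz : ∀ z ∈ Icc 0 h, |z| ≤ h := fun z hz => abs_le.2 ⟨by linarith [hz.1], hz.2⟩
  have hcl : ∀ s' : ℝ, Continuous fun z : ℝ => (s', γ s' + z) := fun s' => by fun_prop
  have h1 := mono_bound (c := m * h - 2 * κ) (fun s hs =>
    int_deriv u g w hu hcu hg hw γ s 0 h hh.le (hγ s hs) fun z hz' => heq s hs z (hz z hz'))
    (fun s hs => by
      have i1 : m * h ≤ ∫ z in (0:ℝ)..h, w (s, γ s + z) := by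
        have := intervalIntegral.integral_mono_on hh.le (_root_.intervalIntegrable_const)
          ((hw.comp (hcl s)).intervalIntegrable 0 h) (fun z hz' => hm s hs z (hz z hz'))
          (μ := volume)
        simp only [intervalIntegral.integral_const, smul_eq_mul, Function.comp] at this
        linarith
      have a1 := abs_le.1 (hgu (s, γ s + h))
      have a2 := abs_le.1 (hgu (s, γ s))
      simp only [add_zero]
      nlinarith [sq_nonneg (u (s, γ s + h) - u (s, γ s)), a1.1, a2.2])
  have i2 : ∀ s, |(∫ z in (0:ℝ)..h, u (s, γ s + z)) - h * u (s, γ s)| ≤ h * σ := by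
    intro s
    have e : (∫ z in (0:ℝ)..h, u (s, γ s + z)) - h * u (s, γ s)
        = ∫ z in (0:ℝ)..h, (u (s, γ s + z) - u (s, γ s)) := by
      rw [intervalIntegral.integral_sub (f := fun z => u (s, γ s + z)) (g := fun _ => u (s, γ s)) ((hu.continuous.comp (hcl s)).intervalIntegrable 0 h)
        (_root_.intervalIntegrable_const)]
      simp
    rw [e]
    have := intervalIntegral.norm_integral_le_of_norm_le_const (a := 0) (b := h) (C := σ)
      (f := fun z => u (s, γ s + z) - u (s, γ s)) (fun z hz' => by
        rw [uIoc_of_le hh.le] at hz'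
        exact hσ _ _ _ (hz z ⟨hz'.1.le, hz'.2⟩))
    rw [Real.norm_eq_abs, sub_zero, abs_of_pos hh] at this
    linarith
  intro s hs
  have := h1 s hs
  have b1 := abs_le.1 (i2 s)
  have b2 := abs_le.1 (i2 x)
  have e3 : h * (2 * κ / h) = 2 * κ := by field_simp
  refine le_of_mul_le_mul_left ?_ hh
  have e4 : h * ((m - 2 * κ / h) * (s - x) - 2 * σ)
    = (m * h - h * (2 * κ / h)) * (s - x) - 2 * (h * σ) := by ring
  rw [e4, e3]
  linarith [b1.2, b2.1]

lemma upper_growth (u g w : ℝ × ℝ → ℝ) (hu : ContDiff ℝ 1 u) (hcu : HasCompactSupport u)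
    (hg : ContDiff ℝ 1 g) (hw : Continuous w) (γ : ℝ → ℝ) (x T h κ σ m : ℝ) (hh : 0 < h)
    (hγ : ∀ s ∈ Icc x (x + T), ∀ᶠ s' in 𝓝 s, HasDerivAt γ (-u (s', γ s')) s')
    (hgu : ∀ p, |g p - u p ^ 2 / 2| ≤ κ)
    (hσ : ∀ s y z, |z| ≤ h → |u (s, y + z) - u (s, y)| ≤ σ)
    (heq : ∀ s ∈ Icc x (x + T), ∀ z, |z| ≤ h →
      fderiv ℝ u (s, γ s + z) (1, 0) - fderiv ℝ g (s, γ s + z) (0, 1) = w (s, γ s + z))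
    (hm : ∀ s ∈ Icc x (x + T), ∀ z, |z| ≤ h → w (s, γ s + z) ≤ m) :
    ∀ s ∈ Icc x (x + T), u (s, γ s) - u (x, γ x) ≤ (m + 2 * κ / h) * (s - x) + 2 * σ := by
  have hz : ∀ z ∈ Icc (-h) 0, |z| ≤ h := fun z hz => abs_le.2 ⟨hz.1, by linarith [hz.2]⟩
  have hh' : -h ≤ 0 := by linarith
  have hcl : ∀ s' : ℝ, Continuous fun z : ℝ => (s', γ s' + z) := fun s' => by fun_prop
  have h1 := mono_bound (c := - (m * h + 2 * κ)) (fun s hs =>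
    (int_deriv u g w hu hcu hg hw γ s (-h) 0 hh' (hγ s hs)
      fun z hz' => heq s hs z (hz z hz')).neg)
    (fun s hs => by
      have i1 : (∫ z in (-h)..0, w (s, γ s + z)) ≤ m * h := by
        have := intervalIntegral.integral_mono_on hh' 
          ((hw.comp (hcl s)).intervalIntegrable (-h) 0) (_root_.intervalIntegrable_const)
          (fun z hz' => hm s hs z (hz z hz'))
          (μ := volume)
        simp only [intervalIntegral.integral_const, smul_eq_mul, Function.comp] at this
        linarith
      have a1 := abs_le.1 (hgu (s, γ s + -h))
      have a2 := abs_le.1 (hgu (s, γ s))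
      simp only [add_zero]
      nlinarith [sq_nonneg (u (s, γ s + -h) - u (s, γ s)), a1.1, a2.2])
  have i2 : ∀ s, |(∫ z in (-h)..0, u (s, γ s + z)) - h * u (s, γ s)| ≤ h * σ := by
    intro s
    have e : (∫ z in (-h)..0, u (s, γ s + z)) - h * u (s, γ s)
        = ∫ z in (-h)..0, (u (s, γ s + z) - u (s, γ s)) := by
      rw [intervalIntegral.integral_sub (f := fun z => u (s, γ s + z)) (g := fun _ => u (s, γ s)) ((hu.continuous.comp (hcl s)).intervalIntegrable (-h) 0)
        (_root_.intervalIntegrable_const)]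
      simp
    rw [e]
    have := intervalIntegral.norm_integral_le_of_norm_le_const (a := -h) (b := 0) (C := σ)
      (f := fun z => u (s, γ s + z) - u (s, γ s)) (fun z hz' => by
        rw [uIoc_of_le hh'] at hz'
        exact hσ _ _ _ (hz z ⟨hz'.1.le, hz'.2⟩))
    rw [Real.norm_eq_abs, sub_neg_eq_add, zero_add, abs_of_pos hh] at this
    linarith
  intro s hs
  have := h1 s hs
  simp only [Pi.neg_apply] at this
  have b1 := abs_le.1 (i2 s)
  have b2 := abs_le.1 (i2 x)
  have e3 : h * (2 * κ / h) = 2 * κ := by field_simp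
  refine le_of_mul_le_mul_left ?_ hh
  have e4 : h * ((m + 2 * κ / h) * (s - x) + 2 * σ)
    = (m * h + h * (2 * κ / h)) * (s - x) + 2 * (h * σ) := by ring
  rw [e4, e3]
  linarith [b1.2, b2.1]

def BApprox (S : Set (ℝ × ℝ)) (φ ω : ℝ × ℝ → ℝ) : Prop :=
  ∀ κ : ℝ, 0 < κ → ∃ u g w : ℝ × ℝ → ℝ, ContDiff ℝ 1 u ∧ HasCompactSupport u ∧
    ContDiff ℝ 1 g ∧ Continuous w ∧ (∀ p, |u p - φ p| ≤ κ) ∧ (∀ p, |g p - u p ^ 2 / 2| ≤ κ) ∧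
    (∀ p, |w p - ω p| ≤ κ) ∧
    ∀ p ∈ S, fderiv ℝ u p (1, 0) - fderiv ℝ g p (0, 1) = w p

lemma core_s11 (S : Set (ℝ × ℝ)) (φ ω : ℝ × ℝ → ℝ) (hA : BApprox S φ ω)
    (hφ : UniformContinuous φ) (M : ℝ) (hM : ∀ p, |φ p| ≤ M)
    (x y₁ y₂ w₀ η T R : ℝ) (hT : 0 < T) (hy : y₁ < y₂) (hR : (y₂ - y₁) + (M + 1) * T + 1 * T ≤ R)
    (hS : ∀ t y, |t - x| ≤ T → |y - y₁| ≤ R → (t, y) ∈ S ∧ |ω (t, y) - w₀| ≤ η)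
    (hη : 8 * η * T ≤ φ (x, y₂) - φ (x, y₁))
    (hTd : 4 * (y₂ - y₁) ≤ (φ (x, y₂) - φ (x, y₁)) * T) : False := by
  set Δ := φ (x, y₂) - φ (x, y₁) with hΔ
  have hΔ0 : 0 < Δ := by
    by_contra hcon
    push Not at hcon
    nlinarith
  -- choose h from uniform continuity
  obtain ⟨h₀, hh₀, hh₀'⟩ := Metric.uniformContinuous_iff.1 hφ (Δ / 64) (by positivity)
  obtain ⟨h, hh, hhT, hhh⟩ : ∃ h, 0 < h ∧ h ≤ T ∧ h < h₀ :=
    ⟨min T (h₀ / 2), by positivity, min_le_left _ _, (min_le_right _ _).trans_lt (by linarith)⟩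
  obtain ⟨κ, hκ, hκ1, hκΔ, hκT, hκh⟩ : ∃ κ, 0 < κ ∧ κ ≤ 1 ∧ κ ≤ Δ / 256 ∧ 2 * κ * T ≤ Δ / 64
      ∧ 4 * κ / h * T ≤ Δ / 64 := by
    refine ⟨min (min 1 (Δ / 256)) (min (Δ / (128 * T)) (Δ * h / (256 * T))), by positivity, ?_, ?_, ?_, ?_⟩
    · exact (min_le_left _ _).trans (min_le_left _ _)
    · exact (min_le_left _ _).trans (min_le_right _ _)
    · have : min (min 1 (Δ / 256)) (min (Δ / (128 * T)) (Δ * h / (256 * T))) ≤ Δ / (128 * T) :=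
        (min_le_right _ _).trans (min_le_left _ _)
      rw [le_div_iff₀ (by positivity)] at this
      linarith
    · have : min (min 1 (Δ / 256)) (min (Δ / (128 * T)) (Δ * h / (256 * T))) ≤ Δ * h / (256 * T) :=
        (min_le_right _ _).trans (min_le_right _ _)
      rw [le_div_iff₀ (by positivity)] at this
      rw [div_mul_eq_mul_div, div_le_iff₀ hh]
      linarith
  obtain ⟨u, g, w, hu, hcu, hg, hw, huφ, hgu, hwω, heq⟩ := hA κ hκ
  have huM : ∀ p, |u p| ≤ M + 1 := fun p => by
    have h1 := abs_le.1 (huφ p)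
    have h2 := abs_le.1 (hM p)
    exact abs_le.2 ⟨by linarith, by linarith⟩
  have hσ : ∀ s y z, |z| ≤ h → |u (s, y + z) - u (s, y)| ≤ Δ / 64 + 2 * κ := by
    intro s y z hz
    have hd : dist (s, y + z) (s, y) < h₀ := by
      rw [Prod.dist_eq]; simp; linarith
    have h1 := (hh₀' hd).le
    rw [Real.dist_eq] at h1
    have h1 := abs_le.1 h1
    have h2 := abs_le.1 (huφ (s, y + z))
    have h3 := abs_le.1 (huφ (s, y))
    exact abs_le.2 ⟨by linarith, by linarith⟩
  obtain ⟨γ₁, h10, h1⟩ := exists_char u hu hcu (M + 1) huM x y₁ T hT.le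
  obtain ⟨γ₂, h20, h2⟩ := exists_char u hu hcu (M + 1) huM x y₂ T hT.le
  have hM0 : 0 ≤ M + 1 := (abs_nonneg _).trans (huM 0)
  -- curves stay close
  have hstay : ∀ γ : ℝ → ℝ, (∀ s ∈ Icc x (x + T), ∀ᶠ s' in 𝓝 s, HasDerivAt γ (-u (s', γ s')) s') →
      |γ x - y₁| ≤ y₂ - y₁ → ∀ s ∈ Icc x (x + T), ∀ z, |z| ≤ h → 
        (s, γ s + z) ∈ S ∧ |ω (s, γ s + z) - w₀| ≤ η := by
    intro γ hγ hγx s hs z hz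
    have l1 := mono_bound (c := -(M + 1)) (fun s hs => (hγ s hs).self_of_nhds)
      (fun s hs => by linarith [(abs_le.1 (huM (s, γ s))).2]) s hs
    have l2 := mono_bound (c := -(M + 1)) (fun s hs => (hγ s hs).self_of_nhds.neg)
      (fun s hs => by linarith [(abs_le.1 (huM (s, γ s))).1]) s hs
    simp only [Pi.neg_apply] at l2
    have hsT : s - x ≤ T := by linarith [hs.2]
    have hsx : 0 ≤ s - x := by linarith [hs.1]
    have l3 : (M + 1) * (s - x) ≤ (M + 1) * T := mul_le_mul_of_nonneg_left hsT hM0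
    have a1 := abs_le.1 hγx
    have a2 := abs_le.1 hz
    refine hS s (γ s + z) (abs_le.2 ⟨by linarith, hsT⟩) (abs_le.2 ⟨by linarith, by linarith⟩)
  have st1 := hstay γ₁ h1 (by rw [h10]; simp; linarith)
  have st2 := hstay γ₂ h2 (by rw [h20, abs_of_pos (by linarith)])
  have g2 := lower_growth u g w hu hcu hg hw γ₂ x T h κ _ (w₀ - η - κ) hh h2 hgu hσ
    (fun s hs z hz => heq _ (st2 s hs z hz).1)
    (fun s hs z hz => by
      have b1 := abs_le.1 (hwω (s, γ₂ s + z))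
      have b2 := abs_le.1 (st2 s hs z hz).2
      linarith)
  have g1 := upper_growth u g w hu hcu hg hw γ₁ x T h κ _ (w₀ + η + κ) hh h1 hgu hσ
    (fun s hs z hz => heq _ (st1 s hs z hz).1)
    (fun s hs z hz => by
      have b1 := abs_le.1 (hwω (s, γ₁ s + z))
      have b2 := abs_le.1 (st1 s hs z hz).2
      linarith)
  have hη0 : 0 ≤ η := by
    have := (st1 x ⟨le_rfl, by linarith⟩ 0 (by simp [hh.le])).2
    exact (abs_nonneg _).trans this
  have hgap : ∀ s ∈ Icc x (x + T), Δ / 2 ≤ u (s, γ₂ s) - u (s, γ₁ s) := by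
    intro s hs
    have c1 := g1 s hs
    have c2 := g2 s hs
    rw [h10] at c1
    rw [h20] at c2
    have d1 := abs_le.1 (huφ (x, y₁))
    have d2 := abs_le.1 (huφ (x, y₂))
    have hsT : s - x ≤ T := by linarith [hs.2]
    have e1 : (2 * η + 2 * κ + 4 * κ / h) * (s - x) ≤ (2 * η + 2 * κ + 4 * κ / h) * T :=
      mul_le_mul_of_nonneg_left hsT (by positivity)
    have e2 : (w₀ - η - κ - 2 * κ / h) * (s - x) - (w₀ + η + κ + 2 * κ / h) * (s - x)
      = - ((2 * η + 2 * κ + 4 * κ / h) * (s - x)) := by ring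
    have e3 : (2 * η + 2 * κ + 4 * κ / h) * T = 2 * η * T + 2 * κ * T + 4 * κ / h * T := by ring
    linarith
  have hD := mono_bound (c := Δ / 2) (fun s hs => (h1 s hs).self_of_nhds.sub (h2 s hs).self_of_nhds)
    (fun s hs => by linarith [hgap s hs]) (x + T) ⟨by linarith, le_rfl⟩
  simp only [Pi.sub_apply] at hD
  rw [h10, h20] at hD
  have hcont : ContinuousOn (fun s => γ₂ s - γ₁ s) (Icc x (x + T)) := fun s hs =>
    ((h2 s hs).self_of_nhds.continuousAt.sub (h1 s hs).self_of_nhds.continuousAt).continuousWithinAt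
  obtain ⟨s, hs, hs0⟩ := intermediate_value_Icc' (by linarith) hcont
    (show (0:ℝ) ∈ Icc _ _ from ⟨by linarith, by rw [h10, h20]; linarith⟩)
  have := hgap s hs
  have e : γ₂ s = γ₁ s := by simpa [sub_eq_zero] using hs0
  rw [e] at this
  linarith

lemma BApprox.reflect {S : Set (ℝ × ℝ)} {φ ω : ℝ × ℝ → ℝ} (hA : BApprox S φ ω) :
    BApprox ((fun p : ℝ × ℝ => (-p.1, p.2)) ⁻¹' S) (fun p => - φ (-p.1, p.2))
      (fun p => ω (-p.1, p.2)) := by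
  intro κ hκ
  obtain ⟨u, g, w, hu, hcu, hg, hw, huφ, hgu, hwω, heq⟩ := hA κ hκ
  let L : (ℝ × ℝ) ≃L[ℝ] (ℝ × ℝ) := (ContinuousLinearEquiv.neg ℝ : ℝ ≃L[ℝ] ℝ).prodCongr (.refl ℝ ℝ)
  have hL : ∀ p, L p = (-p.1, p.2) := fun p => rfl
  have hLd : ∀ f : ℝ × ℝ → ℝ, ContDiff ℝ 1 f → ∀ p v, fderiv ℝ (fun p : ℝ × ℝ => f (-p.1, p.2)) p v
      = fderiv ℝ f (-p.1, p.2) (-v.1, v.2) := by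
    intro f hf p v
    have h2 := (hf.differentiable (by norm_num) (L p)).hasFDerivAt
    have := (h2.comp p L.hasFDerivAt).fderiv
    have e : (f ∘ L) = (fun p : ℝ × ℝ => f (-p.1, p.2)) := rfl
    rw [e] at this
    rw [this]
    rfl
  refine ⟨fun p => - u (-p.1, p.2), fun p => g (-p.1, p.2), fun p => w (-p.1, p.2), ?_, ?_, ?_, ?_,
    ?_, ?_, ?_, ?_⟩
  · exact (hu.comp L.contDiff).neg
  · exact (hcu.comp_homeomorph L.toHomeomorph).comp_left (g := fun x : ℝ => -x) (by norm_num)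
  · exact hg.comp L.contDiff
  · exact hw.comp L.continuous
  · intro p
    have := huφ (-p.1, p.2)
    rw [abs_sub_comm] at this
    rwa [neg_sub_neg]
  · intro p
    simpa using hgu (-p.1, p.2)
  · intro p; exact hwω _
  · intro p hp
    have := heq _ hp
    rw [fderiv_fun_neg, neg_apply, hLd u hu, hLd g hg]
    refine Eq.trans ?_ this
    have e : ((-1 : ℝ), (0:ℝ)) = -((1:ℝ), (0:ℝ)) := by simp
    simp only [neg_zero]
    rw [e, map_neg, neg_neg]

lemma conv_fderiv (ρ f : ℝ × ℝ → ℝ) (hρ : ContDiff ℝ 1 ρ) (hcρ : HasCompactSupport ρ)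
    (hf : Continuous f) (p v : ℝ × ℝ) :
    fderiv ℝ (convolution ρ f (ContinuousLinearMap.lsmul ℝ ℝ) volume) p v
      = ∫ q, fderiv ℝ ρ (p - q) v * f q := by
  have h := (hcρ.hasFDerivAt_convolution_left (ContinuousLinearMap.lsmul ℝ ℝ) hρ
    (hf.locallyIntegrable (μ := volume)) p).fderiv
  rw [h, convolution_eq_swap, ContinuousLinearMap.integral_apply]
  · rfl
  · have hd : Continuous fun q => fderiv ℝ ρ (p - q) :=
      (hρ.continuous_fderiv (by norm_num)).comp (by fun_prop)
    refine Continuous.integrable_of_hasCompactSupport (by fun_prop) ?_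
    have h1 : HasCompactSupport fun q => fderiv ℝ ρ (p - q) :=
      (hcρ.fderiv (𝕜 := ℝ)).comp_homeomorph (Homeomorph.subLeft p)
    refine h1.mono' ?_
    refine (Function.support_subset_iff'.2 fun q hq => ?_).trans subset_closure
    simp only [Function.mem_support, not_not] at hq
    simp [hq]

lemma bapprox (U : Set (ℝ × ℝ))
    (φ ω : ℝ × ℝ → ℝ)
    (hdistr : ∀ ξ : ℝ × ℝ → ℝ, ContDiff ℝ (⊤ : ℕ∞) ξ → HasCompactSupport ξ → tsupport ξ ⊆ U →
      ∫ p in U, (-(φ p) * fderiv ℝ ξ p (1, 0) + (φ p) ^ 2 / 2 * fderiv ℝ ξ p (0, 1)) =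
        ∫ p in U, ω p * ξ p)
    (K₁ S : Set (ℝ × ℝ)) (hKU : K₁ ⊆ U) (r₀ : ℝ) (hr₀ : 0 < r₀)
    (hS : ∀ p ∈ S, Metric.closedBall p r₀ ⊆ K₁)
    (f o : ℝ × ℝ → ℝ) (hf : Continuous f) (ho : Continuous o)
    (hcf : HasCompactSupport f) (hco : HasCompactSupport o)
    (hfφ : ∀ p ∈ K₁, f p = φ p) (hoω : ∀ p ∈ K₁, o p = ω p) : BApprox S f o := by
  intro κ hκ
  obtain ⟨M, hM⟩ := hcf.exists_bound_of_continuous hf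
  have hM0 : 0 ≤ M := (norm_nonneg _).trans (hM 0)
  obtain ⟨κ', hκ', hκ1, hκκ, hκM⟩ : ∃ κ', 0 < κ' ∧ κ' ≤ 1 ∧ κ' ≤ κ ∧ κ' * (M + 2) ≤ κ := by
    refine ⟨min 1 (κ / (M + 2)), by positivity, min_le_left _ _, ?_, ?_⟩
    · exact (min_le_right _ _).trans (div_le_self hκ.le (by linarith))
    · rw [← le_div_iff₀ (by positivity)]; exact min_le_right _ _
  have hf2 : Continuous fun p => f p ^ 2 / 2 := by fun_prop
  have hcf2 : HasCompactSupport fun p => f p ^ 2 / 2 :=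
    hcf.comp_left (g := fun x => x ^ 2 / 2) (by norm_num)
  have huc : ∀ k : ℝ × ℝ → ℝ, Continuous k → HasCompactSupport k → ∃ r > 0, ∀ p q,
      dist p q < r → dist (k p) (k q) < κ' := fun k hk hck => by
    obtain ⟨r, hr, h⟩ := Metric.uniformContinuous_iff.1
      (hck.uniformContinuous_of_continuous hk) κ' hκ'
    exact ⟨r, hr, fun p q h' => h h'⟩
  obtain ⟨r1, hr1, h1⟩ := huc f hf hcf
  obtain ⟨r2, hr2, h2⟩ := huc _ hf2 hcf2
  obtain ⟨r3, hr3, h3⟩ := huc o ho hco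
  obtain ⟨r, hr, hrr0, hrr1, hrr2, hrr3⟩ : ∃ r, 0 < r ∧ r ≤ r₀ ∧ r ≤ r1 ∧ r ≤ r2 ∧ r ≤ r3 :=
    ⟨min (min r₀ r1) (min r2 r3), by positivity, by simp, by simp, by simp, by simp⟩
  let b : ContDiffBump (0 : ℝ × ℝ) := ⟨r / 2, r, by positivity, by linarith⟩
  have hbr : b.rOut = r := rfl
  set ρ : ℝ × ℝ → ℝ := b.normed volume with hρdef
  have hρs : ∀ n : ℕ∞, ContDiff ℝ n ρ := fun n => b.contDiff_normed
  have hcρ : HasCompactSupport ρ := b.hasCompactSupport_normed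
  have hρ1 : ContDiff ℝ 1 ρ := hρs 1
  have hconv : ∀ k : ℝ × ℝ → ℝ, Continuous k → (∀ p q, dist p q < r → dist (k p) (k q) < κ') →
      ∀ p, |convolution ρ k (ContinuousLinearMap.lsmul ℝ ℝ) volume p - k p| ≤ κ' := by
    intro k hk hk' p
    rw [← Real.dist_eq]
    exact b.dist_normed_convolution_le hk.aestronglyMeasurable fun x hx => (hk' x p hx).le
  have hsm : ∀ k : ℝ × ℝ → ℝ, Continuous k →
      ContDiff ℝ 1 (convolution ρ k (ContinuousLinearMap.lsmul ℝ ℝ) volume) := fun k hk =>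
    hcρ.contDiff_convolution_left (n := 1) _ (hρs 1) hk.locallyIntegrable
  have c1 := hconv f hf fun p q h => h1 p q (h.trans_le hrr1)
  have c2 := hconv _ hf2 fun p q h => h2 p q (h.trans_le hrr2)
  have c3 := hconv o ho fun p q h => h3 p q (h.trans_le hrr3)
  refine ⟨_, _, _, hsm f hf, HasCompactSupport.convolution _ hcρ hcf, hsm _ hf2,
    (hsm o ho).continuous, fun p => (c1 p).trans hκκ, fun p => ?_, fun p => (c3 p).trans hκκ, ?_⟩
  · have a1 := c1 p
    have a2 := abs_le.1 (c2 p)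
    have a3 := hM p
    rw [Real.norm_eq_abs] at a3
    generalize convolution ρ f (ContinuousLinearMap.lsmul ℝ ℝ) volume p = u at *
    have e : |f p ^ 2 / 2 - u ^ 2 / 2| ≤ κ' * (M + 1) := by
      have : f p ^ 2 / 2 - u ^ 2 / 2 = -(u - f p) * ((2 * f p + (u - f p)) / 2) := by ring
      rw [this, abs_mul, abs_neg]
      refine mul_le_mul a1 ?_ (abs_nonneg _) hκ'.le
      have b1 := abs_le.1 a1
      have b2 := abs_le.1 a3
      exact abs_le.2 ⟨by linarith, by linarith⟩
    have e := abs_le.1 e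
    exact abs_le.2 ⟨by linarith, by linarith⟩
  · intro p hp
    rw [conv_fderiv ρ f hρ1 hcρ hf, conv_fderiv ρ _ hρ1 hcρ hf2, convolution_eq_swap]
    set ξ : ℝ × ℝ → ℝ := fun q => ρ (p - q) with hξ
    have hξs : ContDiff ℝ (⊤ : ℕ∞) ξ := (hρs ⊤).comp (by fun_prop)
    have hcξ : HasCompactSupport ξ := hcρ.comp_homeomorph (Homeomorph.subLeft p)
    have hξ0 : ∀ q, q ∉ K₁ → q ∉ tsupport ξ := by
      intro q hq hq'
      have : tsupport ξ ⊆ Metric.closedBall p r := by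
        refine closure_minimal ?_ Metric.isClosed_closedBall
        intro z hz
        have : p - z ∈ Function.support ρ := hz
        rw [hρdef, b.support_normed_eq, mem_ball_zero_iff, ← dist_eq_norm, dist_comm] at this
        exact Metric.ball_subset_closedBall this
      exact hq (hS p hp (Metric.closedBall_subset_closedBall hrr0 (this hq')))
    have hdξ : ∀ q v, fderiv ℝ ξ q v = - fderiv ℝ ρ (p - q) v := by
      intro q v
      have h2 := (hρ1.differentiable (by norm_num) (p - q)).hasFDerivAt
      have h3 : HasFDerivAt (fun q : ℝ × ℝ => p - q) (-(ContinuousLinearMap.id ℝ (ℝ × ℝ))) q :=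
        (hasFDerivAt_id q).const_sub p
      have := (h2.comp q h3).fderiv
      have e : (ρ ∘ fun q => p - q) = ξ := rfl
      rw [e] at this
      rw [this]; simp
    have htU : tsupport ξ ⊆ U := fun q hq => hKU (by_contra fun h => hξ0 q h hq)
    have hd := hdistr ξ hξs hcξ htU
    have hfd0 : ∀ q, q ∉ tsupport ξ → fderiv ℝ ξ q = 0 := fun q hq =>
      image_eq_zero_of_notMem_tsupport fun h => hq (tsupport_fderiv_subset ℝ h)
    rw [setIntegral_eq_integral_of_forall_compl_eq_zero, 
      setIntegral_eq_integral_of_forall_compl_eq_zero] at hd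
    · rw [← integral_sub]
      · have el : ∫ q, (-(φ q) * fderiv ℝ ξ q (1, 0) + (φ q) ^ 2 / 2 * fderiv ℝ ξ q (0, 1))
          = ∫ q, (fderiv ℝ ρ (p - q) (1, 0) * f q - fderiv ℝ ρ (p - q) (0, 1) * (f q ^ 2 / 2)) := by
          refine integral_congr_ae (ae_of_all _ fun q => ?_)
          by_cases hq : q ∈ K₁
          · simp only [hdξ, hfφ q hq]; ring
          · have h0 := hfd0 q (hξ0 q hq)
            have z1 := hdξ q (1, 0)
            have z2 := hdξ q (0, 1)
            rw [h0] at z1 z2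
            simp only [zero_apply] at z1 z2
            have z1 : fderiv ℝ ρ (p - q) (1, 0) = 0 := by linarith
            have z2 : fderiv ℝ ρ (p - q) (0, 1) = 0 := by linarith
            simp only [h0, z1, z2]; simp
        have er : ∫ q, ω q * ξ q = ∫ q, (ContinuousLinearMap.lsmul ℝ ℝ) (ρ (p - q)) (o q) := by
          refine integral_congr_ae (ae_of_all _ fun q => ?_)
          by_cases hq : q ∈ K₁
          · simp [hoω q hq, hξ, mul_comm]
          · have : ξ q = 0 := image_eq_zero_of_notMem_tsupport (hξ0 q hq)
            have h' : ρ (p - q) = 0 := this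
            simp [this, h']
        rw [← el, ← er, hd]
      · have hcd : Continuous fun q => fderiv ℝ ρ (p - q) (1, 0) :=
          ((hρ1.continuous_fderiv (by norm_num)).comp (by fun_prop)).clm_apply continuous_const
        exact (hcd.mul hf).integrable_of_hasCompactSupport hcf.mul_left
      · have hcd : Continuous fun q => fderiv ℝ ρ (p - q) (0, 1) :=
          ((hρ1.continuous_fderiv (by norm_num)).comp (by fun_prop)).clm_apply continuous_const
        exact (hcd.mul hf2).integrable_of_hasCompactSupport hcf2.mul_left
    · intro q hq
      rw [image_eq_zero_of_notMem_tsupport (fun h => hq (htU h)), mul_zero]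
    · intro q hq
      rw [hfd0 q (fun h => hq (htU h))]; simp

lemma exists_ext (K : Set (ℝ × ℝ)) (hK : IsCompact K) (f : ℝ × ℝ → ℝ) (hf : ContinuousOn f K) :
    ∃ F : ℝ × ℝ → ℝ, Continuous F ∧ HasCompactSupport F ∧ ∀ p ∈ K, F p = f p := by
  obtain ⟨G, hG⟩ := ContinuousMap.exists_restrict_eq hK.isClosed ⟨K.domRestrict f, hf.domRestrict⟩
  obtain ⟨χ, h1, -, h3, -⟩ := exists_continuous_one_zero_of_isCompact hK isClosed_empty
    (disjoint_empty K)
  refine ⟨fun p => χ p * G p, by fun_prop, h3.mul_right, fun p hp => ?_⟩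
  have e1 : χ p = 1 := h1 hp
  have e2 : G p = f p := congrArg (fun k : C(K, ℝ) => k ⟨p, hp⟩) hG
  show χ p * G p = f p
  rw [e1, e2, one_mul]

theorem stmt_11 (U : Set (ℝ × ℝ)) (hU : IsOpen U)
    (φ ω : ℝ × ℝ → ℝ) (hφ : ContinuousOn φ U) (hω : ContinuousOn ω U)
    (C : ℝ) (hC : ∀ p ∈ U, |ω p| ≤ C)
    (hdistr : ∀ ξ : ℝ × ℝ → ℝ, ContDiff ℝ (⊤ : ℕ∞) ξ → HasCompactSupport ξ → tsupport ξ ⊆ U →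
      ∫ p in U, (-(φ p) * fderiv ℝ ξ p (1, 0) + (φ p) ^ 2 / 2 * fderiv ℝ ξ p (0, 1)) =
        ∫ p in U, ω p * ξ p) :
    ∀ K : Set (ℝ × ℝ), IsCompact K → K ⊆ U →
      ∀ ε : ℝ, 0 < ε → ∃ r : ℝ, 0 < r ∧
        ∀ x y y' : ℝ, (x, y) ∈ K → (x, y') ∈ K → 0 < |y' - y| → |y' - y| < r →
          |φ (x, y') - φ (x, y)| ≤ ε * |y' - y| ^ ((1 : ℝ) / 2) := by
  intro K hK hKU ε hε
  obtain ⟨r₀, hr₀, hrU⟩ := hK.exists_cthickening_subset_open hU hKU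
  have hK₁ : IsCompact (Metric.cthickening r₀ K) := hK.cthickening
  obtain ⟨f, hf, hcf, hfφ⟩ := exists_ext _ hK₁ φ (hφ.mono hrU)
  obtain ⟨o, ho, hco, hoω⟩ := exists_ext _ hK₁ ω (hω.mono hrU)
  have hA : BApprox (Metric.cthickening (r₀ / 2) K) f o := by
    refine bapprox U φ ω hdistr _ _ hrU (r₀ / 2) (by positivity) ?_ f o hf ho hcf hco hfφ hoω
    intro p hp
    refine (Metric.closedBall_subset_cthickening hp _).trans ?_
    refine (Metric.cthickening_cthickening_subset (by positivity) (by positivity) K).trans ?_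
    rw [add_halves]
  have hfu := hcf.uniformContinuous_of_continuous hf
  obtain ⟨M, hM⟩ := hcf.exists_bound_of_continuous hf
  have hM0 : 0 ≤ M := (norm_nonneg _).trans (hM 0)
  obtain ⟨R₀, hR₀, hoR⟩ := Metric.uniformContinuous_iff.1
    (hco.uniformContinuous_of_continuous ho) (ε ^ 2 / 32) (by positivity)
  obtain ⟨R, hR, hRr, hRR⟩ : ∃ R, 0 < R ∧ R ≤ r₀ / 2 ∧ R < R₀ :=
    ⟨min (r₀ / 2) (R₀ / 2), by positivity, min_le_left _ _,
      (min_le_right _ _).trans_lt (by linarith)⟩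
  -- smallness
  set A : ℝ := 4 / ε * (M + 2) + 1 with hAdef
  have hApos : 0 < A := by positivity
  have hA1 : 1 ≤ A := by rw [hAdef]; linarith [show 0 ≤ 4 / ε * (M + 2) by positivity]
  -- the ordered claim
  have main : ∀ x y₁ y₂ : ℝ, (x, y₁) ∈ K → y₁ < y₂ → y₂ - y₁ < min 1 ((R / A) ^ 2) →
      |f (x, y₂) - f (x, y₁)| ≤ ε * √(y₂ - y₁) := by
    intro x y₁ y₂ hp hy hδ
    by_contra hcon
    push Not at hcon
    set δ := y₂ - y₁ with hδdef
    have hδ0 : 0 < δ := by linarith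
    set q := √δ with hq
    have hq0 : 0 < q := Real.sqrt_pos.2 hδ0
    have hqq : q * q = δ := Real.mul_self_sqrt hδ0.le
    have hq1 : q < 1 := by
      have : δ < 1 := hδ.trans_le (min_le_left _ _)
      nlinarith
    have hqR : q * A < R := by
      have : q < R / A := by
        rw [hq]; exact (Real.sqrt_lt' (by positivity)).2 (hδ.trans_le (min_le_right _ _))
      rwa [lt_div_iff₀ hApos] at this
    set Δ := |f (x, y₂) - f (x, y₁)| with hΔ
    have hΔ0 : 0 < Δ := lt_trans (by positivity) hcon
    set T := 4 * q / ε with hTdef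
    have hT : 0 < T := by positivity
    have hTε : T * ε = 4 * q := by rw [hTdef]; field_simp
    have hRb : δ + (M + 1) * T + 1 * T ≤ R := by
      have : q * A = (M + 2) * T + q := by rw [hAdef, hTdef]; ring
      nlinarith
    have hTR : T ≤ R := by nlinarith
    have hηT : 8 * (ε ^ 2 / 32) * T ≤ Δ := by
      have : 8 * (ε ^ 2 / 32) * T = ε * q := by
        have : 8 * (ε ^ 2 / 32) * T = ε / 4 * (T * ε) := by ring
        rw [this, hTε]; ring
      linarith
    have hΔT : 4 * δ ≤ Δ * T := by
      have : ε * q * T = 4 * δ := by rw [← hqq]; linear_combination q * hTε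
      nlinarith
    have hreg : ∀ t y, |t - x| ≤ T → |y - y₁| ≤ R → (t, y) ∈ Metric.cthickening (r₀ / 2) K ∧
        |o (t, y) - o (x, y₁)| ≤ ε ^ 2 / 32 := by
      intro t y ht hy'
      have hd : dist (t, y) (x, y₁) ≤ R := by
        rw [Prod.dist_eq]; exact max_le (by rw [Real.dist_eq]; linarith) hy'
      exact ⟨Metric.mem_cthickening_of_dist_le _ _ _ _ hp (hd.trans hRr),
        (hoR (hd.trans_lt hRR)).le⟩
    rcases le_total 0 (f (x, y₂) - f (x, y₁)) with hs | hs
    · have hΔe : Δ = f (x, y₂) - f (x, y₁) := abs_of_nonneg hs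
      rw [hΔe] at hηT hΔT
      exact core_s11 _ f o hA hfu M hM x y₁ y₂ (o (x, y₁)) (ε ^ 2 / 32) T R hT hy hRb hreg hηT hΔT
    · have hΔe : Δ = -f (x, y₂) - -f (x, y₁) := by rw [hΔ, abs_of_nonpos hs]; ring
      rw [hΔe] at hηT hΔT
      have hfu' : UniformContinuous fun p : ℝ × ℝ => - f (-p.1, p.2) :=
        (hfu.comp (uniformContinuous_fst.neg.prodMk uniformContinuous_snd)).neg
      refine core_s11 _ _ _ hA.reflect hfu' M (fun p => ?_) (-x) y₁ y₂ (o (x, y₁)) (ε ^ 2 / 32) T R hT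
        hy hRb ?_ ?_ ?_
      · rw [abs_neg]; exact hM _
      · intro t y ht hy'
        refine hreg (-t) y ?_ hy'
        rw [← abs_neg]; convert ht using 2; ring
      · simpa using hηT
      · simpa using hΔT
  refine ⟨min 1 ((R / A) ^ 2), by positivity, fun x y y' hy hy' h0 hr => ?_⟩
  rw [← Real.sqrt_eq_rpow]
  have hsub := Metric.self_subset_cthickening (δ := r₀) K
  rw [← hfφ _ (hsub hy), ← hfφ _ (hsub hy')]
  rcases lt_trichotomy y y' with h | h | h
  · rw [abs_of_pos (sub_pos.2 h)] at hr ⊢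
    exact main x y y' hy h hr
  · simp [h] at h0
  · rw [abs_sub_comm y' y, abs_of_pos (sub_pos.2 h)] at hr ⊢
    rw [abs_sub_comm]
    exact main x y' y hy' h hr
end
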